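/- arXiv:2210.01722 — 8 statements merged into one kernel-verified Lean document; each statement's English description precedes it below -/
import Mathlib

section
/- Let n ≥ 3 and let f_i(x) = xᵀA_ix + 2b_iᵀx + c_i, i ∈ [m], define S = {x ∈ ℝⁿ : f_i(x) < 0 for all i ∈ [m]}. Suppose the matrices Q_1,…,Q_m satisfy one of the following: (a) there exist indices i_1, i_2 ∈ [m] such that every Q_i lies in the span of Q_{i_1}, Q_{i_2}; or (b) there exist indices i_1, i_2, i_3 ∈ [m] such that every Q_i lies in the span of Q_{i_1}, Q_{i_2}, Q_{i_3} and Q_{i_1}, Q_{i_2}, Q_{i_3} satisfy PDLC. If ∅ ⊊ conv(S) ⊊ ℝⁿ, then conv(S) = ⋂_{λ∈Ω} S_λ. -/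
open Matrix Set

noncomputable section

/-- The value of the quadratic function `xᵀ A x + 2 bᵀ x + c`. -/
def qf {n : ℕ} (A : Matrix (Fin n) (Fin n) ℝ) (b : Fin n → ℝ) (c : ℝ) (x : Fin n → ℝ) : ℝ :=
  x ⬝ᵥ A.mulVec x + 2 * (b ⬝ᵥ x) + c

/-- The bordered `(n+1)×(n+1)` matrix `[[A, b], [bᵀ, c]]`. -/
def Qmat {n : ℕ} (A : Matrix (Fin n) (Fin n) ℝ) (b : Fin n → ℝ) (c : ℝ) :
    Matrix (Fin n ⊕ Unit) (Fin n ⊕ Unit) ℝ :=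
  Matrix.fromBlocks A (Matrix.of fun i _ => b i) (Matrix.of fun _ j => b j)
    (Matrix.of fun _ _ => c)

/-- A linear hyperplane: the kernel of a nonzero linear functional. -/
def IsLinearHyperplane {V : Type*} [AddCommGroup V] [Module ℝ V] (H : Submodule ℝ V) : Prop :=
  ∃ φ : V →ₗ[ℝ] ℝ, φ ≠ 0 ∧ H = LinearMap.ker φ

/-- Image of a set under the quadratic map associated to the family `Q`. -/
def quadImage {ι κ : Type*} [Fintype ι] (Q : κ → Matrix ι ι ℝ) (U : Set (ι → ℝ)) :
    Set (κ → ℝ) :=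
  (fun x k => x ⬝ᵥ (Q k).mulVec x) '' U

/-- Hidden hyperplane convexity: the image of every linear hyperplane under the
quadratic map is convex. -/
def HHC {ι κ : Type*} [Fintype ι] (Q : κ → Matrix ι ι ℝ) : Prop :=
  ∀ H : Submodule ℝ (ι → ℝ), IsLinearHyperplane H →
    Convex ℝ (quadImage Q (H : Set (ι → ℝ)))

/-- `Q` has at most one negative eigenvalue, counted with multiplicity. -/
def NegEigsAtMostOne {ι : Type*} [Fintype ι] [DecidableEq ι] (Q : Matrix ι ι ℝ) : Prop :=
  ∃ hQ : Q.IsHermitian, (Finset.univ.filter fun i => hQ.eigenvalues i < 0).card ≤ 1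

/-- The set `S` defined by the strict quadratic inequalities. -/
def Sset {n m : ℕ} (A : Fin m → Matrix (Fin n) (Fin n) ℝ) (b : Fin m → Fin n → ℝ)
    (c : Fin m → ℝ) : Set (Fin n → ℝ) :=
  {x | ∀ i, qf (A i) (b i) (c i) x < 0}

/-- The set defined by the aggregated inequality with weights `lam`. -/
def Sagg {n m : ℕ} (A : Fin m → Matrix (Fin n) (Fin n) ℝ) (b : Fin m → Fin n → ℝ)
    (c : Fin m → ℝ) (lam : Fin m → ℝ) : Set (Fin n → ℝ) :=
  {x | ∑ i, lam i * qf (A i) (b i) (c i) x < 0}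

/-- The set `Ω` of good aggregations. -/
def Omega {n m : ℕ} (A : Fin m → Matrix (Fin n) (Fin n) ℝ) (b : Fin m → Fin n → ℝ)
    (c : Fin m → ℝ) : Set (Fin m → ℝ) :=
  {lam | 0 ≤ lam ∧ lam ≠ 0 ∧ convexHull ℝ (Sset A b c) ⊆ Sagg A b c lam ∧
    NegEigsAtMostOne (∑ i, lam i • Qmat (A i) (b i) (c i))}

/-- Two quadratic forms: the joint image is closed under addition (Dines). -/
lemma exists_joint_add_two {V : Type*} [AddCommGroup V] [Module ℝ V]
    (P Q : LinearMap.BilinForm ℝ V) (hP : ∀ u v, P u v = P v u) (hQ : ∀ u v, Q u v = Q v u)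
    (x y : V) : ∃ z, P z z = P x x + P y y ∧ Q z z = Q x x + Q y y := by
  set s := P x x + P y y with hs
  set t := Q x x + Q y y with ht
  by_cases h0 : s ^ 2 + t ^ 2 = 0
  · have h1 : s = 0 := by nlinarith [sq_nonneg s, sq_nonneg t]
    have h2 : t = 0 := by nlinarith [sq_nonneg s, sq_nonneg t]
    exact ⟨0, by simp [h1], by simp [h2]⟩
  have hpos : 0 < s ^ 2 + t ^ 2 := lt_of_le_of_ne (by positivity) (Ne.symm h0)
  suffices h : ∃ z, t * P z z - s * Q z z = 0 ∧ 0 < s * P z z + t * Q z z by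
    obtain ⟨z, hz, hM⟩ := h
    set k := (s ^ 2 + t ^ 2) / (s * P z z + t * Q z z) with hk
    have hkM : k * (s * P z z + t * Q z z) = s ^ 2 + t ^ 2 := div_mul_cancel₀ _ hM.ne'
    have hk0 : Real.sqrt k * Real.sqrt k = k := Real.mul_self_sqrt (by positivity)
    refine ⟨Real.sqrt k • z, ?_, ?_⟩
    · simp only [map_smul, LinearMap.smul_apply, smul_eq_mul]
      apply mul_left_cancel₀ h0
      linear_combination s * hkM + t * k * hz + (s ^ 2 + t ^ 2) * P z z * hk0
    · simp only [map_smul, LinearMap.smul_apply, smul_eq_mul]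
      apply mul_left_cancel₀ h0
      linear_combination t * hkM - s * k * hz + (s ^ 2 + t ^ 2) * Q z z * hk0
  obtain ⟨a, b, hab, h⟩ : ∃ a b : ℝ, 0 < a ^ 2 + b ^ 2 ∧
      (t * P x x - s * Q x x) * (a ^ 2 - b ^ 2) + 2 * (t * P x y - s * Q x y) * (a * b) = 0 := by
    by_cases hl : t * P x x - s * Q x x = 0
    · exact ⟨1, 0, by norm_num, by rw [hl]; ring⟩
    · set l := t * P x x - s * Q x x
      set B := t * P x y - s * Q x y
      have hsq := Real.sq_sqrt (show 0 ≤ B ^ 2 + l ^ 2 by positivity)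
      refine ⟨-B + Real.sqrt (B ^ 2 + l ^ 2), l, by positivity, ?_⟩
      linear_combination l * hsq
  have hsum : 0 < (a ^ 2 + b ^ 2) * (s ^ 2 + t ^ 2) := mul_pos hab hpos
  have hPe : ∀ a b : ℝ, P (a • x + b • y) (a • x + b • y) =
      a ^ 2 * P x x + b ^ 2 * P y y + 2 * (a * b) * P x y := fun a b ↦ by
    simp only [map_add, map_smul, LinearMap.add_apply, LinearMap.smul_apply, smul_eq_mul, hP y x]
    ring
  have hQe : ∀ a b : ℝ, Q (a • x + b • y) (a • x + b • y) =
      a ^ 2 * Q x x + b ^ 2 * Q y y + 2 * (a * b) * Q x y := fun a b ↦ by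
    simp only [map_add, map_smul, LinearMap.add_apply, LinearMap.smul_apply, smul_eq_mul, hQ y x]
    ring
  by_cases hM : 0 < s * P (a • x + b • y) (a • x + b • y) + t * Q (a • x + b • y) (a • x + b • y)
  · refine ⟨_, ?_, hM⟩
    rw [hPe, hQe]
    linear_combination h - t * b ^ 2 * hs + s * b ^ 2 * ht
  · refine ⟨(-b) • x + a • y, ?_, ?_⟩
    · rw [hPe, hQe]
      linear_combination -h - t * a ^ 2 * hs + s * a ^ 2 * ht
    · rw [hPe, hQe] at hM ⊢
      have : s ^ 2 + t ^ 2 = s * (P x x + P y y) + t * (Q x x + Q y y) := by rw [← hs, ← ht]; ring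
      rw [this] at hsum
      linarith

/-- A quadratic form with values of opposite weak signs on independent vectors vanishes at a
nonzero combination of them. -/
lemma exists_isotropic_combination {V : Type*} [AddCommGroup V] [Module ℝ V]
    (Q : LinearMap.BilinForm ℝ V) (x y : V) (hxy : LinearIndependent ℝ ![x, y])
    (h : Q x x * Q y y ≤ 0) : ∃ a b : ℝ, a • x + b • y ≠ 0 ∧
      Q (a • x + b • y) (a • x + b • y) = 0 := by
  have hne : ∀ a b : ℝ, a • x + b • y = 0 → a = 0 ∧ b = 0 := LinearIndependent.pair_iff.1 hxy
  by_cases hx : Q x x = 0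
  · exact ⟨1, 0, fun h0 ↦ one_ne_zero (hne _ _ h0).1, by simp [hx]⟩
  have hd : 0 ≤ ((Q x y + Q y x) / 2) ^ 2 - Q x x * Q y y := by
    nlinarith [sq_nonneg ((Q x y + Q y x) / 2)]
  refine ⟨-((Q x y + Q y x) / 2) + Real.sqrt (((Q x y + Q y x) / 2) ^ 2 - Q x x * Q y y), Q x x,
    fun h0 ↦ hx (hne _ _ h0).2, ?_⟩
  have hsq := Real.sq_sqrt hd
  simp only [map_add, map_smul, LinearMap.add_apply, LinearMap.smul_apply, smul_eq_mul]
  linear_combination Q x x * hsq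

/-- If a form `P` vanishes at independent `x`, `y`, and `Q` takes opposite signs there, then in
dimension at least three `P` and `Q` have a nonzero common zero. -/
lemma exists_common_zero_of_isotropic {V : Type*} [AddCommGroup V] [Module ℝ V]
    (hV : 3 ≤ Module.finrank ℝ V)
    (P Q : LinearMap.BilinForm ℝ V) (hP : ∀ u v, P u v = P v u) (hQ : ∀ u v, Q u v = Q v u)
    (x y : V) (hxy : LinearIndependent ℝ ![x, y]) (hPx : P x x = 0) (hPy : P y y = 0)
    (h : Q x x + Q y y = 0) : ∃ z ≠ 0, P z z = 0 ∧ Q z z = 0 := by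
  have hQyy : Q y y = -Q x x := by linarith
  have hQxy : Q x x * Q y y ≤ 0 := by rw [hQyy]; nlinarith [sq_nonneg (Q x x)]
  by_cases hp : P x y = 0
  · obtain ⟨a, b, hne, hz⟩ := exists_isotropic_combination Q x y hxy hQxy
    refine ⟨_, hne, ?_, hz⟩
    simp [hPx, hPy, hp, hP y x]
  obtain ⟨w₀, hw₀⟩ : ∃ w₀, LinearIndependent ℝ ![w₀, x, y] := by
    have hlt : Submodule.span ℝ (Set.range ![x, y]) < ⊤ := by
      rw [lt_top_iff_ne_top]
      intro htop
      have h1 := finrank_range_le_card (R := ℝ) ![x, y]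
      rw [Set.finrank, htop, finrank_top] at h1
      simp at h1
      omega
    obtain ⟨w₀, -, hw₀⟩ := SetLike.exists_of_lt hlt
    exact ⟨w₀, linearIndependent_finCons.2 ⟨hxy, hw₀⟩⟩
  have hne₀ : ∀ a b c : ℝ, a • w₀ + b • x + c • y = 0 → a = 0 ∧ b = 0 ∧ c = 0 := by
    intro a b c h0
    have := Fintype.linearIndependent_iff.1 hw₀ ![a, b, c] (by
      simpa [Fin.sum_univ_succ, add_assoc] using h0)
    exact ⟨this 0, this 1, this 2⟩
  obtain ⟨w, hwx, hwy, hne⟩ : ∃ w, P x w = 0 ∧ P y w = 0 ∧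
      ∀ a b c : ℝ, a • x + b • y + c • w = 0 → a = 0 ∧ b = 0 ∧ c = 0 := by
    refine ⟨w₀ - (P x w₀ / P x y) • y - (P y w₀ / P x y) • x, ?_, ?_, ?_⟩
    · simp [hPx, hp]
    · simp [hPy, hP y x, hp]
    · intro a b c h0
      obtain ⟨h1, h2, h3⟩ := hne₀ c (a - c * (P y w₀ / P x y)) (b - c * (P x w₀ / P x y)) (by
        rw [← h0]; module)
      subst h1
      simpa using And.intro h2 h3
  have hPe : ∀ a b c : ℝ, P (a • x + b • y + c • w) (a • x + b • y + c • w) =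
      2 * P x y * (a * b) + c ^ 2 * P w w := fun a b c ↦ by
    simp only [map_add, map_smul, LinearMap.add_apply, LinearMap.smul_apply, smul_eq_mul, hP y x,
      hP w x, hP w y, hwx, hwy, hPx, hPy]
    ring
  have hxw : LinearIndependent ℝ ![x, w] := LinearIndependent.pair_iff.2 fun a c h0 ↦ by
    have := hne a 0 c (by simpa using h0)
    exact ⟨this.1, this.2.2⟩
  have hyw : LinearIndependent ℝ ![y, w] := LinearIndependent.pair_iff.2 fun a c h0 ↦ by
    have := hne 0 a c (by simpa using h0)
    exact ⟨this.2.1, this.2.2⟩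
  by_cases hs : P w w = 0
  · by_cases hc : Q x x * Q w w ≤ 0
    · obtain ⟨a, c, hz0, hz⟩ := exists_isotropic_combination Q x w hxw hc
      refine ⟨_, hz0, ?_, hz⟩
      simpa [hs] using hPe a 0 c
    · obtain ⟨a, c, hz0, hz⟩ := exists_isotropic_combination Q y w hyw (by rw [hQyy]; linarith)
      refine ⟨_, hz0, ?_, hz⟩
      simpa [hs] using hPe 0 a c
  -- On the conic, join `x` to `±y` by `t ↦ (1 - t)² x ± t² y + κ t (1 - t) w`.
  obtain ⟨e, κ, he, hκ⟩ : ∃ e κ : ℝ, e ^ 2 = 1 ∧ 2 * P x y * e + κ ^ 2 * P w w = 0 := by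
    rcases le_total 0 (-(2 * P x y) / P w w) with h1 | h1
    · refine ⟨1, Real.sqrt (-(2 * P x y) / P w w), by norm_num, ?_⟩
      rw [Real.sq_sqrt h1]; field_simp; ring
    · refine ⟨-1, Real.sqrt (-(-(2 * P x y) / P w w)), by norm_num, ?_⟩
      rw [Real.sq_sqrt (by linarith)]; field_simp; ring
  have hQe : ∀ a b c : ℝ, Q (a • x + b • y + c • w) (a • x + b • y + c • w) =
      a ^ 2 * Q x x + b ^ 2 * Q y y + c ^ 2 * Q w w + 2 * (a * b) * Q x y + 2 * (a * c) * Q x w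
        + 2 * (b * c) * Q y w := fun a b c ↦ by
    simp only [map_add, map_smul, LinearMap.add_apply, LinearMap.smul_apply, smul_eq_mul, hQ y x,
      hQ w x, hQ w y]
    ring
  let z : ℝ → V := fun t ↦ (1 - t) ^ 2 • x + (e * t ^ 2) • y + (κ * (t * (1 - t))) • w
  have hcont : Continuous fun t ↦ Q (z t) (z t) := by
    simp only [z, hQe]
    fun_prop
  have hz0 : Q (z 0) (z 0) = Q x x := by simp [z]
  have hz1 : Q (z 1) (z 1) = -Q x x := by
    simp only [z, hQe]
    linear_combination Q y y * he + h
  obtain ⟨t, ht⟩ : ∃ t, Q (z t) (z t) = 0 := by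
    rcases le_total 0 (Q x x) with h1 | h1
    · exact mem_range_of_exists_le_of_exists_ge hcont ⟨1, by linarith⟩ ⟨0, by linarith⟩
    · exact mem_range_of_exists_le_of_exists_ge hcont ⟨0, by linarith⟩ ⟨1, by linarith⟩
  refine ⟨z t, fun h0 ↦ ?_, ?_, ht⟩
  · obtain ⟨h1, h2, -⟩ := hne _ _ _ h0
    have h3 : t = 1 := by have := pow_eq_zero_iff (two_ne_zero) |>.1 h1; linarith
    rw [h3] at h2
    simp at h2
    simp [h2] at he
  · simp only [z, hPe]
    linear_combination (t * (1 - t)) ^ 2 * hκ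

/-- In dimension at least three, two forms with opposite values at a pair of independent vectors
have a nonzero common zero. -/
lemma exists_common_zero {V : Type*} [AddCommGroup V] [Module ℝ V]
    (hV : 3 ≤ Module.finrank ℝ V)
    (P Q : LinearMap.BilinForm ℝ V) (hP : ∀ u v, P u v = P v u) (hQ : ∀ u v, Q u v = Q v u)
    (x y : V) (hxy : LinearIndependent ℝ ![x, y]) (h₁ : P x x + P y y = 0)
    (h₂ : Q x x + Q y y = 0) : ∃ z ≠ 0, P z z = 0 ∧ Q z z = 0 := by
  by_cases h0 : P x x ^ 2 + Q x x ^ 2 = 0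
  · refine ⟨x, hxy.ne_zero 0, ?_, ?_⟩ <;> nlinarith [sq_nonneg (P x x), sq_nonneg (Q x x)]
  obtain ⟨z, hz, hz1, hz2⟩ := exists_common_zero_of_isotropic hV
    (Q x x • P - P x x • Q) (P x x • P + Q x x • Q)
    (fun u v ↦ by simp [hP u v, hQ u v]) (fun u v ↦ by simp [hP u v, hQ u v]) x y hxy
    (by simp; ring) (by simp; linear_combination Q x x * h₁ - P x x * h₂)
    (by simp; linear_combination P x x * h₁ + Q x x * h₂)
  simp at hz1 hz2
  refine ⟨z, hz, ?_, ?_⟩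
  · apply mul_left_cancel₀ h0
    linear_combination Q x x * hz1 + P x x * hz2
  · apply mul_left_cancel₀ h0
    linear_combination Q x x * hz2 - P x x * hz1

/-- Three quadratic forms, one of them positive definite, in dimension at least three: the joint
image is closed under addition (Brickman, Calabi, Polyak). -/
lemma exists_joint_add_three {V : Type*} [AddCommGroup V] [Module ℝ V]
    (hV : 3 ≤ Module.finrank ℝ V)
    (P Q R : LinearMap.BilinForm ℝ V) (hP : ∀ u v, P u v = P v u) (hQ : ∀ u v, Q u v = Q v u)
    (hR : ∀ u v, R u v = R v u) (hpos : ∀ u, u ≠ 0 → 0 < R u u) (x y : V) :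
    ∃ z, P z z = P x x + P y y ∧ Q z z = Q x x + Q y y ∧ R z z = R x x + R y y := by
  by_cases hx : x = 0
  · exact ⟨y, by simp [hx]⟩
  by_cases hxy : LinearIndependent ℝ ![x, y]
  · have hρ : 0 < R x x + R y y := add_pos (hpos x hx) (hpos y (hxy.ne_zero 1))
    set ρ := R x x + R y y with hρdef
    obtain ⟨z, hz, hz1, hz2⟩ := exists_common_zero hV
      (P - ((P x x + P y y) / ρ) • R) (Q - ((Q x x + Q y y) / ρ) • R)
      (fun u v ↦ by simp [hP u v, hR u v]) (fun u v ↦ by simp [hQ u v, hR u v]) x y hxy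
      (by simp; field_simp; rw [hρdef]; ring) (by simp; field_simp; rw [hρdef]; ring)
    simp at hz1 hz2
    have hRz := hpos z hz
    have hk0 : Real.sqrt (ρ / R z z) * Real.sqrt (ρ / R z z) = ρ / R z z :=
      Real.mul_self_sqrt (by positivity)
    have key : ∀ a, Real.sqrt (ρ / R z z) * (Real.sqrt (ρ / R z z) * a) = ρ / R z z * a :=
      fun a ↦ by rw [← mul_assoc, hk0]
    refine ⟨Real.sqrt (ρ / R z z) • z, ?_, ?_, ?_⟩ <;>
      simp only [map_smul, LinearMap.smul_apply, smul_eq_mul, key]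
    · rw [sub_eq_zero.1 hz1]; field_simp
    · rw [sub_eq_zero.1 hz2]; field_simp
    · field_simp
  · obtain ⟨c, rfl⟩ : ∃ c : ℝ, c • x = y := by
      rw [LinearIndependent.pair_iff' hx] at hxy
      push Not at hxy
      exact hxy
    have hk0 : Real.sqrt (1 + c ^ 2) * Real.sqrt (1 + c ^ 2) = 1 + c ^ 2 :=
      Real.mul_self_sqrt (by positivity)
    refine ⟨Real.sqrt (1 + c ^ 2) • x, ?_, ?_, ?_⟩ <;>
      simp only [map_smul, LinearMap.smul_apply, smul_eq_mul, ← mul_assoc, hk0] <;> ring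

/-- If the joint image of a finite family of quadratic forms is closed under addition and misses
the open negative orthant, then some nonzero nonnegative combination is positive semidefinite. -/
lemma exists_nonneg_combination {V ι : Type*} [AddCommGroup V] [Module ℝ V] [Fintype ι]
    (B : ι → LinearMap.BilinForm ℝ V)
    (hadd : ∀ x y, ∃ z, ∀ i, B i z z = B i x x + B i y y)
    (hneg : ∀ z, ∃ i, 0 ≤ B i z z) :
    ∃ l : ι → ℝ, 0 ≤ l ∧ l ≠ 0 ∧ ∀ z, 0 ≤ ∑ i, l i * B i z z := by
  classical
  have hscale : ∀ (k : ℝ) (x : V), 0 ≤ k → ∃ z, ∀ i, B i z z = k * B i x x := fun k x hk ↦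
    ⟨Real.sqrt k • x, fun i ↦ by
      simp only [map_smul, LinearMap.smul_apply, smul_eq_mul]
      rw [← mul_assoc, Real.mul_self_sqrt hk]⟩
  let C : Set (ι → ℝ) := Set.range fun z i ↦ B i z z
  let N : Set (ι → ℝ) := {v | ∀ i, v i < 0}
  have hN : N = Set.univ.pi fun _ ↦ Set.Iio 0 := by ext v; simp [N]
  have hNo : IsOpen N := by rw [hN]; exact isOpen_set_pi Set.finite_univ fun _ _ ↦ isOpen_Iio
  have hNc : Convex ℝ N := by rw [hN]; exact convex_pi fun _ _ ↦ convex_Iio 0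
  have hC : Convex ℝ C := by
    rintro _ ⟨x, rfl⟩ _ ⟨y, rfl⟩ s t hs ht -
    obtain ⟨x', hx'⟩ := hscale s x hs
    obtain ⟨y', hy'⟩ := hscale t y ht
    obtain ⟨z, hz⟩ := hadd x' y'
    exact ⟨z, by ext i; simp [hz, hx', hy']⟩
  have hdisj : Disjoint N C := by
    rw [Set.disjoint_left]
    rintro _ hv ⟨z, rfl⟩
    obtain ⟨i, hi⟩ := hneg z
    exact absurd (hv i) hi.not_gt
  obtain ⟨f, u, hfN, hfC⟩ := geometric_hahn_banach_open hNc hNo hC hdisj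
  have hu : u ≤ 0 := by simpa using hfC 0 ⟨0, by ext; simp⟩
  have hcone : ∀ v ∈ N, f v ≤ 0 := fun v hv ↦ (hfN v hv).le.trans hu
  have hclosure : ∀ v : ι → ℝ, (∀ i, v i ≤ 0) → f v ≤ 0 := by
    intro v hv
    have hlim : Filter.Tendsto (fun ε : ℝ ↦ f (v - ε • (1 : ι → ℝ))) (nhdsWithin 0 (Set.Ioi 0))
        (nhds (f v)) := by
      have : Continuous fun ε : ℝ ↦ f (v - ε • (1 : ι → ℝ)) := by fun_prop
      simpa using (this.tendsto 0).mono_left nhdsWithin_le_nhds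
    refine le_of_tendsto hlim ?_
    filter_upwards [self_mem_nhdsWithin] with ε hε
    refine hcone _ fun i ↦ ?_
    have := hv i
    simp at hε ⊢
    linarith
  have hu0 : 0 ≤ u := by
    have hlim : Filter.Tendsto (fun ε : ℝ ↦ f (-ε • (1 : ι → ℝ))) (nhdsWithin 0 (Set.Ioi 0))
        (nhds 0) := by
      have : Continuous fun ε : ℝ ↦ f (-ε • (1 : ι → ℝ)) := by fun_prop
      simpa using (this.tendsto 0).mono_left nhdsWithin_le_nhds
    refine le_of_tendsto hlim ?_
    filter_upwards [self_mem_nhdsWithin] with ε hε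
    refine (hfN _ fun i ↦ ?_).le
    simpa using hε
  have hf : ∀ v, f v = ∑ i, f (Pi.single i 1) * v i := fun v ↦ by
    conv_lhs => rw [pi_eq_sum_univ' v, map_sum]
    refine Finset.sum_congr rfl fun i _ ↦ ?_
    rw [map_smul, smul_eq_mul, mul_comm]
  refine ⟨fun i ↦ f (Pi.single i 1), fun i ↦ ?_, fun h0 ↦ ?_, fun z ↦ ?_⟩
  · have := hclosure (-Pi.single i 1) fun j ↦ by
      by_cases h : j = i <;> simp [h]
    simpa using this
  · have := hfN (-1) fun i ↦ by simp
    rw [hf, show ∑ i, f (Pi.single i 1) * (-1 : ι → ℝ) i = 0 from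
      Finset.sum_eq_zero fun i _ ↦ by rw [show f (Pi.single i 1) = 0 from congrFun h0 i, zero_mul]]
      at this
    linarith
  · have := hfC _ ⟨z, rfl⟩
    rw [hf] at this
    linarith

/-- A symmetric matrix that is positive semidefinite on a hyperplane has at most one negative
eigenvalue. -/
lemma negEigsAtMostOne_of_nonneg_on_ker {ι : Type*} [Fintype ι] [DecidableEq ι]
    (Q : Matrix ι ι ℝ) (hQ : Q.IsHermitian) (φ : (ι → ℝ) →ₗ[ℝ] ℝ)
    (h : ∀ v, φ v = 0 → 0 ≤ v ⬝ᵥ Q.mulVec v) : NegEigsAtMostOne Q := by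
  refine ⟨hQ, Finset.card_le_one.2 fun i hi j hj ↦ ?_⟩
  simp only [Finset.mem_filter, Finset.mem_univ, true_and] at hi hj
  by_contra hij
  let e : ι → ι → ℝ := fun k ↦ (hQ.eigenvectorBasis k).ofLp
  have he : ∀ k l, e k ⬝ᵥ e l = if k = l then 1 else 0 := fun k l ↦ by
    have := orthonormal_iff_ite.1 hQ.eigenvectorBasis.orthonormal k l
    rw [← this, EuclideanSpace.inner_eq_star_dotProduct, dotProduct_comm]
    simp [e]
  have hmul : ∀ k, Q.mulVec (e k) = hQ.eigenvalues k • e k := fun k ↦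
    hQ.mulVec_eigenvectorBasis k
  have hval : ∀ a b : ℝ, (a • e i + b • e j) ⬝ᵥ Q.mulVec (a • e i + b • e j) =
      a ^ 2 * hQ.eigenvalues i + b ^ 2 * hQ.eigenvalues j := fun a b ↦ by
    simp only [mulVec_add, mulVec_smul, hmul, add_dotProduct, dotProduct_add, smul_dotProduct,
      dotProduct_smul, he, smul_eq_mul, if_true, if_neg hij, if_neg (Ne.symm hij)]
    ring
  obtain ⟨a, b, hab, hφ⟩ : ∃ a b : ℝ, 0 < a ^ 2 + b ^ 2 ∧ φ (a • e i + b • e j) = 0 := by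
    by_cases h0 : φ (e i) = 0
    · exact ⟨1, 0, by norm_num, by simp [h0]⟩
    · exact ⟨φ (e j), -φ (e i), add_pos_of_nonneg_of_pos (sq_nonneg _)
        (sq_pos_of_ne_zero (neg_ne_zero.2 h0)), by simp; ring⟩
  have := h _ hφ
  rw [hval] at this
  nlinarith [mul_pos hab (lt_min (neg_pos.2 hi) (neg_pos.2 hj)),
    mul_le_mul_of_nonneg_left (min_le_left (-hQ.eigenvalues i) (-hQ.eigenvalues j)) (sq_nonneg a),
    mul_le_mul_of_nonneg_left (min_le_right (-hQ.eigenvalues i) (-hQ.eigenvalues j)) (sq_nonneg b)]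

/-- If `B` is positive semidefinite on `ker φ`, then `{B < 0, φ < 0}` is convex. -/
lemma convex_neg_cone {V : Type*} [AddCommGroup V] [Module ℝ V]
    (B : LinearMap.BilinForm ℝ V) (hB : ∀ u v, B u v = B v u) (φ : V →ₗ[ℝ] ℝ)
    (h : ∀ v, φ v = 0 → 0 ≤ B v v) : Convex ℝ {v | B v v < 0 ∧ φ v < 0} := by
  rintro x ⟨hx, hφx⟩ y ⟨hy, hφy⟩ s t hs ht hst
  have hxy : B x y < 0 := by
    have h1 := h (φ y • x - φ x • y) (by simp; ring)
    simp only [map_sub, map_smul, LinearMap.sub_apply, LinearMap.smul_apply, smul_eq_mul,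
      hB y x] at h1
    have h2 := mul_pos_of_neg_of_neg hφx hφy
    have h3 : φ y ^ 2 * B x x < 0 := mul_neg_of_pos_of_neg (sq_pos_of_neg hφy) hx
    have h4 : φ x ^ 2 * B y y < 0 := mul_neg_of_pos_of_neg (sq_pos_of_neg hφx) hy
    by_contra hc
    nlinarith [mul_nonneg h2.le (not_lt.1 hc)]
  obtain rfl : t = 1 - s := by linarith
  rcases hs.eq_or_lt with rfl | hs'
  · simpa using And.intro hy hφy
  refine ⟨?_, ?_⟩
  · simp only [map_add, map_smul, LinearMap.add_apply, LinearMap.smul_apply, smul_eq_mul, hB y x]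
    nlinarith [mul_neg_of_pos_of_neg (mul_pos hs' hs') hx,
      mul_nonneg (mul_nonneg ht ht) (neg_nonneg.2 hy.le),
      mul_nonneg (mul_nonneg hs ht) (neg_nonneg.2 hxy.le)]
  · simp only [map_add, map_smul, smul_eq_mul]
    nlinarith [mul_neg_of_pos_of_neg hs' hφx, mul_nonneg ht (neg_nonneg.2 hφy.le)]

lemma Qmat_isHermitian {n : ℕ} {A : Matrix (Fin n) (Fin n) ℝ} (hA : A.IsSymm) (b : Fin n → ℝ)
    (c : ℝ) : (Qmat A b c).IsHermitian := by
  ext (i | i) (j | j) <;> simp [Qmat, hA.apply]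

lemma toBilin'_symm {ι : Type*} [Fintype ι] [DecidableEq ι] {Q : Matrix ι ι ℝ}
    (hQ : Q.IsHermitian) (u v : ι → ℝ) : Matrix.toBilin' Q u v = Matrix.toBilin' Q v u := by
  rw [Matrix.toBilin'_apply', Matrix.toBilin'_apply', dotProduct_mulVec, ← mulVec_transpose,
    dotProduct_comm, ← conjTranspose_eq_transpose_of_trivial, hQ.eq]

/-- The homogenization `(x, t)` of a point. -/
def homog {n : ℕ} (x : Fin n → ℝ) (t : ℝ) : Fin n ⊕ Unit → ℝ := Sum.elim x fun _ ↦ t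

lemma toBilin'_Qmat_homog {n : ℕ} (A : Matrix (Fin n) (Fin n) ℝ) (b : Fin n → ℝ) (c : ℝ)
    (x : Fin n → ℝ) :
    Matrix.toBilin' (Qmat A b c) (homog x 1) (homog x 1) = qf A b c x := by
  rw [Matrix.toBilin'_apply']
  simp only [Qmat, homog, qf, fromBlocks_mulVec, Matrix.dotProduct_block]
  simp [dotProduct, mulVec, Finset.sum_add_distrib, mul_add, mul_comm]
  ring

lemma isOpen_Sset {n m : ℕ} (A : Fin m → Matrix (Fin n) (Fin n) ℝ) (b : Fin m → Fin n → ℝ)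
    (c : Fin m → ℝ) : IsOpen (Sset A b c) := by
  have : Sset A b c = ⋂ i, {x | qf (A i) (b i) (c i) x < 0} := by ext; simp [Sset]
  rw [this]
  refine isOpen_iInter_of_finite fun i ↦ isOpen_lt ?_ continuous_const
  unfold qf
  simp only [dotProduct, mulVec]
  fun_prop

/-- If all leading forms are negative in a common direction, the convex hull is everything. -/
lemma convexHull_Sset_eq_univ {n m : ℕ} (A : Fin m → Matrix (Fin n) (Fin n) ℝ)
    (b : Fin m → Fin n → ℝ) (c : Fin m → ℝ) (d : Fin n → ℝ)
    (hd : ∀ i, Matrix.toBilin' (Qmat (A i) (b i) (c i)) (homog d 0) (homog d 0) < 0) :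
    convexHull ℝ (Sset A b c) = Set.univ := by
  have key : ∀ p q r : ℝ, p < 0 → ∀ᶠ k : ℝ in Filter.atTop, p * k ^ 2 + q * k + r < 0 := by
    intro p q r hp
    filter_upwards [Filter.eventually_gt_atTop 1, Filter.eventually_gt_atTop ((|q| + |r|) / (-p))]
      with k hk1 hk2
    rw [div_lt_iff₀ (by linarith)] at hk2
    nlinarith [le_abs_self q, le_abs_self r, abs_nonneg r,
      mul_lt_mul_of_pos_left hk2 (by linarith : 0 < k),
      mul_le_mul_of_nonneg_left (le_abs_self q) (by linarith : 0 ≤ k),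
      mul_nonneg (abs_nonneg r) (by linarith : 0 ≤ k - 1)]
  have hdir : ∀ (e : ℝ) (p : Fin n → ℝ), e ^ 2 = 1 →
      ∀ᶠ k : ℝ in Filter.atTop, p + (e * k) • d ∈ Sset A b c := by
    intro e p he
    refine Filter.eventually_all.2 fun i ↦ ?_
    set B := Matrix.toBilin' (Qmat (A i) (b i) (c i)) with hB
    filter_upwards [key (B (homog d 0) (homog d 0))
      (e * (B (homog p 1) (homog d 0) + B (homog d 0) (homog p 1)))
      (B (homog p 1) (homog p 1)) (hd i)] with k hk
    have hh : homog (p + (e * k) • d) 1 = homog p 1 + (e * k) • homog d 0 := by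
      ext (j | j) <;> simp [homog]
    rw [← toBilin'_Qmat_homog, ← hB, hh]
    simp only [map_add, map_smul, LinearMap.add_apply, LinearMap.smul_apply, smul_eq_mul]
    convert hk using 1
    linear_combination k ^ 2 * B (homog d 0) (homog d 0) * he
  refine Set.eq_univ_of_forall fun p ↦ ?_
  obtain ⟨k, h1, h2⟩ := ((hdir 1 p (by norm_num)).and (hdir (-1) p (by norm_num))).exists
  have := convex_convexHull ℝ (Sset A b c) (subset_convexHull ℝ _ h1) (subset_convexHull ℝ _ h2)
    (show (0 : ℝ) ≤ 1 / 2 by norm_num) (show (0 : ℝ) ≤ 1 / 2 by norm_num) (by norm_num)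
  convert this using 1
  module

/-- Under either span hypothesis, the joint image of a subspace of dimension at least three is
closed under addition. -/
lemma exists_joint_add_of_span {ι κ : Type*} [Fintype ι] [DecidableEq ι]
    (Q : κ → Matrix ι ι ℝ) (hQ : ∀ i, (Q i).IsHermitian)
    (hspan : (∃ i₁ i₂, ∀ i, Q i ∈ Submodule.span ℝ {Q i₁, Q i₂}) ∨
      (∃ i₁ i₂ i₃, (∀ i, Q i ∈ Submodule.span ℝ {Q i₁, Q i₂, Q i₃}) ∧
        ∃ p q r : ℝ, (p • Q i₁ + q • Q i₂ + r • Q i₃).PosDef))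
    (H : Submodule ℝ (ι → ℝ)) (hH : 3 ≤ Module.finrank ℝ H) (x y : H) :
    ∃ z : H, ∀ i, (Matrix.toBilin' (Q i)).restrict H z z =
      (Matrix.toBilin' (Q i)).restrict H x x + (Matrix.toBilin' (Q i)).restrict H y y := by
  have hsymm : ∀ i (u v : H), (Matrix.toBilin' (Q i)).restrict H u v =
      (Matrix.toBilin' (Q i)).restrict H v u := fun i u v ↦ toBilin'_symm (hQ i) u v
  rcases hspan with ⟨i₁, i₂, h⟩ | ⟨i₁, i₂, i₃, h, p, q, r, hpos⟩
  · obtain ⟨z, h1, h2⟩ := exists_joint_add_two _ _ (hsymm i₁) (hsymm i₂) x y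
    refine ⟨z, fun i ↦ ?_⟩
    obtain ⟨s, t, hi⟩ := Submodule.mem_span_pair.1 (h i)
    simp only [LinearMap.BilinForm.restrict_apply, LinearMap.domRestrict_apply] at h1 h2
    simp only [LinearMap.BilinForm.restrict_apply, LinearMap.domRestrict_apply, ← hi, map_add,
      map_smul, LinearMap.add_apply, LinearMap.smul_apply, smul_eq_mul]
    linear_combination s * h1 + t * h2
  · set R := p • Q i₁ + q • Q i₂ + r • Q i₃ with hR
    have hRpos : ∀ u : H, u ≠ 0 → 0 < (Matrix.toBilin' R).restrict H u u := fun u hu ↦ by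
      have := hpos.dotProduct_mulVec_pos (x := (u : ι → ℝ)) (by simpa using hu)
      simpa [Matrix.toBilin'_apply'] using this
    have hRsymm : ∀ u v : H, (Matrix.toBilin' R).restrict H u v =
      (Matrix.toBilin' R).restrict H v u := fun u v ↦ toBilin'_symm hpos.1 u v
    have hRe : ∀ u : H, (Matrix.toBilin' R).restrict H u u =
        p * (Matrix.toBilin' (Q i₁)).restrict H u u + q * (Matrix.toBilin' (Q i₂)).restrict H u u
          + r * (Matrix.toBilin' (Q i₃)).restrict H u u := fun u ↦ by
      simp [hR]
    have main : ∃ z : H, ∀ i ∈ ({i₁, i₂, i₃} : Set κ), (Matrix.toBilin' (Q i)).restrict H z z =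
        (Matrix.toBilin' (Q i)).restrict H x x + (Matrix.toBilin' (Q i)).restrict H y y := by
      simp only [Set.mem_insert_iff, Set.mem_singleton_iff, forall_eq_or_imp, forall_eq]
      by_cases hp : p = 0
      · by_cases hq : q = 0
        · obtain ⟨z, h1, h2, h3⟩ := exists_joint_add_three hH _ _ _ (hsymm i₁) (hsymm i₂) hRsymm
            hRpos x y
          have hr : r ≠ 0 := by
            rintro rfl
            have := Module.nontrivial_of_finrank_pos (R := ℝ) (M := H) (by omega)
            obtain ⟨u, hu⟩ := exists_ne (0 : H)
            have := hRpos u hu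
            rw [hRe, hp, hq] at this
            simp at this
          refine ⟨z, h1, h2, mul_left_cancel₀ hr ?_⟩
          rw [hRe, hRe, hRe] at h3
          linear_combination h3 - p * h1 - q * h2
        · obtain ⟨z, h1, h2, h3⟩ := exists_joint_add_three hH _ _ _ (hsymm i₁) (hsymm i₃) hRsymm
            hRpos x y
          refine ⟨z, h1, mul_left_cancel₀ hq ?_, h2⟩
          rw [hRe, hRe, hRe] at h3
          linear_combination h3 - p * h1 - r * h2
      · obtain ⟨z, h1, h2, h3⟩ := exists_joint_add_three hH _ _ _ (hsymm i₂) (hsymm i₃) hRsymm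
          hRpos x y
        refine ⟨z, mul_left_cancel₀ hp ?_, h1, h2⟩
        rw [hRe, hRe, hRe] at h3
        linear_combination h3 - q * h1 - r * h2
    obtain ⟨z, hz⟩ := main
    refine ⟨z, fun i ↦ ?_⟩
    have h1 := hz i₁ (by simp)
    have h2 := hz i₂ (by simp)
    have h3 := hz i₃ (by simp)
    obtain ⟨s, t, w, hi⟩ := Submodule.mem_span_triple.1 (h i)
    simp only [LinearMap.BilinForm.restrict_apply, LinearMap.domRestrict_apply] at h1 h2 h3
    simp only [LinearMap.BilinForm.restrict_apply, LinearMap.domRestrict_apply, ← hi, map_add,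
      map_smul, LinearMap.add_apply, LinearMap.smul_apply, smul_eq_mul]
    linear_combination s * h1 + t * h2 + w * h3

/-- If the `Qᵢ` all lie in the span of two of them, or in the span of three of them
satisfying PDLC, then the convex hull is given by aggregations. -/
theorem statement8 (n m : ℕ) (hn : 3 ≤ n)
    (A : Fin m → Matrix (Fin n) (Fin n) ℝ) (b : Fin m → Fin n → ℝ) (c : Fin m → ℝ)
    (hsymm : ∀ i, (A i).IsSymm)
    (hspan :
      (∃ i₁ i₂ : Fin m, ∀ i, Qmat (A i) (b i) (c i) ∈
        Submodule.span ℝ {Qmat (A i₁) (b i₁) (c i₁), Qmat (A i₂) (b i₂) (c i₂)}) ∨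
      (∃ i₁ i₂ i₃ : Fin m,
        (∀ i, Qmat (A i) (b i) (c i) ∈
          Submodule.span ℝ {Qmat (A i₁) (b i₁) (c i₁), Qmat (A i₂) (b i₂) (c i₂),
            Qmat (A i₃) (b i₃) (c i₃)}) ∧
        ∃ p q r : ℝ, (p • Qmat (A i₁) (b i₁) (c i₁) + q • Qmat (A i₂) (b i₂) (c i₂) +
          r • Qmat (A i₃) (b i₃) (c i₃)).PosDef))
    (hS : (Sset A b c).Nonempty)
    (hconv : convexHull ℝ (Sset A b c) ≠ Set.univ) :
    convexHull ℝ (Sset A b c) = ⋂ lam ∈ Omega A b c, Sagg A b c lam := by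
  refine Set.Subset.antisymm (Set.subset_iInter₂ fun lam hlam ↦ hlam.2.2.1) fun y hy ↦ ?_
  by_contra hyS
  obtain ⟨f, hf⟩ := geometric_hahn_banach_open_point (convex_convexHull ℝ (Sset A b c))
    (isOpen_Sset A b c).convexHull hyS
  let Q : Fin m → Matrix (Fin n ⊕ Unit) (Fin n ⊕ Unit) ℝ := fun i ↦ Qmat (A i) (b i) (c i)
  have hQ : ∀ i, (Q i).IsHermitian := fun i ↦ Qmat_isHermitian (hsymm i) (b i) (c i)
  let φ : (Fin n ⊕ Unit → ℝ) →ₗ[ℝ] ℝ :=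
    (f : (Fin n → ℝ) →ₗ[ℝ] ℝ) ∘ₗ LinearMap.funLeft ℝ ℝ Sum.inl - f y • LinearMap.proj (Sum.inr ())
  have hφ : ∀ x t, φ (homog x t) = f x - f y * t := fun x t ↦ by
    simp only [φ, LinearMap.sub_apply, LinearMap.comp_apply, LinearMap.smul_apply,
      LinearMap.proj_apply, smul_eq_mul]
    rfl
  have hrank : 3 ≤ Module.finrank ℝ (LinearMap.ker φ) := by
    have h1 := LinearMap.finrank_range_add_finrank_ker φ
    have h2 := Submodule.finrank_le (LinearMap.range φ)
    simp at h1 h2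
    omega
  have hneg : ∀ z : LinearMap.ker φ, ∃ i, 0 ≤ (Matrix.toBilin' (Q i)).restrict _ z z := by
    rintro ⟨z, hz⟩
    by_contra! hc
    simp only [LinearMap.BilinForm.restrict_apply, LinearMap.domRestrict_apply] at hc
    rw [LinearMap.mem_ker] at hz
    obtain ⟨x, t, rfl⟩ : ∃ x t, z = homog x t :=
      ⟨fun i ↦ z (Sum.inl i), z (Sum.inr ()), by ext (j | j) <;> rfl⟩
    by_cases ht : t = 0
    · subst ht
      exact hconv (convexHull_Sset_eq_univ A b c x hc)
    · have hx : homog x t = t • homog (t⁻¹ • x) 1 := by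
        ext (j | j) <;> simp [homog, ht]
      have hmem : t⁻¹ • x ∈ Sset A b c := fun i ↦ by
        have := hc i
        rw [hx, map_smul, map_smul, LinearMap.smul_apply, smul_eq_mul, smul_eq_mul,
          toBilin'_Qmat_homog, ← mul_assoc] at this
        exact neg_of_mul_neg_right this (mul_self_nonneg t)
      have h1 := hf _ (subset_convexHull ℝ _ hmem)
      rw [hx, map_smul, hφ, smul_eq_mul, mul_eq_zero] at hz
      rcases hz with hz | hz
      · exact ht hz
      · linarith
  obtain ⟨lam, hlam, hlam0, hpsd⟩ := exists_nonneg_combination _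
    (exists_joint_add_of_span Q hQ hspan (LinearMap.ker φ) hrank) hneg
  let M := ∑ i, lam i • Q i
  have hM : M.IsHermitian := by
    simp only [M, Matrix.IsHermitian, conjTranspose_sum, conjTranspose_smul, (hQ _).eq, star_trivial]
  have hMval : ∀ v, Matrix.toBilin' M v v = ∑ i, lam i * Matrix.toBilin' (Q i) v v := fun v ↦ by
    simp [M, map_sum, LinearMap.sum_apply]
  have hMpsd : ∀ v, φ v = 0 → 0 ≤ Matrix.toBilin' M v v := fun v hv ↦ by
    rw [hMval]
    exact hpsd ⟨v, hv⟩
  have hMagg : ∀ x, Matrix.toBilin' M (homog x 1) (homog x 1) =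
      ∑ i, lam i * qf (A i) (b i) (c i) x := fun x ↦ by
    simp only [hMval, Q, toBilin'_Qmat_homog]
  have hmem : lam ∈ Omega A b c := by
    refine ⟨hlam, hlam0, ?_, negEigsAtMostOne_of_nonneg_on_ker M hM φ fun v hv ↦ by
      simpa [Matrix.toBilin'_apply'] using hMpsd v hv⟩
    have hconvex : Convex ℝ {x | Matrix.toBilin' M (homog x 1) (homog x 1) < 0 ∧
        φ (homog x 1) < 0} := by
      intro x hx z hz s t hs ht hst
      have := convex_neg_cone _ (toBilin'_symm hM) φ hMpsd hx hz hs ht hst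
      have he : s • homog x 1 + t • homog z 1 = homog (s • x + t • z) 1 := by
        ext (j | j) <;> simp [homog, hst]
      rwa [he] at this
    refine (convexHull_min (fun x hx ↦ ?_) hconvex).trans fun x hx ↦ (hMagg x).symm.trans_lt hx.1
    constructor
    · rw [hMagg]
      obtain ⟨i, hi⟩ := Function.ne_iff.1 hlam0
      exact Finset.sum_neg' (fun j _ ↦ mul_nonpos_of_nonneg_of_nonpos (hlam j) (hx j).le)
        ⟨i, Finset.mem_univ i, mul_neg_of_pos_of_neg (lt_of_le_of_ne (hlam i) (Ne.symm hi)) (hx i)⟩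
    · rw [hφ]
      linarith [hf x (subset_convexHull ℝ _ hx)]
  have h1 : ∑ i, lam i * qf (A i) (b i) (c i) y < 0 := Set.mem_iInter₂.1 hy lam hmem
  rw [← hMagg] at h1
  exact absurd (hMpsd (homog y 1) (by rw [hφ]; ring)) h1.not_ge

end
end

section
/- Let f_i(x) = xᵀA_ix + 2b_iᵀx + c_i, i ∈ [m], be quadratic functions on ℝⁿ where each A_i is either I_n, −I_n, or the zero matrix, and let S = {x ∈ ℝⁿ : f_i(x) < 0 for all i ∈ [m]}. Assume either dim span(Q_1,…,Q_m) ≤ n−1, or dim span(Q_1,…,Q_m) = n and Q_1,…,Q_m satisfy PDLC. If ∅ ⊊ conv(S) ⊊ ℝⁿ, then conv(S) = ⋂_{λ∈Ω'} S_λ, where Ω' = {λ ∈ ℝᵐ : λ ≥ 0, λ ≠ 0, Σᵢ λ_iA_i positive semidefinite}. -/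
open Matrix Set

noncomputable section

/-- A quadratic polynomial with positive leading coefficient and nonpositive constant term has a
nonnegative root. -/
lemma exists_nonneg_root {p q r : ℝ} (hp : 0 < p) (hr : r ≤ 0) :
    ∃ t : ℝ, 0 ≤ t ∧ p * t ^ 2 + q * t + r = 0 := by
  have hd : 0 ≤ q ^ 2 - 4 * p * r := by nlinarith [sq_nonneg q, mul_nonneg hp.le (neg_nonneg.2 hr)]
  have hs := Real.sq_sqrt hd
  refine ⟨(-q + √(q ^ 2 - 4 * p * r)) / (2 * p), ?_, ?_⟩
  · apply div_nonneg _ (by positivity)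
    have : |q| ≤ √(q ^ 2 - 4 * p * r) :=
      Real.abs_le_sqrt (by nlinarith [mul_nonneg hp.le (neg_nonneg.2 hr)])
    linarith [le_abs_self q]
  · generalize √(q ^ 2 - 4 * p * r) = D at hs
    field_simp
    linear_combination hs

/-- A theorem of the alternative: if the cone generated by the range of `F` is convex and contains
no vector with all entries negative, then some nontrivial nonnegative combination of the components
of `F` is nonnegative everywhere. -/
lemma exists_nonneg_weights {X ι : Type*} [Nonempty X] [Fintype ι] (F : X → ι → ℝ)
    (hF : ∀ x y : X, ∀ α β : ℝ, 0 ≤ α → 0 ≤ β → α + β = 1 →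
      ∃ z : X, ∃ τ : ℝ, 0 < τ ∧ τ • F z = α • F x + β • F y)
    (hneg : ∀ x, ¬ ∀ i, F x i < 0) :
    ∃ lam : ι → ℝ, 0 ≤ lam ∧ lam ≠ 0 ∧ ∀ x, 0 ≤ ∑ i, lam i * F x i := by
  classical
  let N : Set (ι → ℝ) := Set.pi Set.univ fun _ => Set.Iio 0
  let T : Set (ι → ℝ) := {v | ∃ z : X, ∃ τ : ℝ, 0 < τ ∧ v = τ • F z}
  have hNc : Convex ℝ N := convex_pi fun _ _ => convex_Iio 0
  have hNo : IsOpen N := isOpen_set_pi Set.finite_univ fun _ _ => isOpen_Iio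
  have hTc : Convex ℝ T := by
    rintro _ ⟨x, σ, hσ, rfl⟩ _ ⟨y, τ, hτ, rfl⟩ α β hα hβ hαβ
    have hμ : 0 < α * σ + β * τ := by
      rcases hα.lt_or_eq with h | h
      · have := mul_pos h hσ
        have := mul_nonneg hβ hτ.le
        linarith
      · have : β = 1 := by linarith
        subst this
        simp [← h, hτ]
    obtain ⟨z, ρ, hρ, hz⟩ := hF x y (α * σ / (α * σ + β * τ)) (β * τ / (α * σ + β * τ))
      (by positivity) (by positivity) (by field_simp)
    refine ⟨z, (α * σ + β * τ) * ρ, by positivity, ?_⟩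
    rw [mul_smul, hz, smul_add, smul_smul, smul_smul, smul_smul, smul_smul,
      mul_div_cancel₀ _ hμ.ne', mul_div_cancel₀ _ hμ.ne']
  have hd : Disjoint N T := by
    rw [Set.disjoint_left]
    rintro _ hv ⟨z, τ, hτ, rfl⟩
    refine hneg z fun i => ?_
    have : τ * F z i < 0 := hv i trivial
    exact (pos_iff_neg_of_mul_neg this).1 hτ
  obtain ⟨φ, u, hu, hu'⟩ := geometric_hahn_banach_open hNc hNo hTc hd
  have hφ : ∀ v, φ v = ∑ i, φ (Pi.single i 1) * v i := by
    intro v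
    conv_lhs => rw [pi_eq_sum_univ' v]
    simp [mul_comm]
  have hT0 : ∀ x, 0 ≤ φ (F x) := by
    intro x
    by_contra! h
    have key : ∀ τ : ℝ, 0 < τ → u ≤ τ * φ (F x) := fun τ hτ => by
      simpa using hu' _ ⟨x, τ, hτ, rfl⟩
    have h1 : u < 0 := by linarith [key 1 one_pos]
    have := key (2 * (u / φ (F x))) (mul_pos two_pos (div_pos_of_neg_of_neg h1 h))
    rw [mul_assoc, div_mul_cancel₀ _ h.ne] at this
    linarith
  obtain ⟨x₀⟩ := ‹Nonempty X›
  have hN : ∀ v ∈ N, φ v < 0 := by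
    intro v hv
    by_contra! h
    have hu0 : 0 < u := h.trans_lt (hu v hv)
    have key : ∀ τ : ℝ, 0 < τ → u ≤ τ * φ (F x₀) := fun τ hτ => by
      simpa using hu' _ ⟨x₀, τ, hτ, rfl⟩
    have h1 : 0 < φ (F x₀) := by linarith [key 1 one_pos]
    have := key (u / φ (F x₀) / 2) (by positivity)
    have h2 : u / φ (F x₀) / 2 * φ (F x₀) = u / 2 := by field_simp
    linarith
  refine ⟨fun i => φ (Pi.single i 1), ?_, ?_, fun x => by rw [← hφ]; exact hT0 x⟩
  · intro i
    by_contra! h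
    change φ (Pi.single i 1) < 0 at h
    obtain ⟨δ, hδ, hlt⟩ : ∃ δ : ℝ, 0 < δ ∧
        δ * φ (fun _ => 1) < - φ (Pi.single i 1) := by
      refine ⟨- φ (Pi.single i 1) / (2 * (|φ fun _ => 1| + 1)),
        div_pos (by linarith) (by positivity), ?_⟩
      have h3 := le_abs_self (φ fun _ => (1 : ℝ))
      have h4 := abs_nonneg (φ fun _ => (1 : ℝ))
      rw [div_mul_eq_mul_div, div_lt_iff₀ (by positivity)]
      nlinarith
    have hv : (-(Pi.single i 1 : ι → ℝ) - δ • fun _ => (1 : ℝ)) ∈ N := by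
      intro j _
      have : (0 : ℝ) ≤ (Pi.single i 1 : ι → ℝ) j := by
        by_cases hj : j = i
        · subst hj; simp
        · simp [hj]
      simp only [Pi.sub_apply, Pi.neg_apply, Pi.smul_apply, smul_eq_mul, mul_one, Set.mem_Iio]
      linarith
    have := hN _ hv
    simp only [map_sub, map_neg, map_smul, smul_eq_mul] at this
    linarith
  · intro h0
    have := hN (fun _ => -1) fun i _ => by simp
    rw [hφ] at this
    simp [fun i => congrFun h0 i] at this

section IsotropicQuadratics

variable {n : ℕ} {V : Type*} [AddCommGroup V] [Module ℝ V]

/-- The isotropic quadratic function with coefficients `s v`, `w v`, `c v`. -/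
def isoQuad (s : V →ₗ[ℝ] ℝ) (w : V →ₗ[ℝ] Fin n → ℝ) (c : V →ₗ[ℝ] ℝ) (v : V)
    (x : Fin n → ℝ) : ℝ :=
  s v * (x ⬝ᵥ x) + 2 * (w v ⬝ᵥ x) + c v

variable (s : V →ₗ[ℝ] ℝ) (w : V →ₗ[ℝ] Fin n → ℝ) (c : V →ₗ[ℝ] ℝ)

lemma isoQuad_add (u v : V) (x : Fin n → ℝ) :
    isoQuad s w c (u + v) x = isoQuad s w c u x + isoQuad s w c v x := by
  simp only [isoQuad, map_add, add_dotProduct]; ring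

lemma isoQuad_smul (r : ℝ) (v : V) (x : Fin n → ℝ) :
    isoQuad s w c (r • v) x = r * isoQuad s w c v x := by
  simp only [isoQuad, map_smul, smul_dotProduct, smul_eq_mul]; ring

lemma isoQuad_sum {ι : Type*} (t : Finset ι) (v : ι → V) (x : Fin n → ℝ) :
    isoQuad s w c (∑ i ∈ t, v i) x = ∑ i ∈ t, isoQuad s w c (v i) x := by
  classical
  induction t using Finset.induction_on with
  | empty => simp [isoQuad]
  | insert i t hi ih => rw [Finset.sum_insert hi, Finset.sum_insert hi, isoQuad_add, ih]

lemma isoQuad_convexComb (v : V) (x y : Fin n → ℝ) {α β : ℝ} (h : α + β = 1) :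
    isoQuad s w c v (α • x + β • y) = α * isoQuad s w c v x + β * isoQuad s w c v y
      - s v * (α * β * ((x - y) ⬝ᵥ (x - y))) := by
  obtain rfl : β = 1 - α := by linarith
  simp only [isoQuad, dotProduct_add, add_dotProduct, dotProduct_smul, smul_dotProduct,
    dotProduct_sub, sub_dotProduct, smul_eq_mul, dotProduct_comm y x]
  ring

lemma isoQuad_add_smul (v : V) (x u : Fin n → ℝ) (t : ℝ) :
    isoQuad s w c v (x + t • u) = isoQuad s w c v x
      + 2 * t * (s v * (x ⬝ᵥ u) + w v ⬝ᵥ u) + s v * t ^ 2 * (u ⬝ᵥ u) := by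
  simp only [isoQuad, dotProduct_add, add_dotProduct, dotProduct_smul, smul_dotProduct,
    smul_eq_mul, dotProduct_comm u x]
  ring

lemma dotProduct_self_pos_of_ne_zero {u : Fin n → ℝ} (hu : u ≠ 0) : 0 < u ⬝ᵥ u := by
  have h0 : 0 ≤ u ⬝ᵥ u := Finset.sum_nonneg fun i _ => mul_self_nonneg (u i)
  exact lt_of_le_of_ne h0 fun h => hu (dotProduct_self_eq_zero.1 h.symm)

/-- Along a hyperplane `g = d`, a value of `p` above its value at `z` can be attained at another
point, up to a positive scaling, without changing the functions of `M` that are affine. -/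
lemma exists_rescale (M : Submodule ℝ V) [FiniteDimensional ℝ M] {p : V} (hpM : p ∈ M)
    (hp : s p = 1) (g : (Fin n → ℝ) →ₗ[ℝ] ℝ)
    (hM : Module.finrank ℝ M + 1 ≤ n ∨
      Module.finrank ℝ M = n ∧ ∀ x, 0 < isoQuad s w c p x)
    (z : Fin n → ℝ) {r : ℝ} (hr : isoQuad s w c p z ≤ r) :
    ∃ y : Fin n → ℝ, ∃ τ : ℝ, 0 < τ ∧ g y = g z ∧ τ * isoQuad s w c p y = r ∧
      ∀ k ∈ M, s k = 0 → τ * isoQuad s w c k y = isoQuad s w c k z := by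
  let K : Submodule ℝ V := M ⊓ LinearMap.ker s
  have hKM : K ≤ M := inf_le_left
  have hKlt : K < M := lt_of_le_of_ne hKM fun h => by
    have : p ∈ K := h ▸ hpM
    have : s p = 0 := this.2
    linarith
  have : FiniteDimensional ℝ K := Submodule.finiteDimensional_of_le hKM
  have hKrank : Module.finrank ℝ K < Module.finrank ℝ M := Submodule.finrank_lt_finrank_of_lt hKlt
  have move : ∀ u : Fin n → ℝ, u ≠ 0 → g u = 0 → (∀ k ∈ M, s k = 0 → w k ⬝ᵥ u = 0) →
      ∃ y : Fin n → ℝ, ∃ τ : ℝ, 0 < τ ∧ g y = g z ∧ τ * isoQuad s w c p y = r ∧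
      ∀ k ∈ M, s k = 0 → τ * isoQuad s w c k y = isoQuad s w c k z := by
    intro u hu hgu hwu
    obtain ⟨t, -, ht⟩ := exists_nonneg_root (q := 2 * (s p * (z ⬝ᵥ u) + w p ⬝ᵥ u))
      (r := isoQuad s w c p z - r) (dotProduct_self_pos_of_ne_zero hu) (by linarith)
    refine ⟨z + t • u, 1, one_pos, by simp [hgu], ?_, fun k hk hsk => ?_⟩
    · rw [isoQuad_add_smul, hp] at *
      linarith
    · rw [isoQuad_add_smul, hsk, hwu k hk hsk]; ring
  let L : (Fin n → ℝ) →ₗ[ℝ] Module.Dual ℝ K :=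
    (LinearMap.lcomp ℝ ℝ (w.comp K.subtype)).comp (dotProductBilin ℝ ℝ)
  have hL : ∀ (u : Fin n → ℝ) (k : K), L u k = w k ⬝ᵥ u := fun u k => by
    simp [L, dotProduct_comm]
  rcases hM with hM | ⟨hM, hpos⟩
  · obtain ⟨u, hu, hu0⟩ := Submodule.exists_mem_ne_zero_of_ne_bot
      (LinearMap.ker_ne_bot_of_finrank_lt (f := L.prod g) (by
        rw [Module.finrank_prod, Subspace.dual_finrank_eq]; simp; omega))
    have hu' : L u = 0 ∧ g u = 0 := by simpa [Prod.ext_iff] using hu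
    refine move u hu0 hu'.2 fun k hk hsk => ?_
    rw [← hL u ⟨k, hk, hsk⟩, hu'.1]; rfl
  · let C : ℝ →ₗ[ℝ] Module.Dual ℝ K := LinearMap.toSpanSingleton ℝ _ (c.comp K.subtype)
    let G : ((Fin n → ℝ) × ℝ) →ₗ[ℝ] Module.Dual ℝ K × ℝ :=
      (((2 : ℝ) • L).coprod C).prod (g.coprod (LinearMap.toSpanSingleton ℝ ℝ (-(g z))))
    obtain ⟨⟨u, t⟩, hu, hu0⟩ := Submodule.exists_mem_ne_zero_of_ne_bot
      (LinearMap.ker_ne_bot_of_finrank_lt (f := G) (by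
        rw [Module.finrank_prod, Module.finrank_prod, Subspace.dual_finrank_eq]; simp; omega))
    have hu' : (2 : ℝ) • L u + C t = 0 ∧ g u = t * g z := by
      have h1 : (2 : ℝ) • L u + C t = 0 := congrArg Prod.fst hu
      have h2 : g u + t * -(g z) = 0 := congrArg Prod.snd hu
      exact ⟨h1, by linarith⟩
    have hk : ∀ k ∈ M, s k = 0 → 2 * (w k ⬝ᵥ u) + t * c k = 0 := fun k hk hsk => by
      have := LinearMap.congr_fun hu'.1 ⟨k, hk, hsk⟩
      simpa [hL, C] using this
    by_cases ht : t = 0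
    · subst ht
      refine move u (fun h => hu0 (by simp [h])) (by simpa using hu'.2) fun k hkM hsk => ?_
      linarith [hk k hkM hsk]
    · set o : Fin n → ℝ := t⁻¹ • u with ho
      have hgo : g o = g z := by
        rw [ho, map_smul, hu'.2, smul_eq_mul, inv_mul_cancel_left₀ ht]
      have hko : ∀ k ∈ M, s k = 0 → isoQuad s w c k o = 0 := fun k hkM hsk => by
        have := hk k hkM hsk
        rw [isoQuad, hsk, zero_mul, ho, dotProduct_smul, smul_eq_mul]
        linear_combination t⁻¹ * this - c k * inv_mul_cancel₀ ht
      obtain ⟨D, rfl⟩ : ∃ D, z = o + (1 : ℝ) • D := ⟨z - o, by simp⟩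
      have hgD : g D = 0 := by
        rw [map_add, map_smul, one_smul] at hgo
        linarith
      rw [isoQuad_add_smul, hp] at hr
      set B := 2 * (1 * (o ⬝ᵥ D) + w p ⬝ᵥ D) with hB
      obtain ⟨θ, hθ, hroot⟩ := exists_nonneg_root (p := isoQuad s w c p o)
        (q := 2 * isoQuad s w c p o + B - r) (r := isoQuad s w c p o + B - r + D ⬝ᵥ D)
        (hpos o) (by linarith)
      have hτ : 0 < 1 + θ := by linarith
      refine ⟨o + (1 + θ)⁻¹ • D, 1 + θ, hτ, by simp [hgD], ?_, fun k hkM hsk => ?_⟩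
      · rw [isoQuad_add_smul, hp]
        field_simp
        linarith
      · rw [isoQuad_add_smul, isoQuad_add_smul, hko k hkM hsk, hsk]
        field_simp
        ring

/-- On a hyperplane, the cone generated by the values of finitely many isotropic quadratic functions
spanning a space of small dimension is convex. -/
lemma exists_smul_isoQuad_eq {ι : Type*} (v : ι → V)
    [FiniteDimensional ℝ (Submodule.span ℝ (Set.range v))]
    (hM : Module.finrank ℝ (Submodule.span ℝ (Set.range v)) + 1 ≤ n ∨
      Module.finrank ℝ (Submodule.span ℝ (Set.range v)) = n ∧
        ∃ p ∈ Submodule.span ℝ (Set.range v), 0 < s p ∧ ∀ x, 0 < isoQuad s w c p x)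
    (g : (Fin n → ℝ) →ₗ[ℝ] ℝ) {d : ℝ} {x y : Fin n → ℝ} (hx : g x = d) (hy : g y = d)
    {α β : ℝ} (hα : 0 ≤ α) (hβ : 0 ≤ β) (h : α + β = 1) :
    ∃ z : Fin n → ℝ, ∃ τ : ℝ, 0 < τ ∧ g z = d ∧
      ∀ i, τ * isoQuad s w c (v i) z
        = α * isoQuad s w c (v i) x + β * isoQuad s w c (v i) y := by
  have hv : ∀ i, v i ∈ Submodule.span ℝ (Set.range v) := fun i => Submodule.subset_span ⟨i, rfl⟩
  have hg : g (α • x + β • y) = d := by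
    rw [map_add, map_smul, map_smul, hx, hy, ← add_smul, h, one_smul]
  by_cases hs : ∀ i, s (v i) = 0
  · refine ⟨α • x + β • y, 1, one_pos, hg, fun i => ?_⟩
    rw [isoQuad_convexComb s w c _ _ _ h, hs]; ring
  obtain ⟨p, hpM, hp, hM⟩ : ∃ p ∈ Submodule.span ℝ (Set.range v), s p = 1 ∧
      (Module.finrank ℝ (Submodule.span ℝ (Set.range v)) + 1 ≤ n ∨
      Module.finrank ℝ (Submodule.span ℝ (Set.range v)) = n ∧ ∀ x, 0 < isoQuad s w c p x) := by
    rcases hM with hM | ⟨hM, p, hpM, hp, hpos⟩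
    · push Not at hs
      obtain ⟨i, hi⟩ := hs
      exact ⟨(s (v i))⁻¹ • v i, Submodule.smul_mem _ _ (hv i), by simp [hi], .inl hM⟩
    · refine ⟨(s p)⁻¹ • p, Submodule.smul_mem _ _ hpM, by simp [hp.ne'], .inr ⟨hM, fun x => ?_⟩⟩
      rw [isoQuad_smul]
      exact mul_pos (inv_pos.2 hp) (hpos x)
  obtain ⟨z, τ, hτ, hgz, hpz, hkz⟩ := exists_rescale s w c _ hpM hp g hM (α • x + β • y)
    (r := α * isoQuad s w c p x + β * isoQuad s w c p y) (by
      rw [isoQuad_convexComb s w c _ _ _ h, hp]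
      have : 0 ≤ (x - y) ⬝ᵥ (x - y) := Finset.sum_nonneg fun i _ => mul_self_nonneg _
      have : 0 ≤ α * β * ((x - y) ⬝ᵥ (x - y)) := by positivity
      linarith)
  refine ⟨z, τ, hτ, hgz.trans hg, fun i => ?_⟩
  obtain ⟨k, hk⟩ : ∃ k, k = v i - s (v i) • p := ⟨_, rfl⟩
  have hkM : k ∈ Submodule.span ℝ (Set.range v) :=
    hk ▸ Submodule.sub_mem _ (hv i) (Submodule.smul_mem _ _ hpM)
  have hsk : s k = 0 := by simp [hk, hp]
  have hvi : ∀ x, isoQuad s w c (v i) x = s (v i) * isoQuad s w c p x + isoQuad s w c k x := by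
    intro x
    rw [← isoQuad_smul, ← isoQuad_add, hk, add_sub_cancel]
  have h1 := hkz k hkM hsk
  rw [isoQuad_convexComb s w c _ _ _ h, hsk] at h1
  rw [hvi z, hvi x, hvi y]
  linear_combination s (v i) * hpz + h1

lemma convexOn_isoQuad {v : V} (hv : 0 ≤ s v) : ConvexOn ℝ Set.univ (isoQuad s w c v) := by
  refine ⟨convex_univ, fun x _ y _ α β hα hβ h => ?_⟩
  rw [isoQuad_convexComb s w c v x y h, smul_eq_mul, smul_eq_mul]
  have : 0 ≤ (x - y) ⬝ᵥ (x - y) := Finset.sum_nonneg fun i _ => mul_self_nonneg _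
  have : 0 ≤ s v * (α * β * ((x - y) ⬝ᵥ (x - y))) := by positivity
  linarith

/-- An isotropic quadratic function bounded below on a line has nonnegative leading coefficient. -/
lemma nonneg_of_isoQuad_nonneg_line {v : V} {x u : Fin n → ℝ} (hu : u ≠ 0)
    (h : ∀ t : ℝ, 0 ≤ isoQuad s w c v (x + t • u)) : 0 ≤ s v := by
  by_contra! hs
  have hu' := dotProduct_self_pos_of_ne_zero hu
  have h0 := h 0
  rw [zero_smul, add_zero] at h0
  obtain ⟨t, -, ht⟩ := exists_nonneg_root (p := -(s v) * (u ⬝ᵥ u))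
    (q := -(2 * (s v * (x ⬝ᵥ u) + w v ⬝ᵥ u)))
    (r := -isoQuad s w c v x - 1) (mul_pos (by linarith) hu') (by linarith)
  have := h t
  rw [isoQuad_add_smul] at this
  linarith

end IsotropicQuadratics

lemma Qmat_quadForm {n : ℕ} (A : Matrix (Fin n) (Fin n) ℝ) (b : Fin n → ℝ) (c : ℝ)
    (x : Fin n → ℝ) :
    Sum.elim x (fun _ : Unit => (1 : ℝ)) ⬝ᵥ
      (Qmat A b c).mulVec (Sum.elim x fun _ : Unit => (1 : ℝ)) = qf A b c x := by
  have h1 : (Matrix.of fun i (_ : Unit) => b i) *ᵥ (fun _ : Unit => (1 : ℝ)) = b := by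
    ext i; simp [mulVec, dotProduct]
  have h2 : (Matrix.of fun (_ : Unit) j => b j) *ᵥ x = fun _ => b ⬝ᵥ x := by
    ext i; simp [mulVec, dotProduct]
  have h3 : (Matrix.of fun (_ _ : Unit) => c) *ᵥ (fun _ : Unit => (1 : ℝ)) = fun _ => c := by
    ext i; simp [mulVec, dotProduct]
  rw [Qmat, fromBlocks_mulVec, Sum.elim_comp_inl, Sum.elim_comp_inr, sumElim_dotProduct_sumElim,
    h1, h2, h3, dotProduct_add, qf, dotProduct_comm x b]
  simp [dotProduct]
  ring

lemma continuous_qf {n : ℕ} (A : Matrix (Fin n) (Fin n) ℝ) (b : Fin n → ℝ) (c : ℝ) :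
    Continuous (qf A b c) := by
  unfold qf
  fun_prop

lemma quadForm_sum_Qmat {n m : ℕ} (A : Fin m → Matrix (Fin n) (Fin n) ℝ) (b : Fin m → Fin n → ℝ)
    (c : Fin m → ℝ) (θ : Fin m → ℝ) (x : Fin n → ℝ) :
    Sum.elim x (fun _ : Unit => (1 : ℝ)) ⬝ᵥ
      (∑ i, θ i • Qmat (A i) (b i) (c i)).mulVec (Sum.elim x fun _ : Unit => (1 : ℝ))
      = ∑ i, θ i * qf (A i) (b i) (c i) x := by
  rw [sum_mulVec, dotProduct_sum]
  simp only [smul_mulVec, dotProduct_smul, Qmat_quadForm, smul_eq_mul]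

lemma sum_mul_qf_pos_of_posDef {n m : ℕ} {A : Fin m → Matrix (Fin n) (Fin n) ℝ}
    {b : Fin m → Fin n → ℝ} {c : Fin m → ℝ} {θ : Fin m → ℝ}
    (h : (∑ i, θ i • Qmat (A i) (b i) (c i)).PosDef) (x : Fin n → ℝ) :
    0 < ∑ i, θ i * qf (A i) (b i) (c i) x := by
  have hne : Sum.elim x (fun _ : Unit => (1 : ℝ)) ≠ 0 := fun h0 => by
    simpa using congrFun h0 (Sum.inr ())
  have := h.dotProduct_mulVec_pos hne
  rwa [star_trivial, quadForm_sum_Qmat] at this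

/-- If the matrices `Qmat (A i) (b i) (c i)` span a line containing a positive definite matrix,
then `Sset` is either empty or everything. -/
lemma Sset_eq_univ_of_finrank_eq_one {n m : ℕ} {A : Fin m → Matrix (Fin n) (Fin n) ℝ}
    {b : Fin m → Fin n → ℝ} {c : Fin m → ℝ} {θ : Fin m → ℝ}
    (hdim : Module.finrank ℝ
      (Submodule.span ℝ (Set.range fun i => Qmat (A i) (b i) (c i))) = 1)
    (hθ : (∑ i, θ i • Qmat (A i) (b i) (c i)).PosDef) (hS : (Sset A b c).Nonempty) :
    Sset A b c = Set.univ := by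
  set P := ∑ i, θ i • Qmat (A i) (b i) (c i) with hP
  have hPM : P ∈ Submodule.span ℝ (Set.range fun i => Qmat (A i) (b i) (c i)) :=
    Submodule.sum_mem _ fun i _ => Submodule.smul_mem _ _ (Submodule.subset_span ⟨i, rfl⟩)
  have hP0 : (⟨P, hPM⟩ : Submodule.span ℝ (Set.range fun i => Qmat (A i) (b i) (c i))) ≠ 0 := by
    intro h
    have h0 : P = 0 := congrArg Subtype.val h
    have := hθ.diag_pos (i := Sum.inr ())
    simp [h0] at this
  obtain ⟨x₀, hx₀⟩ := hS
  refine Set.eq_univ_of_forall fun x i => ?_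
  obtain ⟨r, hr⟩ := (finrank_eq_one_iff_of_nonzero' _ hP0).1 hdim
    ⟨Qmat (A i) (b i) (c i), Submodule.subset_span ⟨i, rfl⟩⟩
  have hr' : r • P = Qmat (A i) (b i) (c i) := congrArg Subtype.val hr
  have hq : ∀ y, qf (A i) (b i) (c i) y = r * ∑ i, θ i * qf (A i) (b i) (c i) y := fun y => by
    rw [← Qmat_quadForm, ← hr', smul_mulVec, dotProduct_smul, hP, quadForm_sum_Qmat, smul_eq_mul]
  have h0 := hx₀ i
  rw [hq] at h0 ⊢
  have hr0 : r < 0 := (pos_iff_neg_of_mul_neg (by rwa [mul_comm] at h0)).1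
    (sum_mul_qf_pos_of_posDef hθ x₀)
  exact mul_neg_of_neg_of_pos hr0 (sum_mul_qf_pos_of_posDef hθ x)

/-- Sets defined by linear and sphere constraints: under the dimension/PDLC condition,
the convex hull is given by the aggregations whose quadratic part is PSD. -/
theorem statement9 (n m : ℕ)
    (A : Fin m → Matrix (Fin n) (Fin n) ℝ) (b : Fin m → Fin n → ℝ) (c : Fin m → ℝ)
    (hA : ∀ i, A i = 1 ∨ A i = -1 ∨ A i = 0)
    (hspan :
      Module.finrank ℝ
          (Submodule.span ℝ (Set.range fun i => Qmat (A i) (b i) (c i))) ≤ n - 1 ∨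
      (Module.finrank ℝ
          (Submodule.span ℝ (Set.range fun i => Qmat (A i) (b i) (c i))) = n ∧
        ∃ θ : Fin m → ℝ, (∑ i, θ i • Qmat (A i) (b i) (c i)).PosDef))
    (hS : (Sset A b c).Nonempty)
    (hconv : convexHull ℝ (Sset A b c) ≠ Set.univ) :
    convexHull ℝ (Sset A b c) =
      ⋂ lam ∈ {lam : Fin m → ℝ | 0 ≤ lam ∧ lam ≠ 0 ∧ (∑ i, lam i • A i).PosSemidef},
        Sagg A b c lam := by
  rcases Nat.lt_or_ge n 2 with hn | hn
  · exfalso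
    have hne : Nonempty (Fin m) := by
      by_contra h
      rw [not_nonempty_iff] at h
      exact hconv (by simp [Sset])
    obtain ⟨i₀⟩ := hne
    interval_cases n
    · exact hconv ((hS.convexHull (𝕜 := ℝ)).eq_univ)
    · rcases hspan with h | ⟨h, θ, hθ⟩
      · rw [Nat.sub_self, Nat.le_zero, Submodule.finrank_eq_zero] at h
        have h0 : Qmat (A i₀) (b i₀) (c i₀) = 0 := by
          have := Submodule.subset_span (R := ℝ)
            (Set.mem_range_self (f := fun i => Qmat (A i) (b i) (c i)) i₀)
          rwa [h] at this
        obtain ⟨x, hx⟩ := hS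
        have := hx i₀
        rw [← Qmat_quadForm, h0] at this
        simp at this
      · exact hconv (by rw [Sset_eq_univ_of_finrank_eq_one h hθ hS, convexHull_univ])
  let j₀ : Fin n := ⟨0, by omega⟩
  let s : Matrix (Fin n ⊕ Unit) (Fin n ⊕ Unit) ℝ →ₗ[ℝ] ℝ :=
    Matrix.entryLinearMap ℝ ℝ (Sum.inl j₀) (Sum.inl j₀)
  let w : Matrix (Fin n ⊕ Unit) (Fin n ⊕ Unit) ℝ →ₗ[ℝ] Fin n → ℝ :=
    LinearMap.pi fun j => Matrix.entryLinearMap ℝ ℝ (Sum.inl j) (Sum.inr ())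
  let e : Matrix (Fin n ⊕ Unit) (Fin n ⊕ Unit) ℝ →ₗ[ℝ] ℝ :=
    Matrix.entryLinearMap ℝ ℝ (Sum.inr ()) (Sum.inr ())
  let Q : Fin m → Matrix (Fin n ⊕ Unit) (Fin n ⊕ Unit) ℝ := fun i => Qmat (A i) (b i) (c i)
  have hAs : ∀ i, A i = s (Q i) • 1 := by
    intro i
    have hs : s (Q i) = A i j₀ j₀ := rfl
    rcases hA i with h | h | h <;> rw [hs, h] <;> simp
  have hqf : ∀ i x, qf (A i) (b i) (c i) x = isoQuad s w e (Q i) x := by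
    intro i x
    have hw : w (Q i) = b i := rfl
    have he : e (Q i) = c i := rfl
    rw [qf, isoQuad, hw, he, hAs i, smul_mulVec, one_mulVec, dotProduct_smul, smul_eq_mul]
  have hagg : ∀ (lam : Fin m → ℝ) x,
      ∑ i, lam i * qf (A i) (b i) (c i) x = isoQuad s w e (∑ i, lam i • Q i) x := by
    intro lam x
    simp only [isoQuad_sum, isoQuad_smul, hqf]
  have hAagg : ∀ lam : Fin m → ℝ, ∑ i, lam i • A i = s (∑ i, lam i • Q i) • 1 := by
    intro lam
    rw [map_sum, Finset.sum_smul]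
    refine Finset.sum_congr rfl fun i _ => ?_
    rw [map_smul, smul_assoc, ← hAs]
  apply Set.Subset.antisymm
  · refine Set.subset_iInter₂ fun lam ⟨h0, hne, hpsd⟩ => convexHull_min ?_ ?_
    · intro x hx
      obtain ⟨i, hi⟩ := Function.ne_iff.1 hne
      exact Finset.sum_neg' (fun j _ => mul_nonpos_of_nonneg_of_nonpos (h0 j) (hx j).le)
        ⟨i, Finset.mem_univ i, mul_neg_of_pos_of_neg (lt_of_le_of_ne (h0 i) (Ne.symm hi)) (hx i)⟩
    · have hs : 0 ≤ s (∑ i, lam i • Q i) := by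
        rw [hAagg] at hpsd
        simpa using hpsd.diag_nonneg (i := j₀)
      have := (convexOn_isoQuad s w e hs).convex_lt 0
      simpa [Sagg, hagg] using this
  · intro x hx
    by_contra hxS
    obtain ⟨g, hg⟩ := geometric_hahn_banach_open_point (convex_convexHull ℝ (Sset A b c))
      (isOpen_Sset A b c).convexHull hxS
    have hM : Module.finrank ℝ (Submodule.span ℝ (Set.range Q)) + 1 ≤ n ∨
        Module.finrank ℝ (Submodule.span ℝ (Set.range Q)) = n ∧
          ∃ p ∈ Submodule.span ℝ (Set.range Q), 0 < s p ∧ ∀ x, 0 < isoQuad s w e p x := by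
      refine hspan.imp (fun h => by
        change Module.finrank ℝ (Submodule.span ℝ (Set.range Q)) ≤ n - 1 at h
        omega) fun ⟨h, θ, hθ⟩ => ?_
      refine ⟨h, ∑ i, θ i • Q i, Submodule.sum_mem _ fun i _ =>
        Submodule.smul_mem _ _ (Submodule.subset_span ⟨i, rfl⟩), hθ.diag_pos, fun y => ?_⟩
      rw [← hagg]
      exact sum_mul_qf_pos_of_posDef hθ y
    have : Nonempty {y // g y = g x} := ⟨⟨x, rfl⟩⟩
    obtain ⟨lam, h0, hne, hlam⟩ := exists_nonneg_weights
      (fun (y : {y // g y = g x}) i => qf (A i) (b i) (c i) y)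
      (fun ⟨y, hy⟩ ⟨z, hz⟩ α β hα hβ h => by
        obtain ⟨o, τ, hτ, hgo, ho⟩ :=
          exists_smul_isoQuad_eq s w e Q hM g.toLinearMap hy hz hα hβ h
        refine ⟨⟨o, hgo⟩, τ, hτ, funext fun i => ?_⟩
        simpa [hqf] using ho i)
      (fun ⟨y, hy⟩ hneg => (hg y (subset_convexHull ℝ _ hneg)).ne hy)
    simp only [hagg] at hlam
    obtain ⟨u, hu, hu0⟩ := Submodule.exists_mem_ne_zero_of_ne_bot
      (LinearMap.ker_ne_bot_of_finrank_lt (f := g.toLinearMap) (by simp; omega))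
    have hgu : g u = 0 := hu
    have hs : 0 ≤ s (∑ i, lam i • Q i) := nonneg_of_isoQuad_nonneg_line s w e (x := x) hu0
      fun t => hlam ⟨x + t • u, by simp [hgu]⟩
    have hxl : x ∈ Sagg A b c lam := by
      refine Set.mem_iInter₂.1 hx lam ⟨h0, hne, ?_⟩
      rw [hAagg]
      exact PosSemidef.one.smul hs
    have : ∑ i, lam i * qf (A i) (b i) (c i) x < 0 := hxl
    rw [hagg] at this
    exact this.not_ge (hlam ⟨x, rfl⟩)

end
end

section
/- Let f_i(x) = xᵀA_ix + 2b_iᵀx + c_i, i ∈ [m], be quadratic functions on ℝⁿ with each A_i equal to I_n, −I_n, or the zero matrix, and let P, N, Z denote the index sets where A_i = I_n, A_i = −I_n, A_i = 0 respectively. Suppose conv(S) = ⋂_{λ∈Ω} S_λ, where Ω = {λ ≥ 0 nonzero : conv(S) ⊆ S_λ and Σᵢ λ_iA_i positive semidefinite}. Then conv(S) = (⋂_{i∈P∪Z} {x : f_i(x) < 0}) ∩ (⋂_{i∈P, j∈N} {x : f_i(x) + f_j(x) < 0}); in particular conv(S) is described by at most |P||N| + |P| + |Z| aggregations, and every good aggregation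 Σᵢ λ_i f_i with λ ∈ Ω is a nonnegative combination of the functions f_i (i ∈ P∪Z) and f_i + f_j (i ∈ P, j ∈ N). -/
open Matrix Set

noncomputable section

/-- A quadratic function with positive semidefinite matrix is convex. -/
theorem convexOn_qf {n : ℕ} {A : Matrix (Fin n) (Fin n) ℝ} (hA : A.PosSemidef)
    (b : Fin n → ℝ) (c : ℝ) : ConvexOn ℝ univ (qf A b c) := by
  refine ⟨convex_univ, fun x _ y _ s t hs ht hst => ?_⟩
  have h : 0 ≤ (x - y) ⬝ᵥ A.mulVec (x - y) := by
    simpa using hA.dotProduct_mulVec_nonneg (x - y)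
  have key : s * qf A b c x + t * qf A b c y - qf A b c (s • x + t • y) =
      s * t * ((x - y) ⬝ᵥ A.mulVec (x - y)) := by
    obtain rfl : t = 1 - s := by linarith
    simp only [qf, mulVec_add, mulVec_sub, mulVec_smul, add_dotProduct, dotProduct_add,
      sub_dotProduct, dotProduct_sub, smul_dotProduct, dotProduct_smul, smul_eq_mul]
    ring
  have := mul_nonneg (mul_nonneg hs ht) h
  simp only [smul_eq_mul]
  linarith

theorem qf_add {n : ℕ} (A A' : Matrix (Fin n) (Fin n) ℝ) (b b' : Fin n → ℝ) (c c' : ℝ)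
    (x : Fin n → ℝ) : qf (A + A') (b + b') (c + c') x = qf A b c x + qf A' b' c' x := by
  simp only [qf, add_mulVec, dotProduct_add, add_dotProduct]
  ring

/-- A nonnegative combination of values in which the weight on `N` is dominated by the weight
on `P` is a nonnegative combination of the values on `P ∪ Z` and of the pair sums over
`P × N`. -/
theorem exists_pair_decomposition {ι : Type*} [Fintype ι] [DecidableEq ι] {P N Z : Finset ι}
    (hPN : Disjoint P N) (hPZ : Disjoint P Z) (hNZ : Disjoint N Z)
    (hcover : P ∪ N ∪ Z = Finset.univ) {lam : ι → ℝ} (hlam : 0 ≤ lam)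
    (hle : ∑ j ∈ N, lam j ≤ ∑ i ∈ P, lam i) :
    ∃ (α : ι → ℝ) (γ : ι → ι → ℝ), (∀ i, 0 ≤ α i) ∧ (∀ i j, 0 ≤ γ i j) ∧
      ∀ F : ι → ℝ, ∑ i, lam i * F i =
        (∑ i ∈ P ∪ Z, α i * F i) + ∑ i ∈ P, ∑ j ∈ N, γ i j * (F i + F j) := by
  set p := ∑ i ∈ P, lam i with hp
  set q := ∑ j ∈ N, lam j with hq
  have hp0 : 0 ≤ p := Finset.sum_nonneg fun i _ => hlam i
  have hq0 : 0 ≤ q := Finset.sum_nonneg fun i _ => hlam i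
  refine ⟨fun i => if i ∈ P then lam i * (1 - q / p) else lam i, fun i j => lam i * lam j / p,
    fun i => ?_, fun i j => div_nonneg (mul_nonneg (hlam i) (hlam j)) hp0, fun F => ?_⟩
  · dsimp only
    split_ifs
    · exact mul_nonneg (hlam i) (sub_nonneg.2 (div_le_one_of_le₀ hle hp0))
    · exact hlam i
  have hP : ∑ i ∈ P, (if i ∈ P then lam i * (1 - q / p) else lam i) * F i =
      (1 - q / p) * ∑ i ∈ P, lam i * F i := by
    rw [Finset.mul_sum]
    refine Finset.sum_congr rfl fun i hi => ?_
    rw [if_pos hi]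
    ring
  have hZ : ∑ i ∈ Z, (if i ∈ P then lam i * (1 - q / p) else lam i) * F i =
      ∑ i ∈ Z, lam i * F i :=
    Finset.sum_congr rfl fun i hi => by rw [if_neg (Finset.disjoint_right.1 hPZ hi)]
  have hγ : ∑ i ∈ P, ∑ j ∈ N, lam i * lam j / p * (F i + F j) =
      q / p * ∑ i ∈ P, lam i * F i + p / p * ∑ j ∈ N, lam j * F j := by
    have h1 : q / p * ∑ i ∈ P, lam i * F i = ∑ i ∈ P, ∑ j ∈ N, lam i * lam j / p * F i := by
      rw [hq, Finset.sum_div, Finset.sum_mul_sum, Finset.sum_comm]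
      exact Finset.sum_congr rfl fun i _ => Finset.sum_congr rfl fun j _ => by ring
    have h2 : p / p * ∑ j ∈ N, lam j * F j = ∑ i ∈ P, ∑ j ∈ N, lam i * lam j / p * F j := by
      conv_lhs => enter [1, 1]; rw [hp]
      rw [Finset.sum_div, Finset.sum_mul_sum]
      exact Finset.sum_congr rfl fun i _ => Finset.sum_congr rfl fun j _ => by ring
    rw [h1, h2, ← Finset.sum_add_distrib]
    refine Finset.sum_congr rfl fun i _ => ?_
    rw [← Finset.sum_add_distrib]
    exact Finset.sum_congr rfl fun j _ => by ring
  have hN : p / p * ∑ j ∈ N, lam j * F j = ∑ j ∈ N, lam j * F j := by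
    rcases hp0.eq_or_lt with h | h
    · have hz : ∀ j ∈ N, lam j = 0 :=
        (Finset.sum_eq_zero_iff_of_nonneg fun i _ => hlam i).1 (le_antisymm (h ▸ hle) hq0)
      have : ∑ j ∈ N, lam j * F j = 0 :=
        Finset.sum_eq_zero fun j hj => by rw [hz j hj, zero_mul]
      rw [this, mul_zero]
    · rw [div_self h.ne', one_mul]
  rw [← hcover, Finset.sum_union (Finset.disjoint_union_left.2 ⟨hPZ, hNZ⟩),
    Finset.sum_union hPN, Finset.sum_union hPZ, hP, hZ, hγ, hN]
  ring

/-- If a nonzero nonnegative weight decomposes over single values on `T` and pair sums over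
`P × N`, and all of those are negative, then so is the weighted sum. -/
theorem sum_mul_neg_of_pair_decomposition {ι : Type*} [Fintype ι] {P N T : Finset ι}
    {lam α : ι → ℝ} {γ : ι → ι → ℝ} (hlam : 0 ≤ lam) (hne : lam ≠ 0)
    (hα : ∀ i, 0 ≤ α i) (hγ : ∀ i j, 0 ≤ γ i j)
    (hdec : ∀ F : ι → ℝ, ∑ i, lam i * F i =
      (∑ i ∈ T, α i * F i) + ∑ i ∈ P, ∑ j ∈ N, γ i j * (F i + F j))
    {F : ι → ℝ} (hT : ∀ i ∈ T, F i < 0) (hPN : ∀ i ∈ P, ∀ j ∈ N, F i + F j < 0) :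
    ∑ i, lam i * F i < 0 := by
  have h1 : ∀ i ∈ T, α i * F i ≤ 0 := fun i hi =>
    mul_nonpos_of_nonneg_of_nonpos (hα i) (hT i hi).le
  have h2 : ∀ i ∈ P, ∀ j ∈ N, γ i j * (F i + F j) ≤ 0 := fun i hi j hj =>
    mul_nonpos_of_nonneg_of_nonpos (hγ i j) (hPN i hi j hj).le
  have h3 : ∀ i ∈ P, ∑ j ∈ N, γ i j * (F i + F j) ≤ 0 := fun i hi =>
    Finset.sum_nonpos (h2 i hi)
  have s1 := Finset.sum_nonpos h1
  have s2 := Finset.sum_nonpos h3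
  by_contra hcon
  rw [hdec F] at hcon
  have z1 := (Finset.sum_eq_zero_iff_of_nonpos h1).1 (by linarith)
  have z2 := (Finset.sum_eq_zero_iff_of_nonpos h3).1 (by linarith)
  have hα0 : ∀ i ∈ T, α i = 0 := fun i hi =>
    (mul_eq_zero.1 (z1 i hi)).resolve_right (hT i hi).ne
  have hγ0 : ∀ i ∈ P, ∀ j ∈ N, γ i j = 0 := fun i hi j hj =>
    (mul_eq_zero.1 ((Finset.sum_eq_zero_iff_of_nonpos (h2 i hi)).1 (z2 i hi) j hj)).resolve_right
      (hPN i hi j hj).ne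
  have hsum := hdec fun _ => 1
  rw [Finset.sum_eq_zero (s := T) fun i hi => by rw [hα0 i hi, zero_mul],
    Finset.sum_eq_zero (s := P) fun i hi => Finset.sum_eq_zero fun j hj => by
      rw [hγ0 i hi j hj, zero_mul],
    add_zero] at hsum
  simp only [mul_one] at hsum
  exact hne (funext fun i =>
    (Finset.sum_eq_zero_iff_of_nonneg fun i _ => hlam i).1 hsum i (Finset.mem_univ i))

/-- For matrices equal to `1`, `-1` or `0`, a positive semidefinite nonnegative combination
decomposes over the indices in `P ∪ Z` and the pairs in `P × N`. -/
theorem exists_pair_decomposition_of_posSemidef {n m : ℕ}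
    {A : Fin m → Matrix (Fin n) (Fin n) ℝ} (hA : ∀ i, A i = 1 ∨ A i = -1 ∨ A i = 0)
    {P N Z : Finset (Fin m)}
    (hP : ∀ i, i ∈ P ↔ A i = 1) (hN : ∀ i, i ∈ N ↔ A i = -1) (hZ : ∀ i, i ∈ Z ↔ A i = 0)
    {lam : Fin m → ℝ} (hlam : 0 ≤ lam) (hpsd : (∑ i, lam i • A i).PosSemidef) :
    ∃ (α : Fin m → ℝ) (γ : Fin m → Fin m → ℝ), (∀ i, 0 ≤ α i) ∧ (∀ i j, 0 ≤ γ i j) ∧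
      ∀ F : Fin m → ℝ, ∑ i, lam i * F i =
        (∑ i ∈ P ∪ Z, α i * F i) + ∑ i ∈ P, ∑ j ∈ N, γ i j * (F i + F j) := by
  rcases n with _ | n
  · have : P ∪ Z = Finset.univ :=
      Finset.eq_univ_of_forall fun i =>
        Finset.mem_union_left _ ((hP i).2 (Subsingleton.elim _ _))
    exact ⟨lam, 0, hlam, fun _ _ => le_rfl, fun F => by simp [this]⟩
  have hentry : ∀ {i} {r : Matrix (Fin (n + 1)) (Fin (n + 1)) ℝ}, A i = r → A i 0 0 = r 0 0 :=
    fun h => by rw [h]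
  have eP : ∀ i ∈ P, A i 0 0 = 1 := fun i hi => by simpa using hentry ((hP i).1 hi)
  have eN : ∀ i ∈ N, A i 0 0 = -1 := fun i hi => by simpa using hentry ((hN i).1 hi)
  have eZ : ∀ i ∈ Z, A i 0 0 = 0 := fun i hi => by simpa using hentry ((hZ i).1 hi)
  have hPN : Disjoint P N := Finset.disjoint_left.2 fun i h h' => by
    linarith [eP i h, eN i h']
  have hPZ : Disjoint P Z := Finset.disjoint_left.2 fun i h h' => by
    linarith [eP i h, eZ i h']
  have hNZ : Disjoint N Z := Finset.disjoint_left.2 fun i h h' => by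
    linarith [eN i h, eZ i h']
  have hcover : P ∪ N ∪ Z = Finset.univ := Finset.eq_univ_of_forall fun i => by
    simp only [Finset.mem_union, hP, hN, hZ]
    exact or_assoc.2 (hA i)
  refine exists_pair_decomposition hPN hPZ hNZ hcover hlam ?_
  have hdiag : 0 ≤ (∑ i, lam i • A i) 0 0 := hpsd.diag_nonneg
  simp only [Matrix.sum_apply, Matrix.smul_apply, smul_eq_mul] at hdiag
  rw [← hcover, Finset.sum_union (Finset.disjoint_union_left.2 ⟨hPZ, hNZ⟩),
    Finset.sum_union hPN, Finset.sum_congr rfl fun i hi => by rw [eP i hi, mul_one],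
    Finset.sum_congr (s₁ := N) rfl fun i hi => by rw [eN i hi, mul_neg_one],
    Finset.sum_congr (s₁ := Z) rfl fun i hi => by rw [eZ i hi, mul_zero],
    Finset.sum_neg_distrib, Finset.sum_const_zero] at hdiag
  linarith

/-- For linear and sphere constraints whose convex hull is given by good aggregations,
the convex hull is described by the `|P||N| + |P| + |Z|` aggregations `fᵢ` (`i ∈ P ∪ Z`)
and `fᵢ + fⱼ` (`i ∈ P, j ∈ N`), and every good aggregation is a nonnegative combination
of these. -/
theorem statement11 (n m : ℕ)
    (A : Fin m → Matrix (Fin n) (Fin n) ℝ) (b : Fin m → Fin n → ℝ) (c : Fin m → ℝ)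
    (hA : ∀ i, A i = 1 ∨ A i = -1 ∨ A i = 0)
    (P N Z : Finset (Fin m))
    (hP : ∀ i, i ∈ P ↔ A i = 1) (hN : ∀ i, i ∈ N ↔ A i = -1) (hZ : ∀ i, i ∈ Z ↔ A i = 0)
    (Ω' : Set (Fin m → ℝ))
    (hΩ' : Ω' = {lam | 0 ≤ lam ∧ lam ≠ 0 ∧ convexHull ℝ (Sset A b c) ⊆ Sagg A b c lam ∧
      (∑ i, lam i • A i).PosSemidef})
    (hagg : convexHull ℝ (Sset A b c) = ⋂ lam ∈ Ω', Sagg A b c lam) :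
    convexHull ℝ (Sset A b c) =
      (⋂ i ∈ P ∪ Z, {x | qf (A i) (b i) (c i) x < 0}) ∩
      (⋂ i ∈ P, ⋂ j ∈ N, {x | qf (A i) (b i) (c i) x + qf (A j) (b j) (c j) x < 0}) ∧
    ∀ lam ∈ Ω', ∃ (α : Fin m → ℝ) (γ : Fin m → Fin m → ℝ),
      (∀ i, 0 ≤ α i) ∧ (∀ i j, 0 ≤ γ i j) ∧
      ∀ x, ∑ i, lam i * qf (A i) (b i) (c i) x =
        (∑ i ∈ P ∪ Z, α i * qf (A i) (b i) (c i) x) +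
        ∑ i ∈ P, ∑ j ∈ N, γ i j * (qf (A i) (b i) (c i) x + qf (A j) (b j) (c j) x) := by
  subst hΩ'
  refine ⟨Subset.antisymm ?_ fun x hx => ?_, fun lam hlam => ?_⟩
  · refine subset_inter (subset_iInter₂ fun i hi => ?_)
      (subset_iInter₂ fun i hi => subset_iInter₂ fun j hj => ?_)
    · have hpsd : (A i).PosSemidef := by
        rcases Finset.mem_union.1 hi with h | h
        · rw [(hP i).1 h]
          exact Matrix.PosSemidef.one
        · rw [(hZ i).1 h]
          exact Matrix.PosSemidef.zero
      refine convexHull_min (fun x hx => hx i) ?_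
      simpa using (convexOn_qf hpsd (b i) (c i)).convex_lt 0
    · have hpsd : (A i + A j).PosSemidef := by
        rw [(hP i).1 hi, (hN j).1 hj, add_neg_cancel]
        exact Matrix.PosSemidef.zero
      refine convexHull_min (fun x hx => add_neg (hx i) (hx j)) ?_
      simpa [qf_add] using (convexOn_qf hpsd (b i + b j) (c i + c j)).convex_lt 0
  · rw [hagg]
    refine mem_iInter₂.2 fun lam hlam => ?_
    obtain ⟨hnn, hne, -, hpsd⟩ := hlam
    obtain ⟨α, γ, hα, hγ, hdec⟩ :=
      exists_pair_decomposition_of_posSemidef hA hP hN hZ hnn hpsd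
    simp only [mem_inter_iff, mem_iInter, mem_ofPred_eq] at hx
    exact sum_mul_neg_of_pair_decomposition hnn hne hα hγ hdec hx.1 hx.2
  · obtain ⟨hnn, -, -, hpsd⟩ := hlam
    obtain ⟨α, γ, hα, hγ, hdec⟩ :=
      exists_pair_decomposition_of_posSemidef hA hP hN hZ hnn hpsd
    exact ⟨α, γ, hα, hγ, fun x => hdec fun i => qf (A i) (b i) (c i) x⟩

end
end

section
/- Let n ≥ 3 and let f_1,…,f_m be quadratic functions f_i(x) = xᵀA_ix + 2b_iᵀx + c_i on ℝⁿ such that the span of Q_1,…,Q_m is three dimensional and there exists θ ∈ ℝᵐ with Σᵢ θ_iQ_i positive definite. Suppose S ≠ ∅ and conv(S) ≠ ℝⁿ. Then there exists Ω' ⊆ Ω with |Ω'| ≤ 2m such that conv(S) = ⋂_{λ∈Ω'} S_λ. -/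
open Matrix Set

noncomputable section

section CrossProduct

open scoped Matrix

theorem dotProduct_smul_of_cross_eq_zero {g c : Fin 3 → ℝ} (h : g ⨯₃ c = 0) (p : Fin 3 → ℝ) :
    (p ⬝ᵥ c) • g = (p ⬝ᵥ g) • c := by
  have h0 := congrFun h 0
  have h1 := congrFun h 1
  have h2 := congrFun h 2
  simp [cross_apply] at h0 h1 h2
  ext i
  fin_cases i <;> simp [dotProduct, Fin.sum_univ_three]
  · linear_combination p 1 * h2 - p 2 * h1
  · linear_combination p 2 * h0 - p 0 * h2
  · linear_combination p 0 * h1 - p 1 * h0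

theorem dotProduct_self_pos {ι : Type*} [Fintype ι] {v : ι → ℝ} (hv : v ≠ 0) : 0 < v ⬝ᵥ v :=
  lt_of_le_of_ne (Finset.sum_nonneg fun i _ => mul_self_nonneg (v i)) fun h =>
    hv (dotProduct_self_eq_zero.mp h.symm)

theorem cross_eq_zero_of_dotProduct_eq_zero {g c N : Fin 3 → ℝ} (hN : N ≠ 0)
    (hc : N ⬝ᵥ c = 0) (h1 : N ⬝ᵥ g = 0) (h2 : (c ⨯₃ N) ⬝ᵥ g = 0) : g ⨯₃ c = 0 := by
  have key : (N ⬝ᵥ N) • (g ⨯₃ c) = 0 := by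
    simp only [cross_apply, dotProduct, Fin.sum_univ_three] at *
    simp at h2
    ext i
    fin_cases i <;> simp [-mul_eq_zero]
    · linear_combination (g 1 * N 2 - g 2 * N 1) * hc + N 0 * h2 + (c 2 * N 1 - c 1 * N 2) * h1
    · linear_combination (g 2 * N 0 - g 0 * N 2) * hc + N 1 * h2 + (c 0 * N 2 - c 2 * N 0) * h1
    · linear_combination (g 0 * N 1 - g 1 * N 0) * hc + N 2 * h2 + (c 1 * N 0 - c 0 * N 1) * h1
  exact (smul_eq_zero.mp key).resolve_left fun h => hN (dotProduct_self_eq_zero.mp h)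

theorem cross_eq_smul_of_dotProduct_eq_zero {a b l : Fin 3 → ℝ} (ha : l ⬝ᵥ a = 0)
    (hb : l ⬝ᵥ b = 0) : (l ⬝ᵥ l) • (a ⨯₃ b) = (l ⬝ᵥ (a ⨯₃ b)) • l := by
  simp only [cross_apply, dotProduct, Fin.sum_univ_three] at *
  ext i
  fin_cases i <;> simp
  · linear_combination (l 1 * b 2 - l 2 * b 1) * ha - (l 1 * a 2 - l 2 * a 1) * hb
  · linear_combination (l 2 * b 0 - l 0 * b 2) * ha - (l 2 * a 0 - l 0 * a 2) * hb
  · linear_combination (l 0 * b 1 - l 1 * b 0) * ha - (l 0 * a 1 - l 1 * a 0) * hb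

theorem smul_eq_of_dotProduct_cross_eq_zero {a r v : Fin 3 → ℝ} (h : (a ⨯₃ r) ⬝ᵥ v = 0) :
    ((a ⨯₃ r) ⬝ᵥ (a ⨯₃ r)) • v =
      ((v ⨯₃ r) ⬝ᵥ (a ⨯₃ r)) • a + ((a ⨯₃ v) ⬝ᵥ (a ⨯₃ r)) • r := by
  simp only [cross_apply, dotProduct, Fin.sum_univ_three] at *
  simp at h
  ext i
  fin_cases i <;> simp
  · linear_combination (a 1 * r 2 - a 2 * r 1) * h
  · linear_combination (a 2 * r 0 - a 0 * r 2) * h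
  · linear_combination (a 0 * r 1 - a 1 * r 0) * h

end CrossProduct


section HiddenConvexity

variable {E : Type*} [AddCommGroup E] [Module ℝ E]

theorem exists_common_zero_of_path (h₁ h₂ : E →ₗ[ℝ] E →ₗ[ℝ] ℝ) (hs₁ : ∀ x y, h₁ x y = h₁ y x)
    {p q z : E} {k : ℝ} (hk : 0 ≤ k) (hp : h₁ p p = 0) (hq : h₁ q q = 0) (hpz : h₁ p z = 0)
    (hqz : h₁ q z = 0) (hpq : 2 * h₁ p q + k * h₁ z z = 0) (hp2 : 0 ≤ h₂ p p) (hq2 : h₂ q q ≤ 0)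
    (hind : ∀ α β γ : ℝ, α • p + β • q + γ • z = 0 → α = 0 ∧ β = 0) :
    ∃ w, w ≠ 0 ∧ h₁ w w = 0 ∧ h₂ w w = 0 := by
  let w : ℝ → E := fun s => (1 - s) • p + s • q + √(k * (s * (1 - s))) • z
  have hcont : Continuous fun s => h₂ (w s) (w s) := by
    simp only [w, map_add, map_smul, LinearMap.add_apply, LinearMap.smul_apply, smul_eq_mul]
    fun_prop
  have h0 : h₂ (w 0) (w 0) = h₂ p p := by simp [w]
  have h1 : h₂ (w 1) (w 1) = h₂ q q := by simp [w]
  obtain ⟨s, hs, hsz⟩ := intermediate_value_Icc' (zero_le_one (α := ℝ)) hcont.continuousOn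
    (show (0 : ℝ) ∈ Icc _ _ by rw [h0, h1]; exact ⟨hq2, hp2⟩)
  refine ⟨w s, fun h => ?_, ?_, hsz⟩
  · have := hind _ _ _ h
    linarith [this.1, this.2]
  · have hr : √(k * (s * (1 - s))) * √(k * (s * (1 - s))) = k * (s * (1 - s)) :=
      Real.mul_self_sqrt (mul_nonneg hk (mul_nonneg hs.1 (by linarith [hs.2])))
    simp only [w, map_add, map_smul, LinearMap.add_apply, LinearMap.smul_apply, smul_eq_mul]
    rw [hs₁ z p, hs₁ z q, hs₁ q p, hp, hq, hpz, hqz]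
    linear_combination h₁ z z * hr + s * (1 - s) * hpq

theorem exists_common_zero_s12 (hE : 3 ≤ Module.finrank ℝ E) (h₁ h₂ : E →ₗ[ℝ] E →ₗ[ℝ] ℝ)
    (hs₁ : ∀ x y, h₁ x y = h₁ y x) {x y : E} (hx : h₁ x x = 0) (hy : h₁ y y = 0)
    (hx2 : 0 < h₂ x x) (hy2 : h₂ y y < 0) :
    ∃ w, w ≠ 0 ∧ h₁ w w = 0 ∧ h₂ w w = 0 := by
  have hxy : ∀ α β : ℝ, α • x + β • y = 0 → α = 0 ∧ β = 0 := by
    intro α β h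
    have e : h₂ (α • x) (α • x) = h₂ (β • y) (β • y) := by
      rw [eq_neg_of_add_eq_zero_left h]; simp
    simp only [map_smul, LinearMap.smul_apply, smul_eq_mul] at e
    have ha : α * α = 0 := by nlinarith [mul_self_nonneg α, mul_self_nonneg β]
    have hb : β * β = 0 := by nlinarith [mul_self_nonneg α, mul_self_nonneg β]
    exact ⟨mul_self_eq_zero.mp ha, mul_self_eq_zero.mp hb⟩
  by_cases hb : h₁ x y = 0
  · exact exists_common_zero_of_path h₁ h₂ hs₁ le_rfl hx hy (z := 0) (by simp) (by simp)
      (by simp [hb]) hx2.le hy2.le fun α β γ h => hxy α β (by simpa using h)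
  obtain ⟨z₀, hz₀⟩ : ∃ z₀, z₀ ∉ Submodule.span ℝ {x, y} := by
    by_contra! hcon
    have htop : Submodule.span ℝ {x, y} = ⊤ := by ext; simp [hcon]
    classical
    have hle := finrank_span_finset_le_card (R := ℝ) ({x, y} : Finset E)
    have := Finset.card_le_two (a := x) (b := y)
    rw [Set.finrank, Finset.coe_insert, Finset.coe_singleton, htop, finrank_top] at hle
    omega
  set b := h₁ x y with hbdef
  obtain ⟨z, hxz, hyz, hz⟩ : ∃ z, h₁ x z = 0 ∧ h₁ y z = 0 ∧ z ∉ Submodule.span ℝ {x, y} := by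
    refine ⟨z₀ - ((h₁ y z₀ / b) • x + (h₁ x z₀ / b) • y), ?_, ?_, fun h => hz₀ ?_⟩
    · simp only [map_sub, map_add, map_smul, hx, ← hbdef, smul_eq_mul]
      field_simp; ring
    · simp only [map_sub, map_add, map_smul, hy, hs₁ y x, ← hbdef, smul_eq_mul]
      field_simp; ring
    · have hmem : (h₁ y z₀ / b) • x + (h₁ x z₀ / b) • y ∈ Submodule.span ℝ {x, y} :=
        Submodule.mem_span_pair.mpr ⟨_, _, rfl⟩
      simpa using Submodule.add_mem _ h hmem
  have hxyz : ∀ α β γ : ℝ, α • x + β • y + γ • z = 0 → α = 0 ∧ β = 0 ∧ γ = 0 := by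
    intro α β γ h
    have hγ : γ = 0 := by
      by_contra hγ
      refine hz (Submodule.mem_span_pair.mpr ⟨-(α / γ), -(β / γ), ?_⟩)
      have : z = γ⁻¹ • (γ • z) := by rw [smul_smul, inv_mul_cancel₀ hγ, one_smul]
      rw [this, eq_neg_of_add_eq_zero_right h]
      module
    subst hγ
    obtain ⟨h1, h2⟩ := hxy α β (by simpa using h)
    exact ⟨h1, h2, rfl⟩
  rcases lt_trichotomy (b * h₁ z z) 0 with he | he | he
  · have hzz : h₁ z z ≠ 0 := by rintro h; simp [h] at he
    refine exists_common_zero_of_path h₁ h₂ hs₁ (k := -2 * b / h₁ z z) ?_ hx hy hxz hyz ?_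
      hx2.le hy2.le fun α β γ h => ⟨(hxyz α β γ h).1, (hxyz α β γ h).2.1⟩
    · have : -2 * b / h₁ z z = -2 * (b * h₁ z z) / (h₁ z z) ^ 2 := by field_simp
      rw [this]
      exact div_nonneg (by linarith) (sq_nonneg _)
    · rw [← hbdef]; field_simp; ring
  · have hzz : h₁ z z = 0 := (mul_eq_zero.mp he).resolve_left hb
    rcases le_total 0 (h₂ z z) with h | h
    · exact exists_common_zero_of_path h₁ h₂ hs₁ le_rfl hzz hy (z := 0) (by simp) (by simp)
        (by simp [hs₁ z y, hyz]) h hy2.le fun α β γ h => by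
          have := hxyz 0 β α (by simpa [add_comm] using h)
          exact ⟨this.2.2, this.2.1⟩
    · exact exists_common_zero_of_path h₁ h₂ hs₁ le_rfl hx hzz (z := 0) (by simp) (by simp)
        (by simp [hxz]) hx2.le h fun α β γ h => by
          have := hxyz α 0 β (by simpa using h)
          exact ⟨this.1, this.2.2⟩
  · have hzz : h₁ z z ≠ 0 := by rintro h; simp [h] at he
    refine exists_common_zero_of_path h₁ h₂ hs₁ (q := -y) (k := 2 * b / h₁ z z) ?_ hx (by simpa)
      hxz (by simpa) ?_ hx2.le (by simpa using hy2.le) fun α β γ h => ?_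
    · have : 2 * b / h₁ z z = 2 * (b * h₁ z z) / (h₁ z z) ^ 2 := by field_simp
      rw [this]
      exact div_nonneg (by linarith) (sq_nonneg _)
    · rw [map_neg, ← hbdef]; field_simp; ring
    · have := hxyz α (-β) γ (by simpa using h)
      exact ⟨this.1, by simpa using this.2.1⟩

open scoped Matrix in
theorem exists_quadratic_eq_add (hE : 3 ≤ Module.finrank ℝ E)
    (B : E →ₗ[ℝ] E →ₗ[ℝ] (Fin 3 → ℝ)) (hB : ∀ x y, B x y = B y x) {p : Fin 3 → ℝ}
    (hp : ∀ x, x ≠ 0 → 0 < p ⬝ᵥ B x x) (x y : E) : ∃ z, B z z = B x x + B y y := by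
  rcases eq_or_ne x 0 with rfl | hx0
  · exact ⟨y, by simp⟩
  rcases eq_or_ne y 0 with rfl | hy0
  · exact ⟨x, by simp⟩
  have hpx := hp x hx0
  have hpy := hp y hy0
  set c := B x x + B y y with hc
  have hpc : 0 < p ⬝ᵥ c := by rw [hc, dotProduct_add]; linarith
  have scale : ∀ w, w ≠ 0 → B w w ⨯₃ c = 0 → ∃ z, B z z = c := by
    intro w hw h
    have hpw := hp w hw
    have e := dotProduct_smul_of_cross_eq_zero h p
    refine ⟨√((p ⬝ᵥ c) / (p ⬝ᵥ B w w)) • w, ?_⟩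
    rw [map_smul, map_smul, LinearMap.smul_apply, smul_smul,
      Real.mul_self_sqrt (div_nonneg hpc.le hpw.le), div_eq_inv_mul, mul_smul, e, smul_smul,
      inv_mul_cancel₀ hpw.ne', one_smul]
  set N := B x x ⨯₃ B y y with hN
  by_cases hN0 : N = 0
  · exact scale x hx0 (by rw [hc, map_add, cross_self, ← hN, hN0, add_zero])
  have hNN : 0 < N ⬝ᵥ N :=
    dotProduct_self_pos hN0
  have hNx : N ⬝ᵥ B x x = 0 := by rw [dotProduct_comm]; exact dot_self_cross _ _
  have hNy : N ⬝ᵥ B y y = 0 := by rw [dotProduct_comm]; exact dot_cross_self _ _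
  have hx2 : (c ⨯₃ N) ⬝ᵥ B x x = N ⬝ᵥ N := by
    rw [dotProduct_comm, triple_product_permutation, triple_product_permutation, hc,  map_add,
      cross_self, zero_add, ← hN]
  have hy2 : (c ⨯₃ N) ⬝ᵥ B y y = -(N ⬝ᵥ N) := by
    rw [dotProduct_comm, triple_product_permutation, triple_product_permutation, hc,  map_add,
      cross_self, add_zero, ← cross_anticomm, ← hN, dotProduct_neg]
  let F : (Fin 3 → ℝ) → E →ₗ[ℝ] E →ₗ[ℝ] ℝ := fun v => B.compr₂ (dotProductBilin ℝ ℝ v)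
  have hF : ∀ v x y, F v x y = v ⬝ᵥ B x y := fun v x y => rfl
  obtain ⟨w, hw, hw1, hw2⟩ := exists_common_zero_s12 hE (F N) (F (c ⨯₃ N))
    (fun x y => by rw [hF, hF, hB]) (x := x) (y := y) hNx hNy (by rw [hF, hx2]; exact hNN)
    (by rw [hF, hy2]; linarith)
  exact scale w hw (cross_eq_zero_of_dotProduct_eq_zero hN0
    (by rw [hc, dotProduct_add, hNx, hNy, add_zero]) hw1 hw2)

end HiddenConvexity
section Separation

variable {ι : Type*} [Fintype ι]

theorem exists_nonneg_separating {T : Set (ι → ℝ)} (hadd : ∀ a ∈ T, ∀ b ∈ T, a + b ∈ T)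
    (hsmul : ∀ a ∈ T, ∀ t : ℝ, 0 ≤ t → t • a ∈ T) (hne : T.Nonempty)
    (hT : ∀ a ∈ T, ∃ i, 0 ≤ a i) :
    ∃ l : ι → ℝ, 0 ≤ l ∧ l ≠ 0 ∧ ∀ a ∈ T, 0 ≤ l ⬝ᵥ a := by
  classical
  let s : Set (ι → ℝ) := Set.univ.pi fun _ => Iio 0
  have hs : Convex ℝ s := convex_pi fun _ _ => convex_Iio 0
  have hso : IsOpen s := isOpen_set_pi Set.finite_univ fun _ _ => isOpen_Iio
  have hTc : Convex ℝ T := fun a ha b hb x y hx hy _ =>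
    hadd _ (hsmul a ha x hx) _ (hsmul b hb y hy)
  have hd : Disjoint s T := Set.disjoint_left.mpr fun a has haT => by
    obtain ⟨i, hi⟩ := hT a haT
    exact absurd (has i trivial) (not_lt.mpr hi)
  obtain ⟨f, r, hfs, hfT⟩ := geometric_hahn_banach_open hs hso hTc hd
  have h0T : (0 : ι → ℝ) ∈ T := by
    obtain ⟨a, ha⟩ := hne
    simpa using hsmul a ha 0 le_rfl
  have hr : r ≤ 0 := by simpa using hfT 0 h0T
  have hf : ∀ a, f a = (fun i => f (Pi.single i 1)) ⬝ᵥ a := by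
    intro a
    have := LinearMap.pi_apply_eq_sum_univ (f : (ι → ℝ) →ₗ[ℝ] ℝ) a
    simp only [ContinuousLinearMap.coe_coe, smul_eq_mul] at this
    rw [this, dotProduct]
    refine Finset.sum_congr rfl fun i _ => ?_
    rw [mul_comm]
    congr 2
    ext j
    simp [Pi.single_apply, eq_comm]
  refine ⟨fun i => f (Pi.single i 1), fun i => ?_, fun h => ?_, fun a ha => ?_⟩
  · have hlim : Filter.Tendsto (fun ε : ℝ => f (-Pi.single i 1 - ε • 1)) (nhdsWithin 0 (Ioi 0))
        (nhds (f (-Pi.single i 1 - (0 : ℝ) • 1))) :=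
      ((by fun_prop : Continuous fun ε : ℝ => f (-Pi.single i 1 - ε • 1)).tendsto 0).mono_left
        nhdsWithin_le_nhds
    have := le_of_tendsto hlim (b := 0) (by
      filter_upwards [self_mem_nhdsWithin] with ε hε
      refine ((hfs _ fun j _ => ?_).trans_le hr).le
      have : (0 : ℝ) ≤ (Pi.single i 1 : ι → ℝ) j := by
        rw [Pi.single_apply]; split_ifs <;> norm_num
      have hε' : 0 < ε := hε
      simp only [Pi.sub_apply, Pi.neg_apply, Pi.smul_apply, Pi.one_apply, smul_eq_mul, mem_Iio]
      linarith)
    simpa using this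
  · have h1 := (hfs (-1) fun j _ => by simp).trans_le hr
    rw [hf, h] at h1
    simp at h1
  · rw [← hf]
    by_contra! hneg
    have := hfT _ (hsmul a ha ((1 + -r) / -f a) (div_nonneg (by linarith) (by linarith)))
    rw [map_smul, smul_eq_mul, div_mul_eq_mul_div, le_div_iff₀ (by linarith)] at this
    nlinarith

end Separation

section PolyhedralCone

variable {ι : Type*} [Fintype ι] {u : ι → Fin 3 → ℝ}

local notation "U" => Fintype.linearCombination ℝ u

theorem dotProduct_linearCombination (v : Fin 3 → ℝ) (μ : ι → ℝ) :
    v ⬝ᵥ U μ = ∑ i, μ i * (v ⬝ᵥ u i) := by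
  rw [Fintype.linearCombination_apply, dotProduct_sum]
  simp [dotProduct_smul]

theorem dotProduct_linearCombination_nonneg {v : Fin 3 → ℝ} (hv : ∀ i, 0 ≤ v ⬝ᵥ u i)
    {μ : ι → ℝ} (hμ : 0 ≤ μ) : 0 ≤ v ⬝ᵥ U μ := by
  rw [dotProduct_linearCombination]
  exact Finset.sum_nonneg fun i _ => mul_nonneg (hμ i) (hv i)

theorem continuous_linearCombination : Continuous (U : (ι → ℝ) → Fin 3 → ℝ) :=
  LinearMap.continuous_of_finiteDimensional _

theorem exists_maximal_shift {ψ : Fin 3 → ℝ} (hψ : ∀ i, 0 < ψ ⬝ᵥ u i) {θ : ι → ℝ}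
    (hθ : ψ ⬝ᵥ U θ < 0) {l : ι → ℝ} (hl : 0 ≤ l) :
    ∃ s : ℝ, ∃ μ : ι → ℝ, 0 ≤ s ∧ 0 ≤ μ ∧ U μ = U l + s • U θ ∧
      ∀ ε : ℝ, 0 < ε → ∀ ν : ι → ℝ, 0 ≤ ν → U ν ≠ U μ + ε • U θ := by
  let Z : Set (ℝ × (ι → ℝ)) := {z | 0 ≤ z.1 ∧ 0 ≤ z.2 ∧ U z.2 = U l + z.1 • U θ}
  have hU := continuous_linearCombination (u := u)
  have hZc : IsClosed Z := by
    refine (isClosed_le continuous_const continuous_fst).inter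
      ((isClosed_le continuous_const continuous_snd).inter (isClosed_eq ?_ ?_))
    · exact hU.comp continuous_snd
    · fun_prop
  set M := ψ ⬝ᵥ U l with hM
  have hZb : Z ⊆ Icc 0 (M / -(ψ ⬝ᵥ U θ)) ×ˢ Icc 0 (fun i => M / (ψ ⬝ᵥ u i)) := by
    rintro ⟨s, μ⟩ ⟨hs, hμ, e⟩
    dsimp only at hs hμ e
    have e' := congrArg (ψ ⬝ᵥ ·) e
    simp only [dotProduct_add, dotProduct_smul, ← hM, smul_eq_mul] at e'
    have hμψ := dotProduct_linearCombination_nonneg (fun i => (hψ i).le) hμ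
    refine ⟨⟨hs, ?_⟩, hμ, fun i => ?_⟩
    · change s ≤ _
      rw [le_div_iff₀ (by linarith)]
      linarith
    · change μ i ≤ _
      rw [le_div_iff₀ (hψ i)]
      have := Finset.single_le_sum (f := fun i => μ i * (ψ ⬝ᵥ u i))
        (fun i _ => mul_nonneg (hμ i) (hψ i).le) (Finset.mem_univ i)
      rw [← dotProduct_linearCombination] at this
      have h3 := mul_nonneg hs (neg_nonneg.mpr hθ.le)
      linarith
  have hZ : IsCompact Z := (isCompact_Icc.prod isCompact_Icc).of_isClosed_subset hZc hZb
  obtain ⟨⟨s, μ⟩, ⟨hs, hμ, e⟩, hmax⟩ := hZ.exists_isMaxOn ⟨(0, l), le_rfl, hl, by simp⟩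
    continuous_fst.continuousOn
  dsimp only at hs hμ e
  refine ⟨s, μ, hs, hμ, e, fun ε hε ν hν h => ?_⟩
  have : s + ε ≤ s := hmax (a := (s + ε, ν)) ⟨by positivity, hν, by
    change U ν = U l + (s + ε) • U θ
    rw [h, e]; module⟩
  linarith

theorem exists_supporting_functional (hU : Function.Surjective U) {θ μ : ι → ℝ} (hμ : 0 ≤ μ)
    (hmax : ∀ ε : ℝ, 0 < ε → ∀ ν : ι → ℝ, 0 ≤ ν → U ν ≠ U μ + ε • U θ) :
    ∃ v : Fin 3 → ℝ, v ≠ 0 ∧ (∀ i, 0 ≤ v ⬝ᵥ u i) ∧ v ⬝ᵥ U μ = 0 := by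
  classical
  let P : Set (ι → ℝ) := Set.univ.pi fun _ => Ioi 0
  have hP : Convex ℝ P := convex_pi fun _ _ => convex_Ioi 0
  have hPo : IsOpen P := isOpen_set_pi Set.finite_univ fun _ _ => isOpen_Ioi
  have hx : U μ ∉ U '' P := by
    rintro ⟨ν, hν, e⟩
    have hlim : Filter.Tendsto (fun ε : ℝ => ν + ε • θ) (nhdsWithin 0 (Ioi 0))
        (nhds (ν + (0 : ℝ) • θ)) :=
      ((by fun_prop : Continuous fun ε : ℝ => ν + ε • θ).tendsto 0).mono_left nhdsWithin_le_nhds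
    obtain ⟨ε, h1, h2⟩ := ((hlim.eventually (hPo.mem_nhds (by simpa using hν))).and
      self_mem_nhdsWithin).exists
    exact hmax ε h2 (ν + ε • θ) (fun i => (h1 i trivial).le) (by rw [map_add, map_smul, e])
  obtain ⟨f, hf⟩ := geometric_hahn_banach_open_point (hP.linear_image U)
    ((U).isOpenMap_of_finiteDimensional hU _ hPo) hx
  obtain ⟨v, hv⟩ : ∃ v : Fin 3 → ℝ, ∀ x, f x = -(v ⬝ᵥ x) := by
    refine ⟨fun i => -f (Pi.single i 1), fun x => ?_⟩
    have := LinearMap.pi_apply_eq_sum_univ (f : (Fin 3 → ℝ) →ₗ[ℝ] ℝ) x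
    simp only [ContinuousLinearMap.coe_coe, smul_eq_mul] at this
    rw [this, dotProduct, ← Finset.sum_neg_distrib]
    refine Finset.sum_congr rfl fun i _ => ?_
    rw [mul_comm, neg_mul, neg_neg]
    congr 2
    ext j
    simp [Pi.single_apply, eq_comm]
  have hlt : ∀ ν ∈ P, v ⬝ᵥ U μ < v ⬝ᵥ U ν := fun ν hν => by
    have := hf _ ⟨ν, hν, rfl⟩
    rw [hv, hv] at this
    linarith
  have hle : ∀ ν : ι → ℝ, 0 ≤ ν → v ⬝ᵥ U μ ≤ v ⬝ᵥ U ν := fun ν hν => by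
    have hc : Continuous fun ε : ℝ => v ⬝ᵥ U (ν + ε • 1) :=
      continuous_const.dotProduct (continuous_linearCombination.comp (by fun_prop))
    have hlim := (hc.tendsto 0).mono_left (nhdsWithin_le_nhds (s := Ioi 0))
    have := ge_of_tendsto hlim (b := v ⬝ᵥ U μ) (by
      filter_upwards [self_mem_nhdsWithin] with ε hε
      refine (hlt _ fun j _ => ?_).le
      have hε' : 0 < ε := hε
      have := hν j
      simp only [Pi.add_apply, Pi.smul_apply, Pi.one_apply, smul_eq_mul, mul_one, mem_Ioi,
        Pi.zero_apply] at this ⊢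
      linarith)
    simpa using this
  have hneg : v ⬝ᵥ U μ ≤ 0 := by simpa using hle 0 le_rfl
  have hpos : ∀ ν : ι → ℝ, 0 ≤ ν → 0 ≤ v ⬝ᵥ U ν := fun ν hν => by
    by_contra! hcon
    have := hle (((1 - v ⬝ᵥ U μ) / -(v ⬝ᵥ U ν)) • ν)
      (smul_nonneg (div_nonneg (by linarith) (by linarith)) hν)
    rw [map_smul, dotProduct_smul, smul_eq_mul, div_mul_eq_mul_div,
      le_div_iff₀ (by linarith)] at this
    nlinarith
  refine ⟨v, ?_, fun i => ?_, le_antisymm hneg (hpos μ hμ)⟩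
  · rintro rfl
    simpa using hlt 1 fun i _ => by simp
  · have := hpos (Pi.single i 1) (Pi.single_nonneg.mpr zero_le_one)
    simpa [Fintype.linearCombination_apply_single] using this

theorem exists_facet_vertex {v : Fin 3 → ℝ} (hv0 : v ≠ 0) (hv : ∀ i, 0 ≤ v ⬝ᵥ u i) {μ : ι → ℝ}
    (hμ : 0 ≤ μ) (hμ0 : μ ≠ 0) (hvμ : v ⬝ᵥ U μ = 0) :
    ∃ a, ∀ c, 0 ≤ (u a ⨯₃ U μ) ⬝ᵥ u c := by
  have hvv := dotProduct_self_pos hv0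
  have hface : ∀ i, 0 < μ i → v ⬝ᵥ u i = 0 := by
    rw [dotProduct_linearCombination,
      Finset.sum_eq_zero_iff_of_nonneg fun i _ => mul_nonneg (hμ i) (hv i)] at hvμ
    exact fun i hi => (mul_eq_zero.mp (hvμ i (Finset.mem_univ i))).resolve_left hi.ne'
  have hsum : ∑ i, μ i * (v ⬝ᵥ (u i ⨯₃ U μ)) = 0 := by
    have hperm : ∀ x, v ⬝ᵥ (x ⨯₃ U μ) = (U μ ⨯₃ v) ⬝ᵥ x := fun x => by
      rw [triple_product_permutation, dotProduct_comm]
    simp only [hperm]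
    rw [← dotProduct_linearCombination, ← hperm, cross_self, dotProduct_zero]
  obtain ⟨a, ha, hκ⟩ : ∃ a, 0 < μ a ∧ 0 ≤ v ⬝ᵥ (u a ⨯₃ U μ) := by
    by_contra! hcon
    have hnonpos : ∀ i ∈ Finset.univ, μ i * (v ⬝ᵥ (u i ⨯₃ U μ)) ≤ 0 := fun i _ => by
      rcases (hμ i).eq_or_lt with h | h
      · simp [← h]
      · exact (mul_neg_of_pos_of_neg h (hcon i h)).le
    obtain ⟨i, hi⟩ := Function.ne_iff.mp hμ0
    have hi' : 0 < μ i := lt_of_le_of_ne (hμ i) (Ne.symm hi)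
    exact (mul_neg_of_pos_of_neg hi' (hcon i hi')).ne
      ((Finset.sum_eq_zero_iff_of_nonpos hnonpos).mp hsum i (Finset.mem_univ i))
  refine ⟨a, fun c => ?_⟩
  have key := cross_eq_smul_of_dotProduct_eq_zero (hface a ha) hvμ
  have := congrArg (· ⬝ᵥ u c) key
  simp only [smul_dotProduct, smul_eq_mul] at this
  exact nonneg_of_mul_nonneg_right (by rw [this]; exact mul_nonneg hκ (hv c)) hvv

theorem exists_two_generators {ψ : Fin 3 → ℝ} {a : ι} (hψ : ψ ⬝ᵥ u a ≠ 0) {T : Set (ι → ℝ)}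
    (hT : IsCompact T) (hT0 : ∀ μ ∈ T, 0 ≤ μ) (hT1 : ∀ μ ∈ T, ψ ⬝ᵥ U μ = 1)
    (hTa : ∀ μ ∈ T, ∀ c, 0 ≤ (u a ⨯₃ U μ) ⬝ᵥ u c) :
    ∃ F ⊆ T, F.Finite ∧ F.ncard ≤ 2 ∧ ∀ μ ∈ T, ∃ p ∈ F, ∃ q ∈ F, ∃ s t : ℝ, 0 ≤ s ∧ 0 ≤ t ∧
      U μ = s • U p + t • U q := by
  rcases T.eq_empty_or_nonempty with rfl | hne
  · exact ⟨∅, by simp⟩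
  by_cases hpar : ∀ μ ∈ T, u a ⨯₃ U μ = 0
  · obtain ⟨p, hp⟩ := hne
    refine ⟨{p}, by simpa using hp, by simp, by simp, fun μ hμ =>
      ⟨p, rfl, p, rfl, 1, 0, zero_le_one, le_rfl, ?_⟩⟩
    have e1 := dotProduct_smul_of_cross_eq_zero (hpar μ hμ) ψ
    have e2 := dotProduct_smul_of_cross_eq_zero (hpar p hp) ψ
    rw [hT1 μ hμ] at e1
    rw [hT1 p hp, e1] at e2
    simpa using smul_right_injective _ hψ e2
  push Not at hpar
  obtain ⟨ρ, hρ, hN0⟩ := hpar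
  set N := u a ⨯₃ U ρ with hN
  have hNN := dotProduct_self_pos hN0
  have hNT : ∀ μ ∈ T, N ⬝ᵥ U μ = 0 := fun μ hμ => by
    have h1 := dotProduct_linearCombination_nonneg (hTa ρ hρ) (hT0 μ hμ)
    have h2 := dotProduct_linearCombination_nonneg (hTa μ hμ) (hT0 ρ hρ)
    have h3 : (u a ⨯₃ U μ) ⬝ᵥ U ρ = -(N ⬝ᵥ U μ) := by
      rw [hN, dotProduct_comm, triple_product_permutation, ← neg_cross, dotProduct_neg,
        triple_product_permutation, triple_product_permutation,
        dotProduct_comm (U μ)]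
    exact le_antisymm (by linarith) h1
  have hzero : ∀ v, N ⬝ᵥ v = 0 → (u a ⨯₃ v) ⬝ᵥ N = 0 → ψ ⬝ᵥ v = 0 → v = 0 := by
    intro v h1 h2 h3
    have e := smul_eq_of_dotProduct_cross_eq_zero h1
    rw [← hN, h2, zero_smul, add_zero] at e
    have e2 := congrArg (ψ ⬝ᵥ ·) e
    simp only [dotProduct_smul, h3, smul_eq_mul, mul_zero] at e2
    rw [(mul_eq_zero.mp e2.symm).resolve_right hψ, zero_smul] at e
    exact (smul_eq_zero.mp e).resolve_left hNN.ne'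
  let β : (ι → ℝ) → ℝ := fun μ => (u a ⨯₃ U μ) ⬝ᵥ N
  have hβ : Continuous β := by
    have : Continuous (crossProduct (u a)) := LinearMap.continuous_of_finiteDimensional _
    exact (this.comp continuous_linearCombination).dotProduct continuous_const
  obtain ⟨p, hp, hpmin⟩ := hT.exists_isMinOn hne hβ.continuousOn
  obtain ⟨q, hq, hqmax⟩ := hT.exists_isMaxOn hne hβ.continuousOn
  refine ⟨{p, q}, by simp [insert_subset_iff, hp, hq], by simp, (Set.ncard_insert_le p {q}).trans (by simp),
    fun μ hμ => ⟨p, by simp, q, by simp, ?_⟩⟩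
  have hmem : β μ ∈ segment ℝ (β p) (β q) := by
    rw [segment_eq_Icc (hpmin hq)]
    exact ⟨hpmin hμ, hqmax hμ⟩
  obtain ⟨s, t, hs, ht, hst, e⟩ := hmem
  refine ⟨s, t, hs, ht, sub_eq_zero.mp (hzero _ ?_ ?_ ?_)⟩
  · simp only [dotProduct_sub, dotProduct_add, dotProduct_smul, hNT μ hμ, hNT p hp, hNT q hq]
    simp
  · simp only [smul_eq_mul, β] at e
    simp only [map_sub, map_add, map_smul, sub_dotProduct, add_dotProduct, smul_dotProduct,
      smul_eq_mul]
    linarith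
  · simp only [dotProduct_sub, dotProduct_add, dotProduct_smul, hT1 μ hμ, hT1 p hp, hT1 q hq,
      smul_eq_mul]
    linarith

end PolyhedralCone

section SymmetricForms

variable {ι : Type*} [Fintype ι]

theorem negEigsAtMostOne_of_nonneg_on_ker_s12 [DecidableEq ι] {M : Matrix ι ι ℝ}
    (hM : M.IsHermitian) {φ : ι → ℝ} (h : ∀ w, φ ⬝ᵥ w = 0 → 0 ≤ w ⬝ᵥ M *ᵥ w) :
    NegEigsAtMostOne M := by
  refine ⟨hM, Finset.card_le_one.mpr fun i hi j hj => ?_⟩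
  simp only [Finset.mem_filter, Finset.mem_univ, true_and] at hi hj
  by_contra hij
  let v : ι → ι → ℝ := fun k => (hM.eigenvectorBasis k).ofLp
  have hv : ∀ k, M *ᵥ v k = hM.eigenvalues k • v k := fun k => hM.mulVec_eigenvectorBasis k
  have horth : ∀ k l, v k ⬝ᵥ v l = if k = l then 1 else 0 := fun k l => by
    have := orthonormal_iff_ite.mp hM.eigenvectorBasis.orthonormal l k
    rw [EuclideanSpace.inner_eq_star_dotProduct] at this
    simpa [v, eq_comm] using this
  have hval : ∀ α β : ℝ, (α • v i + β • v j) ⬝ᵥ M *ᵥ (α • v i + β • v j) =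
      α ^ 2 * hM.eigenvalues i + β ^ 2 * hM.eigenvalues j := fun α β => by
    simp only [mulVec_add, mulVec_smul, hv, dotProduct_add, add_dotProduct, dotProduct_smul,
      smul_dotProduct, horth, smul_eq_mul, hij, Ne.symm hij, if_true, if_false]
    ring
  by_cases hφ : φ ⬝ᵥ v i = 0
  · have := h (1 • v i + (0 : ℝ) • v j) (by simp [hφ])
    have e := hval 1 0
    simp only [one_smul] at this e
    rw [e] at this
    linarith
  · have := h ((φ ⬝ᵥ v j) • v i + (-(φ ⬝ᵥ v i)) • v j) (by
      simp only [dotProduct_add, dotProduct_smul, smul_eq_mul]; ring)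
    rw [hval] at this
    have h1 : 0 < (-(φ ⬝ᵥ v i)) ^ 2 := sq_pos_iff.mpr (neg_ne_zero.mpr hφ)
    nlinarith [sq_nonneg (φ ⬝ᵥ v j)]

theorem convex_neg_of_nonneg_on_ker {M : Matrix ι ι ℝ} (hM : M.IsSymm) {φ : ι → ℝ}
    (h : ∀ w, φ ⬝ᵥ w = 0 → 0 ≤ w ⬝ᵥ M *ᵥ w) :
    Convex ℝ {z | 0 < φ ⬝ᵥ z ∧ z ⬝ᵥ M *ᵥ z < 0} := by
  rintro x ⟨hx, hqx⟩ y ⟨hy, hqy⟩ a b ha hb hab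
  have hxy : y ⬝ᵥ M *ᵥ x = x ⬝ᵥ M *ᵥ y := by
    rw [dotProduct_mulVec, ← mulVec_transpose, hM.eq, dotProduct_comm]
  have hker := h ((φ ⬝ᵥ y) • x - (φ ⬝ᵥ x) • y) (by
    simp only [dotProduct_sub, dotProduct_smul, smul_eq_mul]; ring)
  simp only [mulVec_sub, mulVec_smul, dotProduct_sub, sub_dotProduct, dotProduct_smul,
    smul_dotProduct, smul_eq_mul, hxy] at hker
  have hmix : x ⬝ᵥ M *ᵥ y < 0 := by
    by_contra! hcon
    have h1 := mul_pos hx hy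
    nlinarith [mul_pos_of_neg_of_neg hqx (neg_neg_of_pos (mul_pos hy hy)),
      mul_pos_of_neg_of_neg hqy (neg_neg_of_pos (mul_pos hx hx)), mul_nonneg h1.le hcon]
  constructor
  · simp only [dotProduct_add, dotProduct_smul, smul_eq_mul]
    rcases ha.eq_or_lt with rfl | ha'
    · have : b = 1 := by linarith
      simpa [this] using hy
    · have := mul_pos ha' hx
      have := mul_nonneg hb hy.le
      linarith
  · simp only [mulVec_add, mulVec_smul, dotProduct_add, add_dotProduct, dotProduct_smul,
      smul_dotProduct, smul_eq_mul, hxy]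
    have h1 := mul_nonneg (mul_nonneg ha hb) (neg_nonneg.mpr hmix.le)
    rcases ha.eq_or_lt with rfl | ha'
    · have : b = 1 := by linarith
      simpa [this] using hqy
    · have h2 := mul_pos (mul_pos ha' ha') (neg_pos.mpr hqx)
      have h3 := mul_nonneg (mul_nonneg hb hb) (neg_nonneg.mpr hqy.le)
      linarith

theorem exists_span_coordinates {κ : Type*} [Fintype κ] {V : Type*} [AddCommGroup V] [Module ℝ V]
    {Q : κ → V} {d : ℕ} (hd : 0 < d)
    (hdim : Module.finrank ℝ (Submodule.span ℝ (Set.range Q)) = d) :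
    ∃ (u : κ → Fin d → ℝ) (R : Fin d → V),
      Function.Surjective (Fintype.linearCombination ℝ u) ∧ (∀ i, Q i = ∑ j, u i j • R j) ∧
      ∀ j, R j ∈ Submodule.span ℝ (Set.range Q) := by
  have : FiniteDimensional ℝ (Submodule.span ℝ (Set.range Q)) :=
    Module.finite_of_finrank_pos (by omega)
  let bas := Module.finBasisOfFinrankEq ℝ (Submodule.span ℝ (Set.range Q)) hdim
  let Q' : κ → Submodule.span ℝ (Set.range Q) := fun i => ⟨Q i, Submodule.subset_span ⟨i, rfl⟩⟩
  refine ⟨fun i => bas.equivFun (Q' i), fun j => bas j, fun x => ?_, fun i => ?_,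
    fun j => (bas j).2⟩
  · obtain ⟨v, hv⟩ := bas.equivFun.surjective x
    obtain ⟨c, hc⟩ := (Submodule.mem_span_range_iff_exists_fun ℝ).mp v.2
    refine ⟨c, ?_⟩
    have : v = ∑ i, c i • Q' i := Subtype.ext (by simp [← hc, Q'])
    rw [← hv, this, map_sum, Fintype.linearCombination_apply]
    simp only [map_smul]
  · calc Q i = ((∑ j, bas.equivFun (Q' i) j • bas j : Submodule.span ℝ (Set.range Q)) : V) := by
          rw [bas.sum_equivFun]
      _ = _ := by simp only [Submodule.coe_sum, Submodule.coe_smul]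

end SymmetricForms

section Aggregations

variable {ι κ : Type*} [Fintype ι] [Fintype κ]

theorem exists_aggregation_nonneg_on_ker (hcard : 4 ≤ Fintype.card ι) {u : κ → Fin 3 → ℝ}
    {B : (ι → ℝ) →ₗ[ℝ] (ι → ℝ) →ₗ[ℝ] (Fin 3 → ℝ)} (hB : ∀ x y, B x y = B y x)
    {p : Fin 3 → ℝ} (hp : ∀ x, x ≠ 0 → 0 < p ⬝ᵥ B x x) {φ : ι → ℝ}
    (hφ : ∀ w, φ ⬝ᵥ w = 0 → ∃ i, 0 ≤ u i ⬝ᵥ B w w) :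
    ∃ l : κ → ℝ, 0 ≤ l ∧ l ≠ 0 ∧
      ∀ w, φ ⬝ᵥ w = 0 → 0 ≤ Fintype.linearCombination ℝ u l ⬝ᵥ B w w := by
  let H := LinearMap.ker (dotProductBilin ℝ ℝ φ)
  have hH : 3 ≤ Module.finrank ℝ H := by
    have h1 := LinearMap.finrank_range_add_finrank_ker (dotProductBilin ℝ ℝ φ)
    have h2 := Submodule.finrank_le (LinearMap.range (dotProductBilin ℝ ℝ φ))
    rw [Module.finrank_fintype_fun_eq_card] at h1
    rw [Module.finrank_self] at h2
    change 3 ≤ Module.finrank ℝ (LinearMap.ker (dotProductBilin ℝ ℝ φ))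
    omega
  let T : Set (κ → ℝ) := {v | ∃ w, φ ⬝ᵥ w = 0 ∧ v = fun i => u i ⬝ᵥ B w w}
  have hadd : ∀ a ∈ T, ∀ b ∈ T, a + b ∈ T := by
    rintro _ ⟨x, hx, rfl⟩ _ ⟨y, hy, rfl⟩
    obtain ⟨⟨z, hz⟩, e⟩ := exists_quadratic_eq_add hH (B.compl₁₂ H.subtype H.subtype)
      (fun x y => hB x y) (fun x hx => hp x (by simpa using hx)) ⟨x, hx⟩ ⟨y, hy⟩
    refine ⟨z, hz, ?_⟩
    have e' : B z z = B x x + B y y := e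
    ext i
    simp [e', dotProduct_add]
  have hsmul : ∀ a ∈ T, ∀ t : ℝ, 0 ≤ t → t • a ∈ T := by
    rintro _ ⟨x, hx, rfl⟩ t ht
    refine ⟨√t • x, by simp [hx], ?_⟩
    ext i
    simp only [Pi.smul_apply, map_smul, LinearMap.smul_apply, smul_smul, Real.mul_self_sqrt ht,
      dotProduct_smul]
  obtain ⟨l, hl, hl0, hlT⟩ := exists_nonneg_separating hadd hsmul ⟨_, 0, by simp, rfl⟩
    (by rintro _ ⟨w, hw, rfl⟩; exact hφ w hw)
  refine ⟨l, hl, hl0, fun w hw => ?_⟩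
  have := hlT _ ⟨w, hw, rfl⟩
  rw [dotProduct_comm, dotProduct_linearCombination]
  simpa [dotProduct, mul_comm] using this

/-- Normalized aggregations that are nonnegative on a hyperplane with `P` on one side. -/
def supportedAggregations (u : κ → Fin 3 → ℝ) (B : (ι → ℝ) →ₗ[ℝ] (ι → ℝ) →ₗ[ℝ] (Fin 3 → ℝ))
    (P : Set (ι → ℝ)) (ψ : Fin 3 → ℝ) : Set (κ → ℝ) :=
  {l | 0 ≤ l ∧ ψ ⬝ᵥ Fintype.linearCombination ℝ u l = 1 ∧ ∃ φ : ι → ℝ, φ ⬝ᵥ φ = 1 ∧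
    (∀ x ∈ P, 0 ≤ φ ⬝ᵥ x) ∧ ∀ w, φ ⬝ᵥ w = 0 → 0 ≤ Fintype.linearCombination ℝ u l ⬝ᵥ B w w}

variable {u : κ → Fin 3 → ℝ} {B : (ι → ℝ) →ₗ[ℝ] (ι → ℝ) →ₗ[ℝ] (Fin 3 → ℝ)}
  {P : Set (ι → ℝ)} {ψ : Fin 3 → ℝ}

local notation "U" => Fintype.linearCombination ℝ u

theorem isCompact_supportedAggregations (hB : Continuous fun w => B w w)
    (hψ : ∀ i, 0 < ψ ⬝ᵥ u i) : IsCompact (supportedAggregations u B P ψ) := by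
  let Z : Set ((ι → ℝ) × (κ → ℝ)) := {z | 0 ≤ z.2 ∧ ψ ⬝ᵥ U z.2 = 1 ∧ z.1 ⬝ᵥ z.1 = 1 ∧
    (∀ x ∈ P, 0 ≤ z.1 ⬝ᵥ x) ∧
    ∀ w, 0 ≤ U z.2 ⬝ᵥ B (w - (z.1 ⬝ᵥ w) • z.1) (w - (z.1 ⬝ᵥ w) • z.1)}
  have hU := continuous_linearCombination (u := u)
  have hZc : IsClosed Z := by
    have h1 : Continuous fun z : (ι → ℝ) × (κ → ℝ) => U z.2 := hU.comp continuous_snd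
    have h2 : IsClosed {z : (ι → ℝ) × (κ → ℝ) | ∀ x ∈ P, 0 ≤ z.1 ⬝ᵥ x} := by
      simp only [ofPred_forall]
      exact isClosed_iInter fun x => isClosed_iInter fun _ =>
        isClosed_le continuous_const (by fun_prop)
    have h3 : IsClosed {z : (ι → ℝ) × (κ → ℝ) |
        ∀ w, 0 ≤ U z.2 ⬝ᵥ B (w - (z.1 ⬝ᵥ w) • z.1) (w - (z.1 ⬝ᵥ w) • z.1)} := by
      simp only [ofPred_forall]
      refine isClosed_iInter fun w => isClosed_le continuous_const (h1.dotProduct ?_)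
      exact hB.comp (by fun_prop :
        Continuous fun z : (ι → ℝ) × (κ → ℝ) => w - (z.1 ⬝ᵥ w) • z.1)
    exact (isClosed_le continuous_const continuous_snd).inter
      ((isClosed_eq (continuous_const.dotProduct h1) continuous_const).inter
      ((isClosed_eq (by fun_prop) continuous_const).inter (h2.inter h3)))
  have hZb : Z ⊆ Icc (-1) 1 ×ˢ Icc 0 (fun i => 1 / (ψ ⬝ᵥ u i)) := by
    rintro ⟨φ, l⟩ ⟨hl, hl1, hφ, -⟩
    dsimp only at hl hl1 hφ
    have hsq : ∀ i, φ i * φ i ≤ 1 := fun i => by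
      rw [← hφ]
      exact Finset.single_le_sum (f := fun i => φ i * φ i) (fun i _ => mul_self_nonneg _)
        (Finset.mem_univ i)
    refine ⟨⟨fun i => ?_, fun i => ?_⟩, hl, fun i => ?_⟩
    · have := hsq i
      change -1 ≤ φ i
      nlinarith
    · have := hsq i
      change φ i ≤ 1
      nlinarith
    · change l i ≤ _
      rw [le_div_iff₀ (hψ i), ← hl1, dotProduct_linearCombination]
      exact Finset.single_le_sum (f := fun i => l i * (ψ ⬝ᵥ u i))
        (fun i _ => mul_nonneg (hl i) (hψ i).le) (Finset.mem_univ i)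
  have hZ : IsCompact Z := (isCompact_Icc.prod isCompact_Icc).of_isClosed_subset hZc hZb
  convert hZ.image continuous_snd
  ext l
  constructor
  · rintro ⟨hl, hl1, φ, hφ, hP, hw⟩
    refine ⟨(φ, l), ⟨hl, hl1, hφ, hP, fun w => hw _ ?_⟩, rfl⟩
    rw [dotProduct_sub, dotProduct_smul, hφ, smul_eq_mul, mul_one, sub_self]
  · rintro ⟨⟨φ, l⟩, ⟨hl, hl1, hφ, hP, hw⟩, rfl⟩
    refine ⟨hl, hl1, φ, hφ, hP, fun w h => ?_⟩
    have := hw w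
    simp only [h, zero_smul, sub_zero] at this
    exact this

theorem exists_facet_aggregation (hU : Function.Surjective U) (hψ : ∀ i, 0 < ψ ⬝ᵥ u i)
    {θ : κ → ℝ} (hθ : ∀ x, x ≠ 0 → 0 < U θ ⬝ᵥ B x x) (hψθ : ψ ⬝ᵥ U θ < 0) {φ : ι → ℝ}
    (hφ : φ ⬝ᵥ φ = 1) (hP : ∀ x ∈ P, 0 ≤ φ ⬝ᵥ x) {l : κ → ℝ} (hl : 0 ≤ l) (hl0 : l ≠ 0)
    (hw : ∀ w, φ ⬝ᵥ w = 0 → 0 ≤ U l ⬝ᵥ B w w) {y : ι → ℝ} (hy0 : y ≠ 0) (hy : φ ⬝ᵥ y = 0) :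
    ∃ a, ∃ μ ∈ supportedAggregations u B P ψ, (∀ c, 0 ≤ (u a ⨯₃ U μ) ⬝ᵥ u c) ∧
      0 ≤ U μ ⬝ᵥ B y y := by
  obtain ⟨s, μ, hs, hμ, e, hmax⟩ := exists_maximal_shift hψ hψθ hl
  have hpos : ∀ {ν : κ → ℝ}, 0 ≤ ν → ν ≠ 0 → 0 < ψ ⬝ᵥ U ν := fun {ν} hν hν0 => by
    rw [dotProduct_linearCombination]
    obtain ⟨i, hi⟩ := Function.ne_iff.mp hν0
    exact Finset.sum_pos' (fun i _ => mul_nonneg (hν i) (hψ i).le)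
      ⟨i, Finset.mem_univ i, mul_pos (lt_of_le_of_ne (hν i) (Ne.symm hi)) (hψ i)⟩
  have hwμ : ∀ w, φ ⬝ᵥ w = 0 → 0 ≤ U μ ⬝ᵥ B w w := fun w hw0 => by
    rw [e, add_dotProduct, smul_dotProduct, smul_eq_mul]
    rcases eq_or_ne w 0 with rfl | hne
    · simp
    · exact add_nonneg (hw w hw0) (mul_nonneg hs (hθ w hne).le)
  have hμ0 : μ ≠ 0 := by
    rintro rfl
    rw [map_zero] at e
    have h1 := congrArg (· ⬝ᵥ B y y) e
    simp only [zero_dotProduct, add_dotProduct, smul_dotProduct, smul_eq_mul] at h1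
    have h2 := hw y hy
    have h3 := hθ y hy0
    have hs0 : s = 0 := by
      by_contra hne
      have := mul_pos (lt_of_le_of_ne hs (Ne.symm hne)) h3
      linarith
    rw [hs0, zero_smul, add_zero] at e
    have := hpos hl hl0
    rw [← e, dotProduct_zero] at this
    exact this.false
  obtain ⟨v, hv0, hv, hvμ⟩ := exists_supporting_functional hU hμ hmax
  obtain ⟨a, ha⟩ := exists_facet_vertex hv0 hv hμ hμ0 hvμ
  have hk := hpos hμ hμ0
  have hk' : 0 ≤ (ψ ⬝ᵥ U μ)⁻¹ := inv_nonneg.mpr hk.le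
  refine ⟨a, (ψ ⬝ᵥ U μ)⁻¹ • μ, ⟨smul_nonneg hk' hμ, ?_, φ, hφ, hP, fun w hw0 => ?_⟩,
    fun c => ?_, ?_⟩
  · rw [map_smul, dotProduct_smul, smul_eq_mul, inv_mul_cancel₀ hk.ne']
  · rw [map_smul, smul_dotProduct]
    exact mul_nonneg hk' (hwμ w hw0)
  · rw [map_smul, map_smul, smul_dotProduct]
    exact mul_nonneg hk' (ha c)
  · rw [map_smul, smul_dotProduct]
    exact mul_nonneg hk' (hwμ y hy)

theorem exists_finite_supportedAggregations (hB : Continuous fun w => B w w)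
    (hψ : ∀ i, 0 < ψ ⬝ᵥ u i) :
    ∃ F ⊆ supportedAggregations u B P ψ, F.Finite ∧ F.ncard ≤ 2 * Fintype.card κ ∧
      ∀ a, ∀ μ ∈ supportedAggregations u B P ψ, (∀ c, 0 ≤ (u a ⨯₃ U μ) ⬝ᵥ u c) →
        ∀ g : Fin 3 → ℝ, 0 ≤ U μ ⬝ᵥ g → ∃ p ∈ F, 0 ≤ U p ⬝ᵥ g := by
  let T : κ → Set (κ → ℝ) := fun a =>
    {μ | μ ∈ supportedAggregations u B P ψ ∧ ∀ c, 0 ≤ (u a ⨯₃ U μ) ⬝ᵥ u c}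
  have hU := continuous_linearCombination (u := u)
  have hT : ∀ a, IsCompact (T a) := fun a => by
    have h1 : Continuous (crossProduct (u a)) := LinearMap.continuous_of_finiteDimensional _
    have h2 : IsClosed {μ : κ → ℝ | ∀ c, 0 ≤ (u a ⨯₃ U μ) ⬝ᵥ u c} := by
      simp only [ofPred_forall]
      exact isClosed_iInter fun c => isClosed_le continuous_const
        ((h1.comp hU).dotProduct continuous_const)
    exact (isCompact_supportedAggregations hB hψ).inter_right h2
  choose F hFT hFfin hFcard hF using fun a => exists_two_generators (hψ a).ne' (hT a)
    (fun μ hμ => hμ.1.1) (fun μ hμ => hμ.1.2.1) (fun μ hμ => hμ.2)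
  refine ⟨⋃ a, F a, iUnion_subset fun a μ hμ => (hFT a hμ).1, finite_iUnion hFfin, ?_,
    fun a μ hμ ha g hg => ?_⟩
  · calc (⋃ a, F a).ncard ≤ ∑ a, (F a).ncard := by
          have := Set.ncard_iUnion_le_of_fintype F
          exact this
      _ ≤ ∑ _a : κ, 2 := Finset.sum_le_sum fun a _ => hFcard a
      _ = 2 * Fintype.card κ := by simp [mul_comm]
  · obtain ⟨p, hp, q, hq, s, t, hs, ht, e⟩ := hF a μ ⟨hμ, ha⟩
    by_contra! hcon
    have h1 := hcon p (mem_iUnion.mpr ⟨a, hp⟩)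
    have h2 := hcon q (mem_iUnion.mpr ⟨a, hq⟩)
    rw [e, add_dotProduct, smul_dotProduct, smul_dotProduct, smul_eq_mul, smul_eq_mul] at hg
    have h3 := mul_nonneg hs (neg_nonneg.mpr h1.le)
    have h4 := mul_nonneg ht (neg_nonneg.mpr h2.le)
    have hs0 : s = 0 := by
      have : s * (U p ⬝ᵥ g) = 0 := by linarith
      exact (mul_eq_zero.mp this).resolve_right h1.ne
    have ht0 : t = 0 := by
      have : t * (U q ⬝ᵥ g) = 0 := by linarith
      exact (mul_eq_zero.mp this).resolve_right h2.ne
    have := hμ.2.1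
    rw [e, hs0, ht0] at this
    simp at this

end Aggregations

section Homogenization

variable {n : ℕ}

/-- The point `(x, 1)`. -/
def homogenize (x : Fin n → ℝ) : Fin n ⊕ Unit → ℝ := Sum.elim x 1

theorem homogenize_ne_zero (x : Fin n → ℝ) : homogenize x ≠ 0 := fun h => by
  simpa [homogenize] using congrFun h (Sum.inr ())

theorem homogenize_combination {x y : Fin n → ℝ} {s t : ℝ} (h : s + t = 1) :
    homogenize (s • x + t • y) = s • homogenize x + t • homogenize y := by
  ext (i | i) <;> simp [homogenize, h]

theorem homogenize_dotProduct_Qmat (A : Matrix (Fin n) (Fin n) ℝ) (b : Fin n → ℝ) (c : ℝ)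
    (x : Fin n → ℝ) : homogenize x ⬝ᵥ Qmat A b c *ᵥ homogenize x = qf A b c x := by
  have h1 : ((of fun (i : Fin n) (_ : Unit) => b i) *ᵥ 1) = b := by
    ext i; simp [mulVec, dotProduct]
  have h2 : ((of fun (_ : Unit) (j : Fin n) => b j) *ᵥ x) = fun _ => b ⬝ᵥ x := by
    ext i; simp [mulVec]
  have h3 : ((of fun (_ : Unit) (_ : Unit) => c) *ᵥ 1) = fun _ => c := by
    ext i; simp [mulVec, dotProduct]
  rw [Qmat, homogenize, fromBlocks_mulVec]
  simp only [Sum.elim_comp_inl, Sum.elim_comp_inr, h1, h2, h3, sumElim_dotProduct_sumElim,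
    dotProduct_add, qf, dotProduct_comm x b]
  simp [dotProduct]
  ring

theorem isSymm_Qmat {A : Matrix (Fin n) (Fin n) ℝ} (hA : A.IsSymm) (b : Fin n → ℝ) (c : ℝ) :
    (Qmat A b c).IsSymm :=
  IsSymm.fromBlocks hA rfl rfl

variable {m : ℕ} {A : Fin m → Matrix (Fin n) (Fin n) ℝ} {b : Fin m → Fin n → ℝ} {c : Fin m → ℝ}

theorem exists_separating_hyperplane (hS : (Sset A b c).Nonempty) {y : Fin n → ℝ}
    (hy : y ∉ convexHull ℝ (Sset A b c)) :
    ∃ φ : Fin n ⊕ Unit → ℝ, φ ⬝ᵥ φ = 1 ∧ φ ⬝ᵥ homogenize y = 0 ∧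
      ∀ x ∈ Sset A b c, 0 < φ ⬝ᵥ homogenize x := by
  classical
  have hopen : IsOpen (Sset A b c) := by
    simp only [Sset, ofPred_forall]
    exact isOpen_iInter_of_finite fun i => isOpen_lt (by unfold qf; fun_prop) continuous_const
  obtain ⟨f, hf⟩ := geometric_hahn_banach_open_point (convex_convexHull ℝ _)
    hopen.convexHull hy
  let φ : Fin n ⊕ Unit → ℝ := Sum.elim (fun i => -f (Pi.single i 1)) fun _ => f y
  have hφ : ∀ x, φ ⬝ᵥ homogenize x = f y - f x := fun x => by
    have := LinearMap.pi_apply_eq_sum_univ (f : (Fin n → ℝ) →ₗ[ℝ] ℝ) x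
    simp only [ContinuousLinearMap.coe_coe, smul_eq_mul] at this
    rw [this, homogenize, sumElim_dotProduct_sumElim, add_comm, sub_eq_add_neg,
      ← Finset.sum_neg_distrib, dotProduct, dotProduct]
    congr 1
    · simp
    · refine Finset.sum_congr rfl fun i _ => ?_
      rw [mul_comm, mul_neg]
      congr 3
      ext j
      simp [Pi.single_apply, eq_comm]
  have hpos : ∀ x ∈ Sset A b c, 0 < φ ⬝ᵥ homogenize x := fun x hx => by
    rw [hφ]
    linarith [hf x (subset_convexHull ℝ _ hx)]
  have hφ0 : φ ≠ 0 := by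
    obtain ⟨x, hx⟩ := hS
    intro h
    have := hpos x hx
    simp [h] at this
  have hφφ := dotProduct_self_pos hφ0
  refine ⟨(√(φ ⬝ᵥ φ))⁻¹ • φ, ?_, ?_, fun x hx => ?_⟩
  · rw [smul_dotProduct, dotProduct_smul, smul_eq_mul, smul_eq_mul, ← mul_assoc, ← mul_inv,
      Real.mul_self_sqrt hφφ.le, inv_mul_cancel₀ hφφ.ne']
  · rw [smul_dotProduct, hφ, sub_self, smul_zero]
  · rw [smul_dotProduct]
    exact mul_pos (inv_pos.mpr (Real.sqrt_pos.mpr hφφ)) (hpos x hx)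

theorem exists_nonneg_of_mem_hyperplane {φ : Fin n ⊕ Unit → ℝ} {y : Fin n → ℝ}
    (hy : φ ⬝ᵥ homogenize y = 0) (hφ : ∀ x ∈ Sset A b c, 0 < φ ⬝ᵥ homogenize x)
    {w : Fin n ⊕ Unit → ℝ} (hw : φ ⬝ᵥ w = 0) :
    ∃ i, 0 ≤ w ⬝ᵥ Qmat (A i) (b i) (c i) *ᵥ w := by
  have key : ∀ z : Fin n ⊕ Unit → ℝ, φ ⬝ᵥ z = 0 → z (Sum.inr ()) ≠ 0 →
      ∃ i, 0 ≤ z ⬝ᵥ Qmat (A i) (b i) (c i) *ᵥ z := by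
    intro z hz hz0
    by_contra! hcon
    set t := z (Sum.inr ()) with ht
    have e : t⁻¹ • z = homogenize fun i => t⁻¹ * z (Sum.inl i) := by
      ext (i | i)
      · simp [homogenize]
      · simp [homogenize, ← ht, hz0]
    have hmem : (fun i => t⁻¹ * z (Sum.inl i)) ∈ Sset A b c := fun i => by
      rw [← homogenize_dotProduct_Qmat, ← e, mulVec_smul, dotProduct_smul, smul_dotProduct,
        smul_eq_mul, smul_eq_mul, ← mul_assoc]
      exact mul_neg_of_pos_of_neg (mul_self_pos.mpr (inv_ne_zero hz0)) (hcon i)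
    have := hφ _ hmem
    rw [← e, dotProduct_smul, hz, smul_zero] at this
    exact this.false
  by_cases hw0 : w (Sum.inr ()) = 0
  · by_contra! hcon
    have hev : ∀ᶠ ε : ℝ in nhdsWithin 0 (Ioi 0), ∀ i, (w + ε • homogenize y) ⬝ᵥ
        Qmat (A i) (b i) (c i) *ᵥ (w + ε • homogenize y) < 0 := by
      refine Filter.eventually_all.mpr fun i => ?_
      have hc : Continuous fun ε : ℝ => (w + ε • homogenize y) ⬝ᵥ
        Qmat (A i) (b i) (c i) *ᵥ (w + ε • homogenize y) := by fun_prop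
      refine ((hc.tendsto 0).mono_left nhdsWithin_le_nhds).eventually_lt_const ?_
      simpa using hcon i
    obtain ⟨ε, h1, h2⟩ := (hev.and self_mem_nhdsWithin).exists
    obtain ⟨i, hi⟩ := key (w + ε • homogenize y) (by
      rw [dotProduct_add, dotProduct_smul, hw, hy, smul_zero, add_zero]) (by
      simpa [hw0, homogenize] using (ne_of_gt h2 : ε ≠ 0))
    exact absurd hi (not_le.mpr (h1 i))
  · exact key w hw hw0

theorem mem_Omega_of_nonneg_on_ker (hsymm : ∀ i, (A i).IsSymm)
    {l : Fin m → ℝ} (hl : 0 ≤ l) (hl0 : l ≠ 0) {φ : Fin n ⊕ Unit → ℝ}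
    (hφ : ∀ x ∈ Sset A b c, 0 ≤ φ ⬝ᵥ homogenize x)
    (h : ∀ w, φ ⬝ᵥ w = 0 → 0 ≤ w ⬝ᵥ (∑ i, l i • Qmat (A i) (b i) (c i)) *ᵥ w) :
    l ∈ Omega A b c := by
  set M := ∑ i, l i • Qmat (A i) (b i) (c i) with hMdef
  have hM : M.IsSymm := by
    rw [Matrix.IsSymm, hMdef, transpose_sum]
    exact Finset.sum_congr rfl fun i _ => by
      rw [transpose_smul, (isSymm_Qmat (hsymm i) _ _).eq]
  have hval : ∀ x, homogenize x ⬝ᵥ M *ᵥ homogenize x =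
      ∑ i, l i * qf (A i) (b i) (c i) x := fun x => by
    rw [hMdef, sum_mulVec, dotProduct_sum]
    simp only [smul_mulVec, dotProduct_smul, homogenize_dotProduct_Qmat, smul_eq_mul]
  have hneg : ∀ x ∈ Sset A b c, homogenize x ⬝ᵥ M *ᵥ homogenize x < 0 := fun x hx => by
    rw [hval]
    obtain ⟨i, hi⟩ := Function.ne_iff.mp hl0
    exact Finset.sum_neg' (fun i _ => mul_nonpos_of_nonneg_of_nonpos (hl i) (hx i).le)
      ⟨i, Finset.mem_univ i, mul_neg_of_pos_of_neg (lt_of_le_of_ne (hl i) (Ne.symm hi)) (hx i)⟩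
  refine ⟨hl, hl0, ?_, negEigsAtMostOne_of_nonneg_on_ker_s12 (by
    rw [IsHermitian, conjTranspose_eq_transpose_of_trivial]; exact hM) h⟩
  have hconv : Convex ℝ {x : Fin n → ℝ | 0 < φ ⬝ᵥ homogenize x ∧
      homogenize x ⬝ᵥ M *ᵥ homogenize x < 0} := fun x hx y hy s t hs ht hst => by
    have := convex_neg_of_nonneg_on_ker hM h hx hy hs ht hst
    rw [← homogenize_combination hst] at this
    exact this
  have hsub : Sset A b c ⊆ {x : Fin n → ℝ | 0 < φ ⬝ᵥ homogenize x ∧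
      homogenize x ⬝ᵥ M *ᵥ homogenize x < 0} := fun x hx =>
    ⟨lt_of_le_of_ne (hφ x hx) fun h0 => absurd (h _ h0.symm) (not_le.mpr (hneg x hx)), hneg x hx⟩
  intro x hx
  have := (convexHull_min hsub hconv hx).2
  rw [hval] at this
  exact this

end Homogenization

/-- If the span of `Q₁,…,Q_m` is three dimensional and some combination is positive
definite, then at most `2m` good aggregations describe the convex hull. -/
theorem statement12 (n m : ℕ) (hn : 3 ≤ n)
    (A : Fin m → Matrix (Fin n) (Fin n) ℝ) (b : Fin m → Fin n → ℝ) (c : Fin m → ℝ)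
    (hsymm : ∀ i, (A i).IsSymm)
    (hdim : Module.finrank ℝ
      (Submodule.span ℝ (Set.range fun i => Qmat (A i) (b i) (c i))) = 3)
    (hPDLC : ∃ θ : Fin m → ℝ, (∑ i, θ i • Qmat (A i) (b i) (c i)).PosDef)
    (hS : (Sset A b c).Nonempty)
    (hconv : convexHull ℝ (Sset A b c) ≠ Set.univ) :
    ∃ Ω' : Set (Fin m → ℝ), Ω' ⊆ Omega A b c ∧ Ω'.Finite ∧ Ω'.ncard ≤ 2 * m ∧
      convexHull ℝ (Sset A b c) = ⋂ lam ∈ Ω', Sagg A b c lam := by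
  obtain ⟨θ, hθ⟩ := hPDLC
  obtain ⟨u, R, hU, hQ, hR⟩ := exists_span_coordinates (by norm_num) hdim
  have hRsymm : ∀ j, (R j).IsSymm := fun j => by
    refine Submodule.span_induction (p := fun M _ => M.IsSymm) ?_ (by simp) ?_ ?_ (hR j)
    · rintro _ ⟨i, rfl⟩
      exact isSymm_Qmat (hsymm i) _ _
    · exact fun _ _ _ _ h1 h2 => h1.add h2
    · exact fun k _ _ h => h.smul k
  let B : (Fin n ⊕ Unit → ℝ) →ₗ[ℝ] (Fin n ⊕ Unit → ℝ) →ₗ[ℝ] (Fin 3 → ℝ) :=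
    LinearMap.mk₂ ℝ (fun x y j => x ⬝ᵥ R j *ᵥ y)
      (fun x x' y => by ext j; simp [add_dotProduct])
      (fun k x y => by ext j; simp [smul_dotProduct])
      (fun x y y' => by ext j; simp [mulVec_add, dotProduct_add])
      (fun k x y => by ext j; simp [mulVec_smul, dotProduct_smul])
  have hB : ∀ x y, B x y = B y x := fun x y => by
    ext j
    change x ⬝ᵥ R j *ᵥ y = y ⬝ᵥ R j *ᵥ x
    rw [dotProduct_mulVec, ← mulVec_transpose, (hRsymm j).eq, dotProduct_comm]
  have hBc : Continuous fun w => B w w := by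
    change Continuous fun w : Fin n ⊕ Unit → ℝ => fun j => w ⬝ᵥ R j *ᵥ w
    fun_prop
  have hBQ : ∀ i w, u i ⬝ᵥ B w w = w ⬝ᵥ Qmat (A i) (b i) (c i) *ᵥ w := fun i w => by
    rw [hQ i, sum_mulVec, dotProduct_sum]
    simp only [smul_mulVec, dotProduct_smul, smul_eq_mul]
    rfl
  have hBU : ∀ l w, Fintype.linearCombination ℝ u l ⬝ᵥ B w w =
      w ⬝ᵥ (∑ i, l i • Qmat (A i) (b i) (c i)) *ᵥ w := fun l w => by
    rw [dotProduct_comm, dotProduct_linearCombination, sum_mulVec, dotProduct_sum]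
    simp only [smul_mulVec, dotProduct_smul, smul_eq_mul, ← hBQ, dotProduct_comm (B w w)]
  have hBθ : ∀ w, w ≠ 0 → 0 < Fintype.linearCombination ℝ u θ ⬝ᵥ B w w := fun w hw => by
    rw [hBU]
    simpa using hθ.dotProduct_mulVec_pos hw
  obtain ⟨x₀, hx₀⟩ := id hS
  let ψ : Fin 3 → ℝ := -B (homogenize x₀) (homogenize x₀)
  have hψ : ∀ i, 0 < ψ ⬝ᵥ u i := fun i => by
    rw [neg_dotProduct, dotProduct_comm, hBQ, homogenize_dotProduct_Qmat]
    exact neg_pos.mpr (hx₀ i)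
  have hψθ : ψ ⬝ᵥ Fintype.linearCombination ℝ u θ < 0 := by
    rw [neg_dotProduct, dotProduct_comm]
    exact neg_neg_of_pos (hBθ _ (homogenize_ne_zero x₀))
  obtain ⟨F, hFsub, hFfin, hFcard, hF⟩ := exists_finite_supportedAggregations
    (P := homogenize '' Sset A b c) hBc hψ
  have hFΩ : F ⊆ Omega A b c := fun l hl => by
    obtain ⟨h0, h1, φ, -, hφ, hw⟩ := hFsub hl
    refine mem_Omega_of_nonneg_on_ker hsymm h0 ?_ (fun x hx => hφ _ ⟨x, hx, rfl⟩)
      fun w h => by rw [← hBU]; exact hw w h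
    rintro rfl
    simp at h1
  refine ⟨F, hFΩ, hFfin, by simpa using hFcard, Subset.antisymm
    (subset_iInter₂ fun l hl => (hFΩ hl).2.2.1) fun y hy => ?_⟩
  by_contra hyS
  obtain ⟨φ, hφ1, hφy, hφS⟩ := exists_separating_hyperplane hS hyS
  obtain ⟨l, hl, hl0, hlw⟩ := exists_aggregation_nonneg_on_ker (u := u)
    (by simp; omega) hB hBθ (φ := φ) fun w hw => by
      simp only [hBQ]
      exact exists_nonneg_of_mem_hyperplane hφy hφS hw
  obtain ⟨a, μ, hμ, hμa, hμy⟩ := exists_facet_aggregation (P := homogenize '' Sset A b c) hU hψ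
    hBθ hψθ hφ1 (by rintro _ ⟨x, hx, rfl⟩; exact (hφS x hx).le) hl hl0 hlw
    (homogenize_ne_zero y) hφy
  obtain ⟨p, hp, hpy⟩ := hF a μ hμ hμa _ hμy
  have hlt : ∑ i, p i * qf (A i) (b i) (c i) y < 0 := mem_iInter₂.mp hy p hp
  rw [dotProduct_comm, dotProduct_linearCombination] at hpy
  simp only [dotProduct_comm (B _ _), hBQ, homogenize_dotProduct_Qmat] at hpy
  exact absurd hpy (not_le.mpr hlt)

end
end

section
/- (1) Any two symmetric n×n real matrices Q_1, Q_2 with n ≥ 2 satisfy hidden hyperplane convexity. (2) If Q_1, Q_2, Q_3 are symmetric n×n real matrices with n ≥ 4 satisfying PDLC (some linear combination θ_1Q_1 + θ_2Q_2 + θ_3Q_3 is positive definite), then Q_1, Q_2, Q_3 satisfy hidden hyperplane convexity. -/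
open Matrix Set

noncomputable section

section BilinearForms

variable {E : Type*} [AddCommGroup E] [Module ℝ E]

open LinearMap (BilinForm)

/-- A quadratic form changing sign between `x` and `y` vanishes somewhere on the segment `[x, y]`. -/
lemma exists_zero_on_segment (F : BilinForm ℝ E) {x y : E}
    (hx : 0 ≤ F x x) (hy : F y y ≤ 0) :
    ∃ s ∈ Icc (0 : ℝ) 1, F ((1 - s) • x + s • y) ((1 - s) • x + s • y) = 0 := by
  have hc : ContinuousOn
      (fun s : ℝ => F ((1 - s) • x + s • y) ((1 - s) • x + s • y)) (Icc 0 1) := by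
    simp only [map_add, map_smul, LinearMap.add_apply, LinearMap.smul_apply, smul_eq_mul]
    fun_prop
  exact intermediate_value_Icc' zero_le_one hc ⟨by simpa using hy, by simpa using hx⟩

/-- If `x`, `y` span a `B`-isotropic plane, then a form `F` changing sign between `x` and `y`
has a common nontrivial zero with `B`. -/
lemma exists_common_zero_of_orthogonal {B F : BilinForm ℝ E} (hB : ∀ x y, B x y = B y x)
    (hF : ∀ x y, F x y = F y x) {x y : E}
    (hBx : B x x = 0) (hBy : B y y = 0) (hBxy : B x y = 0) (hx : 0 < F x x) (hy : F y y < 0) :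
    ∃ z, z ≠ 0 ∧ B z z = 0 ∧ F z z = 0 := by
  obtain ⟨s, ⟨hs0, hs1⟩, hs⟩ := exists_zero_on_segment F hx.le hy.le
  refine ⟨_, fun hz => ?_, ?_, hs⟩
  · have h1 : (1 - s) * F x x + s * F y x = 0 := by simpa using congrArg (fun z => F z x) hz
    have h2 : (1 - s) * F x y + s * F y y = 0 := by simpa using congrArg (fun z => F z y) hz
    rw [hF x y] at h2
    have h3 : (1 - s) ^ 2 * F x x = s ^ 2 * F y y := by linear_combination (1 - s) * h1 - s * h2
    have h4 : s = 0 := by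
      by_contra h
      have : s ^ 2 * F y y < 0 := mul_neg_of_pos_of_neg (by positivity) hy
      have : 0 ≤ (1 - s) ^ 2 * F x x := by positivity
      linarith
    subst h4
    simp at h3
    linarith
  · simp [hBx, hBy, hBxy, hB y x]

/-- In dimension at least three, if `x`, `y` are `B`-isotropic and `F` changes sign between them,
then `B` and `F` have a common nontrivial zero. -/
lemma exists_common_zero_s15 [Module.Finite ℝ E] (hE : 3 ≤ Module.finrank ℝ E)
    {B F : BilinForm ℝ E} (hB : ∀ x y, B x y = B y x) (hF : ∀ x y, F x y = F y x) {x y : E}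
    (hBx : B x x = 0) (hBy : B y y = 0) (hx : 0 < F x x) (hy : F y y < 0) :
    ∃ z, z ≠ 0 ∧ B z z = 0 ∧ F z z = 0 := by
  by_cases hb : B x y = 0
  · exact exists_common_zero_of_orthogonal hB hF hBx hBy hb hx hy
  obtain ⟨w, hw, hw0⟩ := Submodule.exists_mem_ne_zero_of_ne_bot
    (LinearMap.ker_ne_bot_of_finrank_lt (f := (B x).prod (B y))
      (by rw [Module.finrank_prod, Module.finrank_self]; omega))
  obtain ⟨hxw, hyw⟩ : B x w = 0 ∧ B y w = 0 := by simpa using hw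
  have hwx := hB w x
  have hwy := hB w y
  have hyx := hB y x
  by_cases hc : B w w = 0
  · rcases lt_trichotomy (F w w) 0 with h | h | h
    · exact exists_common_zero_of_orthogonal hB hF hBx hc hxw hx h
    · exact ⟨w, hw0, hc, h⟩
    · exact exists_common_zero_of_orthogonal hB hF hc hBy (by rw [hwy, hyw]) h hy
  obtain ⟨σ, κ, hσ, hκ⟩ : ∃ σ κ : ℝ, σ ^ 2 = 1 ∧ 2 * σ * B x y + κ ^ 2 * B w w = 0 := by
    rcases le_total 0 (B x y / B w w) with h | h
    · refine ⟨-1, √(2 * (B x y / B w w)), by norm_num, ?_⟩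
      rw [Real.sq_sqrt (by positivity)]
      field_simp
      ring
    · refine ⟨1, √(-(2 * (B x y / B w w))), by norm_num, ?_⟩
      rw [Real.sq_sqrt (by linarith)]
      field_simp
      ring
  let γ : ℝ → E := fun s => (1 - s) ^ 2 • x + (σ * s ^ 2) • y + (κ * (s * (1 - s))) • w
  have hcont : ContinuousOn (fun s => F (γ s) (γ s)) (Icc 0 1) := by
    simp only [γ, map_add, map_smul, LinearMap.add_apply, LinearMap.smul_apply, smul_eq_mul]
    fun_prop
  obtain ⟨s, -, hs⟩ := intermediate_value_Icc' zero_le_one hcont (show (0 : ℝ) ∈ _ from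
    ⟨by simp [γ]; nlinarith, by simp [γ, hx.le]⟩)
  refine ⟨γ s, fun hz => ?_, ?_, hs⟩
  · have h1 : B x (γ s) = 0 := by rw [hz, map_zero]
    have h2 : B y (γ s) = 0 := by rw [hz, map_zero]
    have hσ0 : σ ≠ 0 := by rintro rfl; norm_num at hσ
    have h3 : s = 0 := by simpa [γ, hBx, hxw, hb, hσ0] using h1
    simp [γ, hyx, hb, h3] at h2
  · simp only [γ, map_add, map_smul, LinearMap.add_apply, LinearMap.smul_apply, smul_eq_mul,
      hBx, hBy, hxw, hyw, hwx, hwy, hyx]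
    linear_combination (s ^ 2 * (1 - s) ^ 2) * hκ

/-- Rescaling a preimage: values that are a nonnegative multiple of attained ones
are attained. -/
lemma exists_apply_self_eq_of_scaled {κ : Type*} (Q : κ → BilinForm ℝ E) {w : κ → ℝ} {c : ℝ}
    (hc : 0 ≤ c) {z : E} (h : ∀ k, w k = c * Q k z z) : ∃ z', ∀ k, Q k z' z' = w k := by
  refine ⟨√c • z, fun k => ?_⟩
  rw [h k]
  simp only [map_smul, LinearMap.smul_apply, smul_eq_mul]
  rw [← mul_assoc, Real.mul_self_sqrt hc]

/-- Dines' theorem: the joint image of two quadratic forms is convex. -/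
theorem dines (Q : Fin 2 → BilinForm ℝ E) (hQ : ∀ k x y, Q k x y = Q k y x) (x y : E)
    {a b : ℝ} (ha : 0 < a) (hb : 0 < b) :
    ∃ z, ∀ k, Q k z z = a * Q k x x + b * Q k y y := by
  obtain ⟨u, hu⟩ : ∃ u : Fin 2 → ℝ, ∀ k, Q k x x = u k := ⟨_, fun _ => rfl⟩
  obtain ⟨v, hv⟩ : ∃ v : Fin 2 → ℝ, ∀ k, Q k y y = v k := ⟨_, fun _ => rfl⟩
  simp only [hu, hv]
  have hscale : ∀ (t : Fin 2 → ℝ) (z : E), (∀ k, Q k z z = t k) →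
      (∃ c, 0 ≤ c ∧ ∀ k, a * u k + b * v k = c * t k) →
      ∃ z, ∀ k, Q k z z = a * u k + b * v k := by
    rintro t z hz ⟨c, hc, h⟩
    exact exists_apply_self_eq_of_scaled Q hc (z := z) fun k => by rw [hz, h]
  obtain ⟨D, hD⟩ : ∃ D, D = u 0 * v 1 - u 1 * v 0 := ⟨_, rfl⟩
  by_cases hD0 : D = 0
  · by_cases hu0 : u = 0
    · exact hscale v y hv ⟨b, hb.le, fun k => by simp [hu0]⟩
    obtain ⟨c, hc⟩ : ∃ c, ∀ k, v k = c * u k := by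
      obtain ⟨i, hi⟩ := Function.ne_iff.mp hu0
      refine ⟨v i / u i, fun k => ?_⟩
      have hi : u i ≠ 0 := hi
      field_simp
      fin_cases i <;> fin_cases k <;> simp <;> linarith
    rcases le_or_gt 0 (a + b * c) with h | h
    · exact hscale u x hu ⟨a + b * c, h, fun k => by rw [hc]; ring⟩
    · have hc0 : c < 0 := by
        by_contra! h'
        have := mul_nonneg hb.le h'
        linarith
      refine hscale v y hv ⟨(a + b * c) / c, (div_pos_of_neg_of_neg h hc0).le, fun k => ?_⟩
      rw [hc]
      field_simp [hc0.ne]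
  obtain ⟨w, hw⟩ : ∃ w : Fin 2 → ℝ, ∀ k, a * u k + b * v k = w k := ⟨_, fun _ => rfl⟩
  simp only [hw] at hscale ⊢
  have hD2 : 0 < D ^ 2 := by positivity
  let F : BilinForm ℝ E := (D * w 1) • Q 0 - (D * w 0) • Q 1
  let G : BilinForm ℝ E := (D * (v 1 - u 1)) • Q 0 - (D * (v 0 - u 0)) • Q 1
  obtain ⟨y', hy', hGy'⟩ : ∃ y', (∀ k, Q k y' y' = v k) ∧ 0 ≤ G x y' := by
    rcases le_total 0 (G x y) with h | h
    · exact ⟨y, hv, h⟩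
    · exact ⟨-y, by simpa using hv, by simpa using h⟩
  have hFx : F x x = b * D ^ 2 := by
    simp only [F, LinearMap.sub_apply, LinearMap.smul_apply, smul_eq_mul, hu, ← hw]
    rw [hD]; ring
  have hFy : F y' y' = -(a * D ^ 2) := by
    simp only [F, LinearMap.sub_apply, LinearMap.smul_apply, smul_eq_mul, hy', ← hw]
    rw [hD]; ring
  have hGx : G x x = D ^ 2 := by
    simp only [G, LinearMap.sub_apply, LinearMap.smul_apply, smul_eq_mul, hu]
    rw [hD]; ring
  have hGy : G y' y' = D ^ 2 := by
    simp only [G, LinearMap.sub_apply, LinearMap.smul_apply, smul_eq_mul, hy']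
    rw [hD]; ring
  have hGxy : G y' x = G x y' := by
    simp only [G, LinearMap.sub_apply, LinearMap.smul_apply, hQ _ y' x]
  obtain ⟨s, ⟨hs0, hs1⟩, hs⟩ := exists_zero_on_segment F (x := x) (y := y')
    (by rw [hFx]; positivity) (by rw [hFy]; simp only [Left.neg_nonpos_iff]; positivity)
  set z := (1 - s) • x + s • y' with hz
  have hGz : 0 < G z z := by
    have h1 : G z z = D ^ 2 * ((1 - s) ^ 2 + s ^ 2) + 2 * (s * (1 - s) * G x y') := by
      simp only [hz, map_add, map_smul, LinearMap.add_apply, LinearMap.smul_apply, smul_eq_mul,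
        hGx, hGy, hGxy]
      ring
    have h2 : 0 ≤ s * (1 - s) * G x y' := mul_nonneg (mul_nonneg hs0 (by linarith)) hGy'
    have h3 : 0 < (1 - s) ^ 2 + s ^ 2 := by nlinarith [sq_nonneg (1 - 2 * s)]
    have h4 := mul_pos hD2 h3
    linarith
  have hFz : w 1 * Q 0 z z = w 0 * Q 1 z z := by
    have : D * (w 1 * Q 0 z z - w 0 * Q 1 z z) = 0 := by
      rw [← hs]
      simp only [F, LinearMap.sub_apply, LinearMap.smul_apply, smul_eq_mul]
      ring
    linarith [(mul_eq_zero.mp this).resolve_left hD0]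
  refine hscale (fun k => Q k z z) z (fun _ => rfl)
    ⟨(a + b) * D ^ 2 / G z z, by positivity, fun k => ?_⟩
  rw [div_mul_eq_mul_div, eq_div_iff hGz.ne']
  have hGw : D * (v 1 - u 1) * w 0 - D * (v 0 - u 0) * w 1 = (a + b) * D ^ 2 := by
    simp only [← hw]
    rw [hD]; ring
  rw [← hGw]
  simp only [G, LinearMap.sub_apply, LinearMap.smul_apply, smul_eq_mul]
  fin_cases k <;> simp only [Fin.zero_eta, Fin.mk_one, Fin.isValue]
  · linear_combination D * (v 0 - u 0) * hFz
  · linear_combination D * (v 1 - u 1) * hFz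

/-- Two vectors in `ℝ³` orthogonal to `l ≠ 0` and coplanar with `l` are parallel. -/
lemma mul_eq_mul_of_cross_dot_eq_zero {l q w : Fin 3 → ℝ} (hl : l ≠ 0) (hq : l ⬝ᵥ q = 0)
    (hw : l ⬝ᵥ w = 0) (h : (l ⨯₃ w) ⬝ᵥ q = 0) (i j : Fin 3) : q i * w j = q j * w i := by
  have hpos : l 0 ^ 2 + l 1 ^ 2 + l 2 ^ 2 ≠ 0 := by
    intro h0
    refine hl (funext fun i => ?_)
    have : l i ^ 2 = 0 := by
      fin_cases i <;> simp <;> nlinarith [sq_nonneg (l 0), sq_nonneg (l 1), sq_nonneg (l 2)]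
    simpa using this
  simp only [cross_apply, vec3_dotProduct, Fin.isValue, cons_val_zero, cons_val_one, cons_val]
    at hq hw h
  have h01 : q 0 * w 1 = q 1 * w 0 := by
    refine sub_eq_zero.mp ((mul_eq_zero.mp ?_).resolve_left hpos)
    linear_combination -l 2 * h + (l 0 * w 1 - l 1 * w 0) * hq - (l 0 * q 1 - l 1 * q 0) * hw
  have h12 : q 1 * w 2 = q 2 * w 1 := by
    refine sub_eq_zero.mp ((mul_eq_zero.mp ?_).resolve_left hpos)
    linear_combination -l 0 * h + (l 1 * w 2 - l 2 * w 1) * hq - (l 1 * q 2 - l 2 * q 1) * hw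
  have h02 : q 0 * w 2 = q 2 * w 0 := by
    refine sub_eq_zero.mp ((mul_eq_zero.mp ?_).resolve_left hpos)
    linear_combination l 1 * h + (l 0 * w 2 - l 2 * w 0) * hq - (l 0 * q 2 - l 2 * q 0) * hw
  fin_cases i <;> fin_cases j <;> simp <;> linarith

/-- Polyak's theorem: in dimension at least three, the joint image of three quadratic forms with a
positive definite linear combination is convex. -/
theorem polyak [Module.Finite ℝ E] (hE : 3 ≤ Module.finrank ℝ E) (Q : Fin 3 → BilinForm ℝ E)
    (hQ : ∀ k x y, Q k x y = Q k y x) (θ : Fin 3 → ℝ)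
    (hθ : ∀ x, x ≠ 0 → 0 < ∑ k, θ k * Q k x x) (x y : E) {a b : ℝ} (ha : 0 < a) (hb : 0 < b) :
    ∃ z, ∀ k, Q k z z = a * Q k x x + b * Q k y y := by
  rcases eq_or_ne x 0 with rfl | hx
  · exact exists_apply_self_eq_of_scaled Q hb.le (z := y) fun k => by simp
  rcases eq_or_ne y 0 with rfl | hy
  · exact exists_apply_self_eq_of_scaled Q ha.le (z := x) fun k => by simp
  obtain ⟨u, hu⟩ : ∃ u : Fin 3 → ℝ, ∀ k, Q k x x = u k := ⟨_, fun _ => rfl⟩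
  obtain ⟨v, hv⟩ : ∃ v : Fin 3 → ℝ, ∀ k, Q k y y = v k := ⟨_, fun _ => rfl⟩
  obtain ⟨w, hw⟩ : ∃ w : Fin 3 → ℝ, ∀ k, a * u k + b * v k = w k := ⟨_, fun _ => rfl⟩
  simp only [hu, hv, hw]
  have hθw : 0 < ∑ k, θ k * w k := by
    have h1 := hθ x hx
    have h2 := hθ y hy
    simp only [hu, hv] at h1 h2
    have h3 : ∑ k, θ k * w k = a * ∑ k, θ k * u k + b * ∑ k, θ k * v k := by
      simp only [← hw, Fin.sum_univ_three]
      ring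
    rw [h3]
    positivity
  suffices ∃ z, z ≠ 0 ∧ ∀ i j, Q i z z * w j = Q j z z * w i by
    obtain ⟨z, hz, h⟩ := this
    have hθz := hθ z hz
    refine exists_apply_self_eq_of_scaled Q (div_pos hθw hθz).le (z := z) fun k => ?_
    rw [div_mul_eq_mul_div, eq_div_iff hθz.ne', Finset.mul_sum, Finset.sum_mul]
    exact Finset.sum_congr rfl fun j _ => by linear_combination θ j * h j k
  obtain ⟨l, hl⟩ : ∃ l, l = u ⨯₃ v := ⟨_, rfl⟩
  have hlk := fun k => congrFun hl k
  simp only [cross_apply, Fin.forall_fin_succ, Fin.isValue, cons_val_zero, cons_val_one, cons_val,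
    Fin.succ_zero_eq_one, Fin.succ_one_eq_two, IsEmpty.forall_iff, and_true] at hlk
  obtain ⟨hl0, hl1, hl2⟩ := hlk
  by_cases hl' : l = 0
  · refine ⟨x, hx, fun i j => ?_⟩
    simp only [hl', Pi.zero_apply] at hl0 hl1 hl2
    simp only [hu, ← hw]
    fin_cases i <;> fin_cases j <;> simp <;> grind
  have hpos : 0 < l ⬝ᵥ l := by simpa using Matrix.dotProduct_star_self_pos_iff.mpr hl'
  let B : BilinForm ℝ E := ∑ k, l k • Q k
  let F : BilinForm ℝ E := -∑ k, (l ⨯₃ w) k • Q k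
  have hBz : ∀ z, B z z = l ⬝ᵥ fun k => Q k z z := fun z => by
    simp [B, dotProduct, LinearMap.sum_apply]
  have hFz : ∀ z, F z z = -((l ⨯₃ w) ⬝ᵥ fun k => Q k z z) := fun z => by
    simp only [F, dotProduct, LinearMap.sum_apply, LinearMap.neg_apply, LinearMap.smul_apply,
      smul_eq_mul]
  have hlu : l ⬝ᵥ u = 0 := by rw [hl, dotProduct_comm, dot_self_cross]
  have hlv : l ⬝ᵥ v = 0 := by rw [hl, dotProduct_comm, dot_cross_self]
  have hlw : l ⬝ᵥ w = 0 := by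
    have : w = a • u + b • v := funext fun k => (hw k).symm
    rw [this, dotProduct_add, dotProduct_smul, dotProduct_smul, hlu, hlv]
    simp
  obtain ⟨z, hz, hBz0, hFz0⟩ := exists_common_zero_s15 hE (B := B) (F := F) (x := x) (y := y)
    (fun x y => by simp only [B, LinearMap.sum_apply, LinearMap.smul_apply, hQ _ x y])
    (fun x y => by
      simp only [F, LinearMap.sum_apply, LinearMap.neg_apply, LinearMap.smul_apply, hQ _ x y])
    (by simpa only [hBz, hu] using hlu) (by simpa only [hBz, hv] using hlv)
    (by
      have : F x x = b * (l ⬝ᵥ l) := by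
        simp only [hFz, hu, cross_apply, vec3_dotProduct, ← hw, Fin.isValue, cons_val_zero,
          cons_val_one, cons_val, hl0, hl1, hl2]
        ring
      rw [this]
      positivity)
    (by
      have : F y y = -(a * (l ⬝ᵥ l)) := by
        simp only [hFz, hv, cross_apply, vec3_dotProduct, ← hw, Fin.isValue, cons_val_zero,
          cons_val_one, cons_val, hl0, hl1, hl2]
        ring
      rw [this]
      exact neg_neg_of_pos (mul_pos ha hpos))
  rw [hBz] at hBz0
  rw [hFz, neg_eq_zero] at hFz0
  exact ⟨z, hz, mul_eq_mul_of_cross_dot_eq_zero hl' hBz0 hlw hFz0⟩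

end BilinearForms

/-- Convexity of the image of a subspace, expressed through restricted bilinear forms. -/
lemma convex_quadImage_of_bilinForm {n : ℕ} {κ : Type*} (Q : κ → Matrix (Fin n) (Fin n) ℝ)
    (H : Submodule ℝ (Fin n → ℝ))
    (h : ∀ (x y : H) (a b : ℝ), 0 < a → 0 < b → ∃ z : H, ∀ k,
      (Matrix.toBilin' (Q k)).restrict H z z =
        a * (Matrix.toBilin' (Q k)).restrict H x x + b * (Matrix.toBilin' (Q k)).restrict H y y) :
    Convex ℝ (quadImage Q (H : Set (Fin n → ℝ))) := by
  rw [convex_iff_forall_pos]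
  rintro _ ⟨x, hx, rfl⟩ _ ⟨y, hy, rfl⟩ a b ha hb -
  obtain ⟨z, hz⟩ := h ⟨x, hx⟩ ⟨y, hy⟩ a b ha hb
  exact ⟨z, z.2, funext fun k => by simpa [Matrix.toBilin'_apply'] using hz k⟩

lemma restrict_toBilin'_comm {n : ℕ} {Q : Matrix (Fin n) (Fin n) ℝ} (hQ : Q.IsSymm)
    (H : Submodule ℝ (Fin n → ℝ)) (x y : H) :
    (Matrix.toBilin' Q).restrict H x y = (Matrix.toBilin' Q).restrict H y x := by
  simp only [LinearMap.BilinForm.restrict_apply, LinearMap.domRestrict_apply,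
    Matrix.toBilin'_apply']
  rw [dotProduct_comm, Matrix.dotProduct_mulVec, ← Matrix.mulVec_transpose, hQ.eq, dotProduct_comm]

lemma IsLinearHyperplane.le_finrank_add_one {V : Type*} [AddCommGroup V] [Module ℝ V]
    [Module.Finite ℝ V] {H : Submodule ℝ V} (hH : IsLinearHyperplane H) :
    Module.finrank ℝ V ≤ Module.finrank ℝ H + 1 := by
  obtain ⟨φ, -, rfl⟩ := hH
  have h1 := φ.finrank_range_add_finrank_ker
  have h2 := Submodule.finrank_le (LinearMap.range φ)
  rw [Module.finrank_self] at h2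
  omega

/-- Any two symmetric matrices (`n ≥ 2`) satisfy HHC, and any three symmetric matrices
(`n ≥ 4`) satisfying PDLC satisfy HHC. -/
theorem statement15 (n : ℕ) :
    (∀ Q₁ Q₂ : Matrix (Fin n) (Fin n) ℝ, 2 ≤ n → Q₁.IsSymm → Q₂.IsSymm →
      HHC ![Q₁, Q₂]) ∧
    (∀ Q₁ Q₂ Q₃ : Matrix (Fin n) (Fin n) ℝ, 4 ≤ n → Q₁.IsSymm → Q₂.IsSymm → Q₃.IsSymm →
      (∃ θ : Fin 3 → ℝ, (θ 0 • Q₁ + θ 1 • Q₂ + θ 2 • Q₃).PosDef) →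
      HHC ![Q₁, Q₂, Q₃]) := by
  refine ⟨fun Q₁ Q₂ _ h₁ h₂ H _ => convex_quadImage_of_bilinForm _ H fun x y a b ha hb => ?_,
    fun Q₁ Q₂ Q₃ hn h₁ h₂ h₃ ⟨θ, hθ⟩ H hH =>
      convex_quadImage_of_bilinForm _ H fun x y a b ha hb => ?_⟩
  · exact dines (fun k => (Matrix.toBilin' (![Q₁, Q₂] k)).restrict H)
      (fun k => restrict_toBilin'_comm (by fin_cases k <;> assumption) H) x y ha hb
  · have hdim := hH.le_finrank_add_one
    rw [Module.finrank_fin_fun] at hdim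
    refine polyak (by omega) (fun k => (Matrix.toBilin' (![Q₁, Q₂, Q₃] k)).restrict H)
      (fun k => restrict_toBilin'_comm (by fin_cases k <;> assumption) H) θ (fun x hx => ?_)
      x y ha hb
    have := hθ.dotProduct_mulVec_pos (x := (x : Fin n → ℝ)) (by simpa using hx)
    simpa [Fin.sum_univ_three, Matrix.toBilin'_apply', Matrix.add_mulVec, Matrix.smul_mulVec]
      using this

end
end

section
/- Let n ≥ 2 and define the quadratic forms f_0(x) = Σ_{i=1}^n x_i² and f_i(x) = x_1x_i for 1 ≤ i ≤ n on ℝⁿ. Then the image of the quadratic map (f_0, f_1,…,f_n) : ℝⁿ → ℝ^{n+1} equals {(y_0, y_1,…,y_n) ∈ ℝ^{n+1} : y_0y_1 = Σ_{i=1}^n y_i², y_0 ≥ 0, y_1 ≥ 0}, and this set is the image of the boundary of the second-order cone {(z_0,…,z_n) : z_0² = Σ_{i=1}^n z_i², z_0 ≥ 0} under an invertible linear map of ℝ^{n+1}. -/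
open Matrix Set

noncomputable section

/-- The linear automorphism `z ↦ (2z₀, z₀ + z₁, z₂, …)`, which carries the quadratic form
`z₀² - Σ zᵢ²` to `y₀y₁ - Σ yᵢ²`. -/
def coneEquiv (m : ℕ) : (Fin (m + 2) → ℝ) ≃ₗ[ℝ] (Fin (m + 2) → ℝ) where
  toFun z := Fin.cons (2 * z 0) (Fin.cons (z 0 + z 1) fun i => z i.succ.succ)
  invFun y := Fin.cons (y 0 / 2) (Fin.cons (y 1 - y 0 / 2) fun i => y i.succ.succ)
  map_add' z w := by
    ext i
    refine Fin.cases ?_ (fun i => Fin.cases ?_ (fun i => ?_) i) i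
    · simp [mul_add]
    · simp only [Fin.cons_succ, Fin.cons_zero, Pi.add_apply]; ring
    · simp
  map_smul' c z := by
    ext i
    refine Fin.cases ?_ (fun i => Fin.cases ?_ (fun i => ?_) i) i
    · simp [mul_left_comm]
    · simp [mul_add]
    · simp
  left_inv z := by
    ext i
    refine Fin.cases ?_ (fun i => Fin.cases ?_ (fun i => ?_) i) i <;>
      simp only [← Fin.succ_zero_eq_one, Fin.cons_succ, Fin.cons_zero] <;> ring
  right_inv z := by
    ext i
    refine Fin.cases ?_ (fun i => Fin.cases ?_ (fun i => ?_) i) i <;>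
      simp only [← Fin.succ_zero_eq_one, Fin.cons_succ, Fin.cons_zero] <;> ring

theorem coneEquiv_apply_zero {m : ℕ} (z : Fin (m + 2) → ℝ) : coneEquiv m z 0 = 2 * z 0 := rfl

theorem coneEquiv_apply_one {m : ℕ} (z : Fin (m + 2) → ℝ) : coneEquiv m z 1 = z 0 + z 1 := rfl

theorem coneEquiv_apply_succ_succ {m : ℕ} (z : Fin (m + 2) → ℝ) (i : Fin m) :
    coneEquiv m z i.succ.succ = z i.succ.succ := rfl

theorem coneEquiv_mem_iff {m : ℕ} (z : Fin (m + 2) → ℝ) :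
    (coneEquiv m z 0 * coneEquiv m z 1 = ∑ i : Fin (m + 1), coneEquiv m z i.succ ^ 2 ∧
        0 ≤ coneEquiv m z 0 ∧ 0 ≤ coneEquiv m z 1) ↔
      z 0 ^ 2 = ∑ i : Fin (m + 1), z i.succ ^ 2 ∧ 0 ≤ z 0 := by
  simp only [Fin.sum_univ_succ, Fin.succ_zero_eq_one, coneEquiv_apply_zero, coneEquiv_apply_one,
    coneEquiv_apply_succ_succ]
  have hS : 0 ≤ ∑ i : Fin m, z i.succ.succ ^ 2 := Finset.sum_nonneg fun _ _ => sq_nonneg _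
  constructor
  · rintro ⟨h, h0, -⟩
    exact ⟨by linarith, by linarith⟩
  · rintro ⟨h, h0⟩
    have := abs_le_of_sq_le_sq' (a := z 1) (b := z 0) (by linarith) h0
    exact ⟨by linarith, by linarith, by linarith⟩

theorem range_sum_sq_cons_mul (m : ℕ) :
    Set.range (fun x : Fin (m + 2) → ℝ =>
        (Fin.cons (∑ i, x i ^ 2) (fun i => x 0 * x i) : Fin (m + 3) → ℝ)) =
      {y : Fin (m + 3) → ℝ |
        y 0 * y 1 = ∑ i : Fin (m + 2), y i.succ ^ 2 ∧ 0 ≤ y 0 ∧ 0 ≤ y 1} := by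
  ext y
  simp only [mem_range, mem_ofPred_eq]
  constructor
  · rintro ⟨x, rfl⟩
    simp only [← Fin.succ_zero_eq_one, Fin.cons_succ, Fin.cons_zero]
    refine ⟨?_, Finset.sum_nonneg fun _ _ => sq_nonneg _, mul_self_nonneg _⟩
    simp only [mul_pow, ← Finset.mul_sum]
    ring
  · rintro ⟨h, h0, h1⟩
    rcases h1.eq_or_lt with h1 | h1
    · have hz : ∀ i : Fin (m + 2), y i.succ = 0 := by
        rw [← h1, mul_zero, eq_comm, Finset.sum_eq_zero_iff_of_nonneg fun _ _ => sq_nonneg _] at h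
        exact fun i => by simpa using h i (Finset.mem_univ i)
      refine ⟨Pi.single 1 √(y 0), ?_⟩
      ext i
      refine Fin.cases ?_ (fun i => ?_) i
      · rw [Fin.cons_zero, Finset.sum_eq_single 1]
        · simp [h0]
        · intro b _ hb
          simp [hb]
        · simp
      · simp [hz]
    · have hs : √(y 1) ≠ 0 := (Real.sqrt_pos.2 h1).ne'
      refine ⟨fun i => y i.succ / √(y 1), ?_⟩
      ext i
      refine Fin.cases ?_ (fun i => ?_) i
      · simp only [Fin.cons_zero, div_pow, ← Finset.sum_div, ← h, Real.sq_sqrt h1.le]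
        field_simp
      · simp only [Fin.cons_succ, Fin.succ_zero_eq_one, Real.div_sqrt]
        field_simp

/-- The image of the quadratic map `x ↦ (Σ xᵢ², x₁x₁, …, x₁xₙ)` is the set
`{y : y₀y₁ = Σᵢ₌₁ⁿ yᵢ², y₀ ≥ 0, y₁ ≥ 0}`, which is the image of the boundary of the
second-order cone under an invertible linear map. -/
theorem statement16 (n : ℕ) (hn : 2 ≤ n) :
    (Set.range (fun x : Fin n → ℝ =>
        (Fin.cons (∑ i, x i ^ 2) (fun i : Fin n => x ⟨0, by omega⟩ * x i) : Fin (n + 1) → ℝ)) =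
      {y : Fin (n + 1) → ℝ | y 0 * y 1 = ∑ i : Fin n, y i.succ ^ 2 ∧ 0 ≤ y 0 ∧ 0 ≤ y 1}) ∧
    ∃ L : (Fin (n + 1) → ℝ) ≃ₗ[ℝ] (Fin (n + 1) → ℝ),
      {y : Fin (n + 1) → ℝ | y 0 * y 1 = ∑ i : Fin n, y i.succ ^ 2 ∧ 0 ≤ y 0 ∧ 0 ≤ y 1} =
        L '' {z : Fin (n + 1) → ℝ | z 0 ^ 2 = ∑ i : Fin n, z i.succ ^ 2 ∧ 0 ≤ z 0} := by
  obtain ⟨m, rfl⟩ := Nat.exists_eq_add_of_le' hn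
  refine ⟨range_sum_sq_cons_mul m, coneEquiv (m + 1), ?_⟩
  rw [LinearEquiv.image_eq_preimage_symm]
  ext y
  simpa using coneEquiv_mem_iff ((coneEquiv (m + 1)).symm y)

end
end

section
/- Let C ⊆ ℝⁿ be a closed convex set with nonempty interior that contains no lines (i.e., there is no x ∈ C and nonzero v ∈ ℝⁿ with x + tv ∈ C for all t ∈ ℝ). Let π : ℝⁿ → ℝᵐ be a linear map with nontrivial kernel. Then π(∂C) = π(C); in particular, π(∂C) is convex. -/
open Set

/-- For a closed convex set `C` with nonempty interior containing no lines, and a linear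
map `π` with nontrivial kernel, the image of the boundary of `C` under `π` equals the
image of `C`; in particular it is convex. -/
theorem statement17 (n m : ℕ) (C : Set (Fin n → ℝ))
    (hclosed : IsClosed C) (hconv : Convex ℝ C) (hint : (interior C).Nonempty)
    (hlines : ¬ ∃ x ∈ C, ∃ v : Fin n → ℝ, v ≠ 0 ∧ ∀ t : ℝ, x + t • v ∈ C)
    (π : (Fin n → ℝ) →ₗ[ℝ] (Fin m → ℝ)) (hker : LinearMap.ker π ≠ ⊥) :
    π '' frontier C = π '' C ∧ Convex ℝ (π '' frontier C) := by
  have himage : π '' frontier C = π '' C := by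
    refine (image_mono hclosed.frontier_subset).antisymm ?_
    rintro _ ⟨x, hx, rfl⟩
    obtain ⟨v, hv, hv0⟩ := (Submodule.ne_bot_iff _).1 hker
    have hcont : Continuous fun t : ℝ => x + t • v := by fun_prop
    obtain ⟨t, ht⟩ : (frontier ((fun t : ℝ => x + t • v) ⁻¹' C)).Nonempty := by
      refine nonempty_frontier_iff.2 ⟨⟨0, by simpa using hx⟩, fun huniv => ?_⟩
      exact hlines ⟨x, hx, v, hv0, eq_univ_iff_forall.1 huniv⟩
    exact ⟨x + t • v, hcont.frontier_preimage_subset C ht, by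
      simp [LinearMap.mem_ker.1 hv]⟩
  exact ⟨himage, himage ▸ hconv.linear_image π⟩
end

section
/- Fix integers n > m ≥ 2. Let f_0,…,f_m : ℝⁿ → ℝ be quadratic forms such that f_0 is positive definite, and suppose there exists a linear form ℓ : ℝⁿ → ℝ such that for all 1 ≤ i ≤ m, f_i(x) = ℓ(x)ℓ_i(x) for some linear form ℓ_i : ℝⁿ → ℝ. Then the set {(f_0(x), f_1(x),…,f_m(x)) : x ∈ ℝⁿ} ⊆ ℝ^{m+1} is convex. -/
open Matrix Set

noncomputable section

namespace LinearMap.BilinForm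

variable {V W : Type*} [AddCommGroup V] [Module ℝ V] [AddCommGroup W] [Module ℝ W]
  {B : LinearMap.BilinForm ℝ V}

lemma apply_smul_add_smul_self (hB : ∀ x y, B x y = B y x) (p q : ℝ) (x y : V) :
    B (p • x + q • y) (p • x + q • y) = p ^ 2 * B x x + 2 * p * q * B x y + q ^ 2 * B y y := by
  simp only [map_add, map_smul, LinearMap.add_apply, LinearMap.smul_apply, smul_eq_mul, hB y x]
  ring

/-- If `c` lies between the value of the form at `z` and infinity, it is attained at a point with
the same value of `ℓ • L`, obtained by moving along the kernel of `L`. -/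
lemma exists_apply_self_eq_of_le (hB : ∀ x y, B x y = B y x) (hpos : ∀ x, x ≠ 0 → 0 < B x x)
    (ℓ : V →ₗ[ℝ] ℝ) (L : V →ₗ[ℝ] W) {e : V} (he : e ≠ 0) (hLe : L e = 0) {z : V} {c : ℝ}
    (hz : ℓ z = 0 → L z = 0) (hc : B z z ≤ c) :
    ∃ w, B w w = c ∧ ℓ w • L w = ℓ z • L z := by
  have hE := hpos e he
  have hnn : ∀ x, 0 ≤ B x x := fun x => by
    rcases eq_or_ne x 0 with rfl | hx
    · simp
    · exact (hpos x hx).le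
  have hlow : ∀ p q : ℝ, q ^ 2 * B e e / 2 - p ^ 2 * B z z
      ≤ B (p • z + q • e) (p • z + q • e) := fun p q => by
    have h := hnn ((2 * p) • z + q • e)
    rw [apply_smul_add_smul_self hB] at h ⊢
    linarith
  by_cases h0 : ℓ e = 0 ∨ ℓ z = 0
  · have hcont : ContinuousOn (fun r : ℝ => B ((1 : ℝ) • z + r • e) ((1 : ℝ) • z + r • e))
        (Icc 0 (1 + 2 * (c + B z z) / B e e)) := by
      simp only [apply_smul_add_smul_self hB]
      fun_prop
    have hq : 0 ≤ 2 * (c + B z z) / B e e := by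
      have := hnn z
      have : 0 ≤ c := this.trans hc
      positivity
    obtain ⟨r, -, hr⟩ := intermediate_value_Icc (by linarith) hcont (show c ∈ Icc _ _ by
      refine ⟨by simpa using hc, le_trans ?_ (hlow _ _)⟩
      have h1 : 2 * (c + B z z) / B e e * B e e = 2 * (c + B z z) := by field_simp
      generalize 2 * (c + B z z) / B e e = k at *
      nlinarith [mul_nonneg (sq_nonneg k) hE.le, mul_nonneg hq hE.le])
    refine ⟨_, hr, ?_⟩
    rcases h0 with h | h
    · simp [h, hLe]
    · simp [h, hz h, hLe]
  · push Not at h0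
    obtain ⟨hℓe, hℓz⟩ := h0
    set s := ℓ z / ℓ e with hs
    have hs0 : s ≠ 0 := div_ne_zero hℓz hℓe
    have hsE : 0 < s ^ 2 * B e e := by positivity
    set k := 8 * (c + B z z) / (s ^ 2 * B e e) with hk
    have hk0 : 0 ≤ k := by
      have := hnn z
      have : 0 ≤ c := this.trans hc
      positivity
    have hcont : ContinuousOn (fun r : ℝ => B (r⁻¹ • z + (s * (r - r⁻¹)) • e)
        (r⁻¹ • z + (s * (r - r⁻¹)) • e)) (Icc 1 (2 + k)) := by
      have hinv : ContinuousOn (fun r : ℝ => r⁻¹) (Icc 1 (2 + k)) :=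
        continuousOn_inv₀.mono fun r hr => by
          have := hr.1
          simp only [mem_compl_iff, mem_singleton_iff]
          linarith
      simp only [apply_smul_add_smul_self hB]
      fun_prop
    obtain ⟨r, hrm, hr⟩ := intermediate_value_Icc (by linarith) hcont (show c ∈ Icc _ _ by
      refine ⟨by simpa using hc, le_trans ?_ (hlow _ _)⟩
      have h1 : k * (s ^ 2 * B e e) = 8 * (c + B z z) := by rw [hk]; field_simp
      have hi : (2 + k)⁻¹ ≤ 1 := inv_le_one_of_one_le₀ (by linarith)
      have hi0 : 0 ≤ (2 + k)⁻¹ := by positivity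
      generalize (2 + k)⁻¹ = i at *
      have h2 : k / 4 ≤ (2 + k - i) ^ 2 / 2 := by nlinarith
      have h3 : i ^ 2 * B z z ≤ B z z :=
        mul_le_of_le_one_left (hnn z) (pow_le_one₀ hi0 hi)
      have h4 := mul_le_mul_of_nonneg_right h2 hsE.le
      have h5 := hnn z
      have h6 : (s * (2 + k - i)) ^ 2 * B e e / 2
        = (2 + k - i) ^ 2 / 2 * (s ^ 2 * B e e) := by ring
      linarith)
    have hr0 : r ≠ 0 := by
      have := hrm.1
      intro h
      linarith
    refine ⟨_, hr, ?_⟩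
    have hℓ : ℓ (r⁻¹ • z + (s * (r - r⁻¹)) • e) = r * ℓ z := by
      simp only [map_add, map_smul, smul_eq_mul, hs]
      field_simp
      ring
    rw [hℓ]
    simp only [map_add, map_smul, hLe, smul_zero, add_zero, smul_smul]
    congr 1
    field_simp

/-- The joint range of a positive definite form and `ℓ • L` is closed under convex combinations
when `L` has a nontrivial kernel. -/
lemma exists_apply_self_eq_convexCombination (hB : ∀ x y, B x y = B y x)
    (hpos : ∀ x, x ≠ 0 → 0 < B x x) (ℓ : V →ₗ[ℝ] ℝ) (L : V →ₗ[ℝ] W) {e : V} (he : e ≠ 0)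
    (hLe : L e = 0) (x y : V) {a b : ℝ} (ha : 0 ≤ a) (hb : 0 ≤ b) (hab : a + b = 1) :
    ∃ w, B w w = a * B x x + b * B y y ∧
      ℓ w • L w = a • (ℓ x • L x) + b • (ℓ y • L y) := by
  have hnn : ∀ x, 0 ≤ B x x := fun x => by
    rcases eq_or_ne x 0 with rfl | hx
    · simp
    · exact (hpos x hx).le
  have hS : 0 ≤ a * ℓ x ^ 2 + b * ℓ y ^ 2 := by positivity
  rcases hS.eq_or_lt with h0 | hSpos
  · have h1 : 0 ≤ a * ℓ x ^ 2 := by positivity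
    have h2 : 0 ≤ b * ℓ y ^ 2 := by positivity
    have hx : a * ℓ x = 0 := by
      have : a * ℓ x ^ 2 = 0 := by linarith
      simpa using this
    have hy : b * ℓ y = 0 := by
      have : b * ℓ y ^ 2 = 0 := by linarith
      simpa using this
    obtain ⟨w, hw, hw'⟩ := exists_apply_self_eq_of_le hB hpos ℓ L he hLe (z := 0)
      (c := a * B x x + b * B y y) (by simp) (by
        have := mul_nonneg ha (hnn x)
        have := mul_nonneg hb (hnn y)
        simp only [map_zero]
        linarith)
    exact ⟨w, hw, by simp [hw', smul_smul, hx, hy]⟩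
  · obtain ⟨s, hs, hs2⟩ : ∃ s : ℝ, 0 < s ∧ s ^ 2 = a * ℓ x ^ 2 + b * ℓ y ^ 2 :=
      ⟨√(a * ℓ x ^ 2 + b * ℓ y ^ 2), Real.sqrt_pos.2 hSpos, Real.sq_sqrt hS⟩
    set z := (a * ℓ x / s) • x + (b * ℓ y / s) • y with hz
    have hℓz : ℓ z = s := by
      simp only [hz, map_add, map_smul, smul_eq_mul]
      field_simp
      linarith
    obtain ⟨w, hw, hw'⟩ := exists_apply_self_eq_of_le hB hpos ℓ L he hLe (z := z)
      (c := a * B x x + b * B y y) (fun h => absurd (hℓz.symm.trans h) hs.ne') (by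
        have h := mul_nonneg (mul_nonneg ha hb) (hnn ((ℓ y) • x + (-ℓ x) • y))
        rw [apply_smul_add_smul_self hB] at h
        rw [hz, apply_smul_add_smul_self hB]
        have hba : b = 1 - a := by linarith
        have key : s ^ 2 * ((a * ℓ x / s) ^ 2 * B x x + 2 * (a * ℓ x / s) * (b * ℓ y / s) * B x y
            + (b * ℓ y / s) ^ 2 * B y y) = (a * ℓ x) ^ 2 * B x x
            + 2 * (a * ℓ x) * (b * ℓ y) * B x y + (b * ℓ y) ^ 2 * B y y := by
          field_simp
        refine le_of_mul_le_mul_left ?_ (pow_pos hs 2)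
        rw [key, hs2]
        subst hba
        linarith)
    refine ⟨w, hw, ?_⟩
    rw [hw', hℓz]
    simp only [hz, map_add, map_smul, smul_add, smul_smul]
    congr 2 <;> field_simp

end LinearMap.BilinForm

/-- If `n > m ≥ 2`, `f₀` is a positive definite quadratic form, and each `fᵢ`
(`1 ≤ i ≤ m`) factors as `ℓ(x)·ℓᵢ(x)` for a common linear form `ℓ`, then the image of
the quadratic map `(f₀,…,f_m)` is convex. -/
theorem statement18 (n m : ℕ) (hm : 2 ≤ m) (hn : m < n)
    (Q : Fin (m + 1) → Matrix (Fin n) (Fin n) ℝ) (hsymm : ∀ i, (Q i).IsSymm)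
    (hpd : ∀ x : Fin n → ℝ, x ≠ 0 → 0 < x ⬝ᵥ (Q 0).mulVec x)
    (ℓ : (Fin n → ℝ) →ₗ[ℝ] ℝ)
    (hfact : ∀ i : Fin m, ∃ ℓi : (Fin n → ℝ) →ₗ[ℝ] ℝ,
      ∀ x, x ⬝ᵥ (Q i.succ).mulVec x = ℓ x * ℓi x) :
    Convex ℝ (Set.range fun x : Fin n → ℝ => fun k => x ⬝ᵥ (Q k).mulVec x) := by
  choose ℓi hℓi using hfact
  have hB : ∀ x y, Matrix.toBilin' (Q 0) x y = x ⬝ᵥ (Q 0).mulVec y :=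
    fun x y => Matrix.toBilin'_apply' _ _ _
  obtain ⟨e, heL, he⟩ := (Submodule.ne_bot_iff _).1
    (LinearMap.ker_ne_bot_of_finrank_lt (f := LinearMap.pi ℓi) (by simpa using hn))
  rintro _ ⟨x, rfl⟩ _ ⟨y, rfl⟩ a b ha hb hab
  obtain ⟨w, hw, hw'⟩ := LinearMap.BilinForm.exists_apply_self_eq_convexCombination
    (B := Matrix.toBilin' (Q 0))
    (fun x y => by
      rw [hB, hB, dotProduct_mulVec, ← mulVec_transpose, (hsymm 0).eq, dotProduct_comm])
    (fun x hx => by rw [hB]; exact hpd x hx) ℓ (LinearMap.pi ℓi) he heL x y ha hb hab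
  refine ⟨w, funext fun k => ?_⟩
  cases k using Fin.cases with
  | zero => simpa [hB] using hw
  | succ i => simpa [hℓi] using congrFun hw' i

end
end
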